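/- arXiv:1312.0670 — 5 statements merged into one kernel-verified Lean document; each statement's English description precedes it below -/
import Mathlib

section
/- If a model of arithmetic N₀ ⊨ PA admits a full satisfaction class, then N₀ has an elementary extension N admitting at least two distinct (incompatible) full satisfaction classes. -/
open FirstOrder FirstOrder.Language FirstOrder.Language.Structure

/-- The function symbols of the language of arithmetic `{0, 1, +, ·}`. -/
inductive ArithFunc : ℕ → Type
  | zero : ArithFunc 0
  | one : ArithFunc 0
  | add : ArithFunc 2
  | mul : ArithFunc 2
  deriving DecidableEq

/-- The relation symbols of the language of arithmetic: `<`. -/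
inductive ArithRel : ℕ → Type
  | lt : ArithRel 2
  deriving DecidableEq

/-- The first-order language of arithmetic `⟨+, ·, 0, 1, <⟩`. -/
def Larith : FirstOrder.Language := ⟨ArithFunc, ArithRel⟩

namespace Larith

variable {N : Type*} [Larith.Structure N]

/-- The interpretation of `+` in an `Larith`-structure. -/
def addF (x y : N) : N := funMap (L := Larith) ArithFunc.add ![x, y]
/-- The interpretation of `·` in an `Larith`-structure. -/
def mulF (x y : N) : N := funMap (L := Larith) ArithFunc.mul ![x, y]
/-- The interpretation of `0` in an `Larith`-structure. -/
def zeroF : N := funMap (L := Larith) ArithFunc.zero ![]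
/-- The interpretation of `1` in an `Larith`-structure. -/
def oneF : N := funMap (L := Larith) ArithFunc.one ![]
/-- The interpretation of `<` in an `Larith`-structure. -/
def ltF (x y : N) : Prop := RelMap (L := Larith) ArithRel.lt ![x, y]

/-- The value of the standard numeral `n̄ = 1 + 1 + ⋯ + 1` (`n` times) in `N`. -/
def natE : ℕ → N
  | 0 => zeroF
  | n + 1 => addF (natE n) oneF

/-- `N` is a model of Peano arithmetic: the `PA⁻` axioms of a discretely ordered commutative
semiring, together with the full first-order induction scheme, stated semantically for every
formula of the language of arithmetic with parameters. -/
def IsPAModel (N : Type*) [Larith.Structure N] : Prop :=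
  (∀ x y z : N, addF (addF x y) z = addF x (addF y z)) ∧
  (∀ x y : N, addF x y = addF y x) ∧
  (∀ x : N, addF x zeroF = x) ∧
  (∀ x y z : N, mulF (mulF x y) z = mulF x (mulF y z)) ∧
  (∀ x y : N, mulF x y = mulF y x) ∧
  (∀ x : N, mulF x oneF = x) ∧
  (∀ x : N, mulF x zeroF = zeroF) ∧
  (∀ x y z : N, mulF x (addF y z) = addF (mulF x y) (mulF x z)) ∧
  (∀ x : N, ¬ ltF x x) ∧
  (∀ x y z : N, ltF x y → ltF y z → ltF x z) ∧
  (∀ x y : N, ltF x y ∨ x = y ∨ ltF y x) ∧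
  (∀ x y z : N, ltF x y → ltF (addF x z) (addF y z)) ∧
  (∀ x y z : N, ltF x y → ltF zeroF z → ltF (mulF x z) (mulF y z)) ∧
  (∀ x y : N, ltF x y ↔ ∃ z : N, ltF zeroF z ∧ addF x z = y) ∧
  (ltF (zeroF : N) oneF) ∧
  (∀ x : N, ltF zeroF x → ltF oneF x ∨ oneF = x) ∧
  (∀ x : N, x = zeroF ∨ ltF zeroF x) ∧
  (∀ (k : ℕ) (φ : Larith.BoundedFormula (Fin k) 1) (v : Fin k → N),
    φ.Realize v ![zeroF] → (∀ x : N, φ.Realize v ![x] → φ.Realize v ![addF x oneF]) →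
    ∀ x : N, φ.Realize v ![x])

/-- `N` is a nonstandard model: some element is not the value of any standard numeral. -/
def IsNonstandard (N : Type*) [Larith.Structure N] : Prop :=
  ∃ x : N, ∀ n : ℕ, natE n ≠ x

end Larith

open Larith

/-- A Gödelized syntax scheme: first-order formulas of the language of arithmetic describing
the internal (arithmetized) syntax of arithmetic inside a model: the class of (codes of)
internal sentences, atomic sentences and their truth, and the graphs of the syntactic
operations of conjunction, negation, existential quantification and substitution of a
numeral into a formula with one free variable. -/
structure SatScheme : Type where
  /-- `x` is (the code of) an internal sentence -/
  sent : Larith.Formula (Fin 1)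
  /-- `x` is an internal atomic sentence -/
  atom : Larith.Formula (Fin 1)
  /-- the internal atomic sentence `x` is true (atomic truth is definable) -/
  atomTrue : Larith.Formula (Fin 1)
  /-- `z` is the conjunction of the internal sentences `x` and `y` -/
  conj : Larith.Formula (Fin 3)
  /-- `y` is the negation of the internal sentence `x` -/
  neg : Larith.Formula (Fin 2)
  /-- `y` is the existential quantification of the internal formula `x` (one free variable) -/
  exist : Larith.Formula (Fin 2)
  /-- `z` is the result of substituting the numeral of `y` into the internal formula `x` -/
  subst : Larith.Formula (Fin 3)

/-- `Tr` is a full satisfaction class (truth predicate) on the model `N`, with respect to the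
internal syntax given by the scheme `S`: a set of internal sentences satisfying the recursive
Tarskian truth conditions for atomic sentences, conjunction, negation, and existential
quantification (witnessed by substituted numerals). -/
def IsSatClass (S : SatScheme) (N : Type*) [Larith.Structure N] (Tr : Set N) : Prop :=
  (∀ a ∈ Tr, S.sent.Realize ![a]) ∧
  (∀ a : N, S.atom.Realize ![a] → (a ∈ Tr ↔ S.atomTrue.Realize ![a])) ∧
  (∀ σ τ c : N, S.sent.Realize ![σ] → S.sent.Realize ![τ] → S.conj.Realize ![σ, τ, c] →
    (c ∈ Tr ↔ σ ∈ Tr ∧ τ ∈ Tr)) ∧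
  (∀ σ c : N, S.sent.Realize ![σ] → S.neg.Realize ![σ, c] → (c ∈ Tr ↔ σ ∉ Tr)) ∧
  (∀ φ c : N, S.exist.Realize ![φ, c] →
    (c ∈ Tr ↔ ∃ n s : N, S.subst.Realize ![φ, n, s] ∧ s ∈ Tr))

/-- `X` is definable in `N` by a formula of the language of arithmetic with parameters. -/
def DefinableWithParams (N : Type*) [Larith.Structure N] (X : Set N) : Prop :=
  ∃ (k : ℕ) (φ : Larith.BoundedFormula (Fin k) 1) (v : Fin k → N),
    ∀ x : N, x ∈ X ↔ φ.Realize v ![x]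

section ModelTheory

variable {L : FirstOrder.Language}

/-- If two tuples `u` and `v` of elements of `M` have the same type, then any formula that holds
of elements of `M` also holds of some reinterpretation of these elements taking `u` to `v`. -/
theorem exists_realize_of_same_type {M X : Type*} [L.Structure M] {u v : X → M}
    (huv : ∀ φ : L.Formula X, φ.Realize u ↔ φ.Realize v) (φ : L.Formula M)
    (hφ : φ.Realize id) : ∃ h : M → M, (∀ x, h (u x) = v x) ∧ φ.Realize h := by
  classical
  have heq : ∀ x y, u x = u y → v x = v y := fun x y hxy => by
    have := huv ((Term.var x).equal (Term.var y))
    simpa [hxy] using this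
  let g : φ.freeVarFinset → X ⊕ φ.freeVarFinset := fun m =>
    if hm : ∃ x, u x = m then Sum.inl hm.choose else Sum.inr m
  let ψ : L.Formula (X ⊕ φ.freeVarFinset) := φ.restrictFreeVar g
  have hu : (ψ.iExs φ.freeVarFinset).Realize u := by
    rw [Formula.realize_iExs]
    refine ⟨Subtype.val, (BoundedFormula.realize_restrictFreeVar id fun m => ?_).2 hφ⟩
    by_cases hm : ∃ x, u x = m
    · simpa [g, hm] using hm.choose_spec
    · simp [g, hm]
  rw [huv, Formula.realize_iExs] at hu
  obtain ⟨i, hi⟩ := hu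
  let h : M → M := fun m => if hm : ∃ x, u x = m then v hm.choose else
    if hf : m ∈ φ.freeVarFinset then i ⟨m, hf⟩ else m
  refine ⟨h, fun x => ?_, (BoundedFormula.realize_restrictFreeVar h fun m => ?_).1 hi⟩
  · have hx : ∃ y, u y = u x := ⟨x, rfl⟩
    simpa only [h, hx, dif_pos] using heq _ _ hx.choose_spec
  · by_cases hm : ∃ x, u x = m
    · simp [g, h, hm]
    · simp [g, h, hm]

/-- The point of the ultrapower of `M` represented by a family of elements of `M`. -/
def ultrapowerMk {I M : Type*} (U : Ultrafilter I) (r : I → M) :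
    (U : Filter I).Product fun _ => M :=
  Quotient.mk'' r

theorem realize_ultrapowerMk {I M α : Type*} [L.Structure M] [Nonempty M] {U : Ultrafilter I}
    (φ : L.Formula α) (x : α → I → M) :
    (φ.Realize fun i => ultrapowerMk U (x i)) ↔
      ∀ᶠ s in (U : Filter I), φ.Realize fun i => x i s :=
  Ultraproduct.realize_formula_cast (u := U) (M := fun _ => M) φ x

theorem exists_ultrapowerMk {I M : Type*} {U : Ultrafilter I}
    (x : (U : Filter I).Product fun _ => M) : ∃ r, ultrapowerMk U r = x :=
  Quotient.exists_rep x

/-- A map into an ultrapower of `M`, given by a family of self-maps of `M` that almost always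
preserve any given formula, is an elementary embedding. -/
def ultrapowerEmbedding {I M : Type*} [L.Structure M] [Nonempty M] (U : Ultrafilter I)
    (h : I → M → M)
    (hh : ∀ φ : L.Formula M, φ.Realize id → ∀ᶠ s in (U : Filter I), φ.Realize (h s)) :
    M ↪ₑ[L] (U : Filter I).Product fun _ => M where
  toFun m := ultrapowerMk U fun s => h s m
  map_formula' n φ x := by
    refine (realize_ultrapowerMk φ fun i s => h s (x i)).trans ⟨fun H => ?_, fun H => ?_⟩
    · by_contra hc
      have := hh (φ.relabel x).not
        (Formula.realize_not.2 (mt (Formula.realize_relabel (v := id)).1 hc))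
      obtain ⟨s, h₁, h₂⟩ := (H.and this).exists
      exact Formula.realize_not.1 h₂ (Formula.realize_relabel.2 h₁)
    · filter_upwards [hh (φ.relabel x) (Formula.realize_relabel.2 H)] with s hs
      exact Formula.realize_relabel.1 hs

/-- The union of an elementary chain is an elementary extension of each of its members. -/
theorem exists_elementary_chain_limit (M : ℕ → Type) [∀ n, L.Structure (M n)]
    (f : ∀ n, M n ↪ₑ[L] M (n + 1)) :
    ∃ (N : Type) (_ : L.Structure N) (g : ∀ n, M n ↪ₑ[L] N),
      (∀ n x, g (n + 1) (f n x) = g n x) ∧ ∀ x, ∃ n y, g n y = x := by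
  let F := DirectedSystem.natLERec fun n => (f n).toEmbedding
  let g := fun n => DirectLimit.of L ℕ M F n
  have hstep : ∀ n x, g (n + 1) (f n x) = g n x := fun n x => by
    rw [← DirectLimit.of_f (hij := n.le_succ)]
    congr 1
    simp [F, Nat.leRecOn_succ']
  have hle : ∀ m n (_ : m ≤ n), ∃ F' : M m ↪ₑ[L] M n, ∀ x, g n (F' x) = g m x := by
    intro m n hmn
    induction n, hmn using Nat.le_induction with
    | base => exact ⟨ElementaryEmbedding.refl L _, fun x => rfl⟩
    | succ n _ ih =>
      obtain ⟨F', hF'⟩ := ih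
      exact ⟨(f n).comp F', fun x => (hstep n _).trans (hF' x)⟩
  have helem : ∀ {α : Type} {k : ℕ} (φ : L.BoundedFormula α k) (n : ℕ) (v : α → M n)
      (xs : Fin k → M n), φ.Realize (g n ∘ v) (g n ∘ xs) ↔ φ.Realize v xs := by
    intro α k φ
    induction φ with
    | falsum => intros; rfl
    | equal t₁ t₂ =>
      intro n v xs
      simp only [BoundedFormula.Realize, ← Sum.comp_elim, HomClass.realize_term]
      exact (g n).injective.eq_iff
    | rel R ts =>
      intro n v xs
      simp only [BoundedFormula.Realize, ← Sum.comp_elim, HomClass.realize_term]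
      exact (g n).map_rel R _
    | imp _ _ ih₁ ih₂ =>
      intro n v xs
      simp only [BoundedFormula.Realize, ih₁, ih₂]
    | all φ ih =>
      intro n v xs
      simp only [BoundedFormula.Realize]
      refine ⟨fun H a => ?_, fun H z => ?_⟩
      · rw [← ih, Fin.comp_snoc]
        exact H _
      · obtain ⟨m, y, rfl⟩ := Language.DirectLimit.exists_of z
        obtain ⟨A, hA⟩ := hle n (max m n) (le_max_right _ _)
        obtain ⟨B, hB⟩ := hle m (max m n) (le_max_left _ _)
        have e₁ : g n ∘ v = g (max m n) ∘ (A ∘ v) := funext fun i => (hA _).symm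
        have e₂ : g n ∘ xs = g (max m n) ∘ (A ∘ xs) := funext fun i => (hA _).symm
        have e₃ : DirectLimit.of L ℕ M F m y = g (max m n) (B y) := (hB y).symm
        rw [e₁, e₂, e₃, ← Fin.comp_snoc, ih]
        exact (A.map_boundedFormula φ.all v xs).2 H _
  refine ⟨Language.DirectLimit M F, inferInstance,
    fun n => ⟨g n, fun k φ x => ?_⟩, hstep, Language.DirectLimit.exists_of⟩
  have := helem φ n x default
  rwa [Subsingleton.elim (g n ∘ default) default] at this

/-- If `T` is not definable with parameters, then there are points inside and outside `T` on
which any given finitely many formulas with parameters agree. -/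
theorem exists_agree_of_not_definable {M : Type*} [L.Structure M] {T : Set M}
    (hT : ∀ ψ : L.Formula (M ⊕ Unit), ∃ x, ¬ (x ∈ T ↔ ψ.Realize (Sum.elim id fun _ => x)))
    (s : Finset (L.Formula (M ⊕ Unit))) :
    ∃ a ∈ T, ∃ b ∉ T, ∀ φ ∈ s,
      φ.Realize (Sum.elim id fun _ => a) ↔ φ.Realize (Sum.elim id fun _ => b) := by
  classical
  let pat : M → Set s := fun x => {φ | φ.1.Realize (Sum.elim id fun _ => x)}
  let ψ : L.Formula (M ⊕ Unit) := Formula.iSup fun t : (pat '' T : Set (Set s)) =>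
    Formula.iInf fun φ : s => if φ ∈ t.1 then φ.1 else φ.1.not
  have hψ : ∀ x, ψ.Realize (Sum.elim id fun _ => x) ↔ pat x ∈ pat '' T := by
    intro x
    have hp : ∀ t : Set s, (∀ φ : s,
        (if φ ∈ t then φ.1 else φ.1.not).Realize (Sum.elim id fun _ => x)) ↔ t = pat x := by
      intro t
      rw [Set.ext_iff]
      refine forall_congr' fun φ => ?_
      by_cases h : φ ∈ t <;> simp [h, pat]
    simp only [ψ, Formula.realize_iSup, Formula.realize_iInf, hp]
    exact ⟨fun ⟨t, ht⟩ => ht ▸ t.2, fun h => ⟨⟨_, h⟩, rfl⟩⟩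
  obtain ⟨x, hx⟩ := hT ψ
  rw [hψ] at hx
  have hxT : x ∉ T := fun h => hx ⟨fun _ => Set.mem_image_of_mem _ h, fun _ => h⟩
  have hpx : pat x ∈ pat '' T := by
    by_contra h
    exact hx ⟨fun h' => absurd h' hxT, fun h' => absurd h' h⟩
  obtain ⟨a, ha, hax⟩ := hpx
  exact ⟨a, ha, x, hxT, fun φ hφ => Set.ext_iff.1 hax ⟨φ, hφ⟩⟩

/-- The ultrapower of a subset. -/
def ultrapowerSet {I M : Type*} (U : Ultrafilter I) (T : Set M) :
    Set ((U : Filter I).Product fun _ => M) :=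
  {x | ∃ r, ultrapowerMk U r = x ∧ ∀ᶠ s in (U : Filter I), r s ∈ T}

theorem ultrapowerMk_mem_ultrapowerSet {I M : Type*} {U : Ultrafilter I} {T : Set M} {r : I → M} :
    ultrapowerMk U r ∈ ultrapowerSet U T ↔
      ∀ᶠ s in (U : Filter I), r s ∈ T := by
  refine ⟨fun ⟨r', h, h'⟩ => ?_, fun h => ⟨r, rfl, h⟩⟩
  have : ∀ᶠ s in (U : Filter I), r' s = r s := Quotient.eq''.1 h
  filter_upwards [this, h'] with s h₁ h₂
  rwa [← h₁]

end ModelTheory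

theorem exists_not_iff_of_not_definableWithParams {M : Type*} [Larith.Structure M] {T : Set M}
    (hT : ¬ DefinableWithParams M T) (ψ : Larith.Formula (M ⊕ Unit)) :
    ∃ x, ¬ (x ∈ T ↔ ψ.Realize (Sum.elim id fun _ => x)) := by
  classical
  by_contra! H
  by_cases hM : IsEmpty M
  · exact hT ⟨0, ⊥, Fin.elim0, fun x => hM.elim x⟩
  rw [not_isEmpty_iff] at hM
  let e := Fintype.equivFin ψ.freeVarFinset
  let g : ψ.freeVarFinset → Fin (Fintype.card ψ.freeVarFinset) ⊕ Fin 1 := fun p =>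
    Sum.elim (fun _ => Sum.inl (e p)) (fun _ => Sum.inr 0) p.1
  let v : Fin (Fintype.card ψ.freeVarFinset) → M := fun i =>
    Sum.elim id (fun _ => Classical.arbitrary M) (e.symm i).1
  let ψ' : Larith.Formula (Fin (Fintype.card ψ.freeVarFinset) ⊕ Fin 1) := ψ.restrictFreeVar g
  refine hT ⟨_, BoundedFormula.relabel (k := 0) id ψ', v, fun x => (H x).trans ?_⟩
  rw [BoundedFormula.realize_relabel, Subsingleton.elim (![x] ∘ Fin.natAdd 1 : Fin 0 → M) default]
  refine (BoundedFormula.realize_restrictFreeVar _ ?_).symm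
  rintro ⟨p | p, hp⟩
  · simp [g, v]
  · simp [g]

/-- The ultrapower of a full satisfaction class is a full satisfaction class. -/
theorem IsSatClass.ultrapower {S : SatScheme} {I M : Type*} [Larith.Structure M] [Nonempty M]
    (U : Ultrafilter I) {T : Set M} (hT : IsSatClass S M T) :
    IsSatClass S ((U : Filter I).Product fun _ => M) (ultrapowerSet U T) := by
  have key : ∀ {n : ℕ} (φ : Larith.Formula (Fin n)) (x : Fin n → I → M)
      (y : Fin n → (U : Filter I).Product fun _ => M)
      (_ : ∀ i, y i = ultrapowerMk U (x i)) (z : I → Fin n → M)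
      (_ : ∀ s i, z s i = x i s),
      φ.Realize y ↔ ∀ᶠ s in (U : Filter I), φ.Realize (z s) := by
    intro n φ x y hy z hz
    obtain rfl : y = _ := funext hy
    obtain rfl : z = fun s i => x i s := funext fun s => funext (hz s)
    exact realize_ultrapowerMk φ x
  have key₁ : ∀ (φ : Larith.Formula (Fin 1)) (a : I → M),
      φ.Realize ![ultrapowerMk U a] ↔
        ∀ᶠ s in (U : Filter I), φ.Realize ![a s] := fun φ a =>
    key φ ![a] _ (by simp) _ (by simp)
  have key₂ : ∀ (φ : Larith.Formula (Fin 2)) (a b : I → M),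
      φ.Realize ![ultrapowerMk U a, ultrapowerMk U b] ↔
        ∀ᶠ s in (U : Filter I), φ.Realize ![a s, b s] := fun φ a b =>
    key φ ![a, b] _ (by simp [Fin.forall_fin_succ]) _ (by simp [Fin.forall_fin_succ])
  have key₃ : ∀ (φ : Larith.Formula (Fin 3)) (a b c : I → M),
      φ.Realize ![ultrapowerMk U a, ultrapowerMk U b, ultrapowerMk U c] ↔
        ∀ᶠ s in (U : Filter I), φ.Realize ![a s, b s, c s] := fun φ a b c =>
    key φ ![a, b, c] _ (by simp [Fin.forall_fin_succ]) _ (by simp [Fin.forall_fin_succ])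
  obtain ⟨h₁, h₂, h₃, h₄, h₅⟩ := hT
  refine ⟨fun a => ?_, fun a => ?_, fun a b c => ?_, fun a b => ?_, fun a b => ?_⟩
  · obtain ⟨a, rfl⟩ := exists_ultrapowerMk a
    intro h
    exact (key₁ _ a).2 ((ultrapowerMk_mem_ultrapowerSet.1 h).mono fun s => h₁ _)
  · obtain ⟨a, rfl⟩ := exists_ultrapowerMk a
    intro h
    refine ultrapowerMk_mem_ultrapowerSet.trans (Iff.trans ?_ (key₁ _ a).symm)
    exact Filter.eventually_congr (((key₁ _ a).1 h).mono fun s => h₂ _)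
  · obtain ⟨a, rfl⟩ := exists_ultrapowerMk a
    obtain ⟨b, rfl⟩ := exists_ultrapowerMk b
    obtain ⟨c, rfl⟩ := exists_ultrapowerMk c
    intro ha hb hc
    refine ultrapowerMk_mem_ultrapowerSet.trans (Iff.trans ?_
      (and_congr ultrapowerMk_mem_ultrapowerSet ultrapowerMk_mem_ultrapowerSet).symm)
    rw [← Filter.eventually_and]
    refine Filter.eventually_congr ?_
    filter_upwards [(key₁ _ a).1 ha, (key₁ _ b).1 hb, (key₃ _ a b c).1 hc] with s
    exact h₃ _ _ _
  · obtain ⟨a, rfl⟩ := exists_ultrapowerMk a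
    obtain ⟨b, rfl⟩ := exists_ultrapowerMk b
    intro ha hb
    refine ultrapowerMk_mem_ultrapowerSet.trans (Iff.trans ?_
      (not_congr ultrapowerMk_mem_ultrapowerSet).symm)
    rw [← Ultrafilter.eventually_not]
    refine Filter.eventually_congr ?_
    filter_upwards [(key₁ _ a).1 ha, (key₂ _ a b).1 hb] with s
    exact h₄ _ _
  · obtain ⟨a, rfl⟩ := exists_ultrapowerMk a
    obtain ⟨b, rfl⟩ := exists_ultrapowerMk b
    intro hab
    have hab' := (key₂ _ a b).1 hab
    refine ultrapowerMk_mem_ultrapowerSet.trans ⟨fun hb => ?_, ?_⟩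
    · have hex : ∀ s, ∃ p : M × M, S.exist.Realize ![a s, b s] → b s ∈ T →
          S.subst.Realize ![a s, p.1, p.2] ∧ p.2 ∈ T := fun s => by
        by_cases h : S.exist.Realize ![a s, b s] ∧ b s ∈ T
        · obtain ⟨n, t, h'⟩ := (h₅ _ _ h.1).1 h.2
          exact ⟨(n, t), fun _ _ => h'⟩
        · exact ⟨Classical.arbitrary _, fun h' h'' => absurd ⟨h', h''⟩ h⟩
      choose p hp using hex
      have := (hab'.and hb).mono fun s hs => hp s hs.1 hs.2
      rw [Filter.eventually_and] at this
      exact ⟨ultrapowerMk U fun s => (p s).1, ultrapowerMk U fun s => (p s).2,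
        (key₃ _ a _ _).2 this.1, ultrapowerMk_mem_ultrapowerSet.2 this.2⟩
    · rintro ⟨n, t, h, ht⟩
      obtain ⟨n, rfl⟩ := exists_ultrapowerMk n
      obtain ⟨t, rfl⟩ := exists_ultrapowerMk t
      filter_upwards [hab', (key₃ _ a n t).1 h, ultrapowerMk_mem_ultrapowerSet.1 ht] with s h h' h''
      exact (h₅ _ _ h).2 ⟨_, _, h', h''⟩

/-- The union of full satisfaction classes on an elementary chain is a full satisfaction class on
the limit. -/
theorem IsSatClass.iUnion_image {S : SatScheme} {N : Type*} [Larith.Structure N]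
    {A : ℕ → Type*} [∀ k, Larith.Structure (A k)] {T : ∀ k, Set (A k)}
    (hT : ∀ k, IsSatClass S (A k) (T k)) (g : ∀ k, A k ↪ₑ[Larith] N)
    (hmono : ∀ k x, ∃ y, g (k + 1) y = g k x ∧ (x ∈ T k ↔ y ∈ T (k + 1)))
    (hsurj : ∀ x, ∃ k y, g k y = x) :
    IsSatClass S N (⋃ k, g k '' T k) ∧
      ∀ k x, g k x ∈ (⋃ k, g k '' T k) ↔ x ∈ T k := by
  have hle : ∀ k l, k ≤ l → ∀ x, ∃ y, g l y = g k x ∧ (x ∈ T k ↔ y ∈ T l) := by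
    intro k l hkl
    induction l, hkl using Nat.le_induction with
    | base => exact fun x => ⟨x, rfl, Iff.rfl⟩
    | succ l _ ih =>
      intro x
      obtain ⟨y, hy, hy'⟩ := ih x
      obtain ⟨z, hz, hz'⟩ := hmono l y
      exact ⟨z, hz.trans hy, hy'.trans hz'⟩
  have hcov : ∀ k x, ∃ l, k ≤ l ∧ ∃ y, g l y = x := fun k x => by
    obtain ⟨l, y, rfl⟩ := hsurj x
    obtain ⟨z, hz, -⟩ := hle l (max k l) (le_max_right _ _) y
    exact ⟨_, le_max_left _ _, z, hz⟩
  have hmem : ∀ k x, g k x ∈ (⋃ k, g k '' T k) ↔ x ∈ T k := by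
    intro k x
    refine ⟨fun h => ?_, fun h => Set.mem_iUnion.2 ⟨k, x, h, rfl⟩⟩
    obtain ⟨l, y, hy, hyx⟩ := Set.mem_iUnion.1 h
    obtain ⟨x', hx', hx⟩ := hle k (max k l) (le_max_left _ _) x
    obtain ⟨y', hy', hyy⟩ := hle l (max k l) (le_max_right _ _) y
    obtain rfl : x' = y' := (g _).injective (by rw [hx', hy', hyx])
    exact hx.2 (hyy.1 hy)
  have r₁ : ∀ (φ : Larith.Formula (Fin 1)) k (a : A k),
      φ.Realize ![g k a] ↔ φ.Realize ![a] := fun φ k a => by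
    rw [← (g k).map_formula φ (![a])]
    congr! 1
    simp [funext_iff]
  have r₂ : ∀ (φ : Larith.Formula (Fin 2)) k (a b : A k),
      φ.Realize ![g k a, g k b] ↔ φ.Realize ![a, b] := fun φ k a b => by
    rw [← (g k).map_formula φ (![a, b])]
    congr! 1
    simp [funext_iff, Fin.forall_fin_succ]
  have r₃ : ∀ (φ : Larith.Formula (Fin 3)) k (a b c : A k),
      φ.Realize ![g k a, g k b, g k c] ↔ φ.Realize ![a, b, c] := fun φ k a b c => by
    rw [← (g k).map_formula φ (![a, b, c])]
    congr! 1
    simp [funext_iff, Fin.forall_fin_succ]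
  have cov₂ : ∀ k x y, ∃ l, k ≤ l ∧ ∃ x' y', g l x' = x ∧ g l y' = y := fun k x y => by
    obtain ⟨l, hl, x', rfl⟩ := hcov k x
    obtain ⟨m, hm, y', rfl⟩ := hcov l y
    obtain ⟨x'', hx, -⟩ := hle l m hm x'
    exact ⟨m, hl.trans hm, x'', y', hx, rfl⟩
  refine ⟨⟨fun a => ?_, fun a => ?_, fun a b c => ?_, fun a b => ?_, fun a b => ?_⟩, hmem⟩
  · obtain ⟨k, a, rfl⟩ := hsurj a
    rw [hmem, r₁]
    exact (hT k).1 a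
  · obtain ⟨k, a, rfl⟩ := hsurj a
    rw [hmem, r₁, r₁]
    exact (hT k).2.1 a
  · obtain ⟨k, a, rfl⟩ := hsurj a
    obtain ⟨l, hkl, b, c, rfl, rfl⟩ := cov₂ k b c
    obtain ⟨a, ha, -⟩ := hle k l hkl a
    rw [← ha, hmem, hmem, hmem, r₁, r₁, r₃]
    exact (hT l).2.2.1 a b c
  · obtain ⟨k, -, a, b, rfl, rfl⟩ := cov₂ 0 a b
    rw [hmem, hmem, r₁, r₂]
    exact (hT k).2.2.2.1 a b
  · obtain ⟨k, -, a, b, rfl, rfl⟩ := cov₂ 0 a b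
    intro hab
    rw [r₂] at hab
    constructor
    · rw [hmem]
      intro hb
      obtain ⟨n, t, h, ht⟩ := ((hT k).2.2.2.2 a b hab).1 hb
      exact ⟨g k n, g k t, (r₃ _ _ _ _ _).2 h, (hmem _ _).2 ht⟩
    · rintro ⟨n, t, h, ht⟩
      obtain ⟨l, hkl, n, t, rfl, rfl⟩ := cov₂ k n t
      obtain ⟨a', ha, -⟩ := hle k l hkl a
      obtain ⟨b', hb, -⟩ := hle k l hkl b
      rw [← ha, r₃] at h
      rw [hmem] at ht
      rw [← r₂, ← ha, ← hb, r₂] at hab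
      rw [← hb, hmem]
      exact ((hT l).2.2.2.2 a' b' hab).2 ⟨n, t, h, ht⟩

/-- A structure with a full satisfaction class. -/
structure SatModel (S : SatScheme) where
  /-- the underlying type -/
  carrier : Type
  [str : Larith.Structure carrier]
  /-- the satisfaction class -/
  tr : Set carrier
  isSatClass : IsSatClass S carrier tr

attribute [instance] SatModel.str

/-- A structure with a full satisfaction class and two tuples of elements that have the same
type in the language of arithmetic. -/
structure TwinModel (S : SatScheme) extends SatModel S where
  /-- the index type of the tuples -/
  ι : Type
  /-- the left tuple -/
  left : ι → carrier
  /-- the right tuple -/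
  right : ι → carrier
  same_type : ∀ φ : Larith.Formula ι, φ.Realize left ↔ φ.Realize right

/-- Two tuples of the same type become conjugate in a suitable extension: an elementary embedding
`f` of reducts takes the left tuple to the image of the right one under an elementary embedding
`i` compatible with the satisfaction classes. -/
theorem TwinModel.exists_amalgam {S : SatScheme} (A : TwinModel S) :
    ∃ (B : SatModel S) (f i : A.carrier ↪ₑ[Larith] B.carrier),
      (∀ x, f (A.left x) = i (A.right x)) ∧ ∀ a, i a ∈ B.tr ↔ a ∈ A.tr := by
  classical
  have : Nonempty A.carrier := ⟨zeroF⟩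
  let I := Finset {φ : Larith.Formula A.carrier // φ.Realize id}
  let U : Ultrafilter I := Ultrafilter.of Filter.atTop
  have hU : ∀ φ, ∀ᶠ s in (U : Filter I), φ ∈ s := fun φ =>
    Ultrafilter.of_le Filter.atTop <| (Filter.eventually_ge_atTop {φ}).mono fun s hs =>
      Finset.singleton_subset_iff.1 hs
  have hsel : ∀ s : I, ∃ h : A.carrier → A.carrier, (∀ x, h (A.left x) = A.right x) ∧
      ∀ φ ∈ s, φ.1.Realize h := fun s => by
    obtain ⟨h, h₁, h₂⟩ := exists_realize_of_same_type A.same_type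
      (Formula.iInf fun φ : s => φ.1.1) (by simpa using fun φ hφ _ => hφ)
    rw [Formula.realize_iInf] at h₂
    exact ⟨h, h₁, fun φ hφ => h₂ ⟨φ, hφ⟩⟩
  choose h h₁ h₂ using hsel
  refine ⟨⟨_, ultrapowerSet U A.tr, A.isSatClass.ultrapower U⟩,
    ultrapowerEmbedding U h fun φ hφ => (hU ⟨φ, hφ⟩).mono fun s hs => h₂ s _ hs,
    ultrapowerEmbedding U (fun _ => id) fun φ hφ => Filter.Eventually.of_forall fun _ => hφ,
    fun x => ?_, fun a => ultrapowerMk_mem_ultrapowerSet.trans Filter.eventually_const⟩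
  exact congrArg (ultrapowerMk U) (funext fun s => h₁ s x)

/-- A full satisfaction class that is not definable with parameters has an elementary extension
containing two points of the same type over the original model, only one of which is in the
satisfaction class. -/
theorem IsSatClass.exists_twins {S : SatScheme} {N₀ : Type} [Larith.Structure N₀] {T : Set N₀}
    (hT : IsSatClass S N₀ T) (hundef : ¬ DefinableWithParams N₀ T) :
    ∃ (A : SatModel S) (i : N₀ ↪ₑ[Larith] A.carrier), ∃ a ∈ A.tr, ∃ b ∉ A.tr,
      ∀ φ : Larith.Formula (N₀ ⊕ Unit),
        φ.Realize (Sum.elim i fun _ => a) ↔ φ.Realize (Sum.elim i fun _ => b) := by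
  classical
  have : Nonempty N₀ := ⟨zeroF⟩
  let I := Finset (Larith.Formula (N₀ ⊕ Unit))
  let U : Ultrafilter I := Ultrafilter.of Filter.atTop
  have hU : ∀ φ, ∀ᶠ s in (U : Filter I), φ ∈ s := fun φ =>
    Ultrafilter.of_le Filter.atTop <| (Filter.eventually_ge_atTop {φ}).mono fun s hs =>
      Finset.singleton_subset_iff.1 hs
  choose a ha b hb hab using exists_agree_of_not_definable
    (exists_not_iff_of_not_definableWithParams hundef)
  let i : N₀ ↪ₑ[Larith] (U : Filter I).Product fun _ => N₀ :=
    ultrapowerEmbedding U (fun _ => id) fun φ hφ => Filter.Eventually.of_forall fun _ => hφ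
  have key : ∀ (φ : Larith.Formula (N₀ ⊕ Unit)) (r : I → N₀),
      φ.Realize (Sum.elim i fun _ => ultrapowerMk U r) ↔
        ∀ᶠ s in (U : Filter I), φ.Realize (Sum.elim id fun _ => r s) := fun φ r => by
    convert realize_ultrapowerMk φ (Sum.elim (fun m _ => m) fun _ => r) using 2 with s
    · ext (m | m) <;> rfl
    · funext s
      congr! 1
      ext (m | m) <;> rfl
  refine ⟨⟨_, ultrapowerSet U T, hT.ultrapower U⟩, i, ultrapowerMk U a,
    ultrapowerMk_mem_ultrapowerSet.2 (Filter.Eventually.of_forall ha),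
    ultrapowerMk U b, fun h => ?_, fun φ => ?_⟩
  · obtain ⟨s, hs⟩ := (ultrapowerMk_mem_ultrapowerSet.1 h).exists
    exact hb s hs
  · exact (key φ a).trans ((Filter.eventually_congr ((hU φ).mono fun s hs => hab s φ hs)).trans
      (key φ b).symm)

/-- **Krajewski's theorem.** If a model `N₀` of PA admits a full satisfaction class `Tr₀`
(which, by Tarski's theorem, is never definable with parameters — here recorded as the
hypothesis `hundef`), then `N₀` has an elementary extension `N` admitting at least two
distinct (incompatible) full satisfaction classes. -/
theorem elementary_extension_with_two_satisfaction_classes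
    (S : SatScheme) (N₀ : Type) [Larith.Structure N₀] (hPA : IsPAModel N₀)
    (Tr₀ : Set N₀) (hsat : IsSatClass S N₀ Tr₀) (hundef : ¬ DefinableWithParams N₀ Tr₀) :
    ∃ (N : Type) (inst : Larith.Structure N) (Tr₁ Tr₂ : Set N),
      Nonempty (@FirstOrder.Language.ElementaryEmbedding Larith N₀ N _ inst) ∧
      @IsSatClass S N inst Tr₁ ∧ @IsSatClass S N inst Tr₂ ∧ Tr₁ ≠ Tr₂ := by
  obtain ⟨A, i₀, a, ha, b, hb, hab⟩ := hsat.exists_twins hundef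
  choose B f i hfi hi using TwinModel.exists_amalgam (S := S)
  let next : TwinModel S → TwinModel S := fun A =>
    ⟨B A, A.carrier, f A, i A, fun φ =>
      ((f A).map_formula φ id).trans ((i A).map_formula φ id).symm⟩
  let A₀ : TwinModel S := ⟨A, _, _, _, hab⟩
  let C : ℕ → TwinModel S := fun n => Nat.rec A₀ (fun _ => next) n
  obtain ⟨N, inst, g, hg, hsurj⟩ := exists_elementary_chain_limit
    (fun n => (C n).carrier) (fun n => f (C n))
  have hf : ∀ n (x : (C n).carrier), f (C (n + 1)) (f (C n) x) = i (C (n + 1)) (i (C n) x) :=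
    fun n x => hfi (C (n + 1)) x
  have hmono : ∀ n (x : (C n).carrier), ∃ y, g (n + 2) y = g n x ∧
      (x ∈ (C n).tr ↔ y ∈ (C (n + 2)).tr) := fun n x =>
    ⟨f (C (n + 1)) (f (C n) x), (hg (n + 1) _).trans (hg n x), by
      rw [hf]
      exact ((hi (C (n + 1)) _).trans (hi (C n) x)).symm⟩
  have hsurj' : ∀ n x, ∃ m, n ≤ m ∧ ∃ y, g m y = x := fun n x => by
    induction n with
    | zero => exact (hsurj x).imp fun m h => ⟨m.zero_le, h⟩
    | succ n ih =>
      obtain ⟨m, hm, y, rfl⟩ := ih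
      exact ⟨m + 1, by lia, _, hg m y⟩
  have hpar : ∀ p x, ∃ k y, g (p + 2 * k) y = x := fun p x => by
    obtain ⟨m, hm, y, rfl⟩ := hsurj' p x
    obtain ⟨k, hk⟩ : ∃ k, m = p + 2 * k ∨ m + 1 = p + 2 * k := ⟨(m + 1 - p) / 2, by lia⟩
    obtain rfl | hk := hk
    · exact ⟨k, y, rfl⟩
    · exact ⟨k, hk ▸ ⟨_, hg m y⟩⟩
  have hcls := fun p => IsSatClass.iUnion_image (N := N) (T := fun k => (C (p + 2 * k)).tr)
    (fun k => (C (p + 2 * k)).isSatClass) (fun k => g (p + 2 * k))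
    (fun k => hmono (p + 2 * k)) (hpar p)
  refine ⟨N, inst, _, _, ⟨(g 0).comp i₀⟩, (hcls 0).1, (hcls 1).1, fun h => ?_⟩
  have h₁ := ((hcls 0).2 0 a).2 ha
  rw [h] at h₁
  have h₂ : g 1 (f A₀ a) = g 0 a := hg 0 a
  have h₃ : f A₀ a = i A₀ b := hfi A₀ (Sum.inr ())
  have h₄ : f A₀ a ∈ (C 1).tr := ((hcls 1).2 0 (f A₀ a)).1 (h₂ ▸ h₁)
  rw [h₃] at h₄
  exact hb ((hi A₀ b).1 h₄)
end

section
/- Beth's implicit definability theorem: if a theory T in a language L ∪ {P} (where P is a new predicate symbol) implicitly defines P — meaning any two models of T with the same L-reduct have the same interpretation of P — then P is explicitly definable in T by an L-formula. -/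
open FirstOrder FirstOrder.Language FirstOrder.Language.Structure

universe u v

/-- The language consisting of a single `m`-ary relation symbol `P` (and nothing else). -/
def relLang (m : ℕ) : FirstOrder.Language :=
  ⟨fun _ => Empty, fun k => PLift (k = m)⟩

/-- The new relation symbol `P` of `L ∪ {P}`. -/
def Psymb {L : FirstOrder.Language.{u, v}} {m : ℕ} : (L.sum (relLang m)).Relations m :=
  Sum.inr (PLift.up rfl)

universe w u' v'

/-- Compactness for formulas, restricted to empty structures. -/
theorem exists_realize_of_forall_finset_isEmpty {K : FirstOrder.Language.{u, v}} {X : Type*}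
    (Γ : Set (K.Formula X))
    (h : ∀ Δ : Finset (K.Formula X), ↑Δ ⊆ Γ →
      ∃ (M : Type w) (_ : K.Structure M) (x : X → M), IsEmpty M ∧ ∀ φ ∈ Δ, φ.Realize x) :
    ∃ (M : Type w) (_ : K.Structure M) (x : X → M), ∀ φ ∈ Γ, φ.Realize x := by
  classical
  have h' : ∀ Δ : Finset Γ, ∃ (M : Type w) (_ : K.Structure M) (x : X → M),
      IsEmpty M ∧ ∀ φ ∈ Δ, φ.1.Realize x := by
    intro Δ
    obtain ⟨M, S, x, hM, hx⟩ := h (Δ.image Subtype.val) (by intro φ; simp +contextual)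
    exact ⟨M, S, x, hM, fun φ hφ => hx _ (Finset.mem_image_of_mem _ hφ)⟩
  choose M S x hM hx using h'
  let U : Ultrafilter (Finset Γ) := Ultrafilter.of Filter.atTop
  let S' : K.Structure PEmpty.{w + 1} :=
    { funMap := fun f y => isEmptyElim (funMap f (fun i => (y i).elim : _ → M ∅))
      RelMap := fun R y => ∀ᶠ Δ in U, RelMap R (fun i => (y i).elim : _ → M Δ) }
  have key : ∀ {n : ℕ} (φ : K.BoundedFormula X n) (x' : X → PEmpty.{w + 1})
      (y : Fin n → PEmpty.{w + 1}),
      φ.Realize x' y ↔ ∀ᶠ Δ in U, φ.Realize (x Δ) (fun i => (y i).elim) := by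
    intro n φ x' y
    induction φ with
    | falsum => simp [BoundedFormula.Realize, U.neBot.ne]
    | equal t₁ t₂ => exact (t₁.realize (Sum.elim x' y)).elim
    | rel R ts =>
      refine Filter.eventually_congr (.of_forall fun Δ => ?_)
      exact iff_of_eq (congrArg (RelMap R) (Subsingleton.elim _ _))
    | imp φ ψ ih₁ ih₂ =>
      simp only [BoundedFormula.realize_imp, ih₁, ih₂, Ultrafilter.eventually_imp]
    | all φ ih =>
      simp only [BoundedFormula.realize_all, IsEmpty.forall_iff, Filter.eventually_true]
  refine ⟨PEmpty, S', fun a => isEmptyElim (x ∅ a), fun φ hφ => (key φ _ _).2 ?_⟩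
  filter_upwards [Ultrafilter.of_le _ (Filter.eventually_ge_atTop {⟨φ, hφ⟩})] with Δ hΔ
  rw [Subsingleton.elim (fun i => _) default]
  exact hx Δ ⟨φ, hφ⟩ (hΔ (Finset.mem_singleton_self _))

/-- Compactness for formulas, restricted to nonempty structures. -/
theorem exists_realize_of_forall_finset_nonempty {K : FirstOrder.Language.{u, v}} {X : Type w}
    (Γ : Set (K.Formula X))
    (h : ∀ Δ : Finset (K.Formula X), ↑Δ ⊆ Γ →
      ∃ (M : Type (max u v w)) (_ : K.Structure M) (x : X → M),
        Nonempty M ∧ ∀ φ ∈ Δ, φ.Realize x) :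
    ∃ (M : Type (max u v w)) (_ : K.Structure M) (x : X → M), ∀ φ ∈ Γ, φ.Realize x := by
  classical
  have hT : Theory.IsSatisfiable (Formula.equivSentence '' Γ : K[[X]].Theory) := by
    rw [Theory.isSatisfiable_iff_isFinitelySatisfiable]
    intro T₀ hT₀
    obtain ⟨Δ, hΔ, rfl⟩ := Finset.subset_set_image_iff.1 hT₀
    obtain ⟨M, S, x, hM, hx⟩ := h Δ hΔ
    let := constantsOn.structure x
    have : M ⊨ (↑(Δ.image Formula.equivSentence) : K[[X]].Theory) := by
      refine ⟨fun σ hσ => ?_⟩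
      obtain ⟨φ, hφ, rfl⟩ := Finset.mem_image.1 hσ
      exact (Formula.realize_equivSentence M φ).2 (hx φ hφ)
    exact Theory.Model.isSatisfiable M
  obtain ⟨N⟩ := hT
  let := (K.lhomWithConstants X).reduct N
  refine ⟨N, inferInstance, fun a => (K.con a : N), fun φ hφ => ?_⟩
  rw [← Formula.realize_equivSentence]
  exact N.is_model.realize_of_mem _ (Set.mem_image_of_mem _ hφ)

/-- Compactness for formulas, in possibly empty structures. -/
theorem exists_realize_of_forall_finset {K : FirstOrder.Language.{u, v}} {X : Type w}
    (Γ : Set (K.Formula X))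
    (h : ∀ Δ : Finset (K.Formula X), ↑Δ ⊆ Γ →
      ∃ (M : Type (max u v w)) (_ : K.Structure M) (x : X → M), ∀ φ ∈ Δ, φ.Realize x) :
    ∃ (M : Type (max u v w)) (_ : K.Structure M) (x : X → M), ∀ φ ∈ Γ, φ.Realize x := by
  classical
  by_cases hne : ∀ Δ : Finset (K.Formula X), ↑Δ ⊆ Γ →
      ∃ (M : Type (max u v w)) (_ : K.Structure M) (x : X → M),
        Nonempty M ∧ ∀ φ ∈ Δ, φ.Realize x
  · exact exists_realize_of_forall_finset_nonempty Γ hne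
  · push Not at hne
    obtain ⟨Δ₀, hΔ₀, hne⟩ := hne
    refine exists_realize_of_forall_finset_isEmpty Γ fun Δ hΔ => ?_
    obtain ⟨M, S, x, hx⟩ := h (Δ ∪ Δ₀) (by simp [hΔ, hΔ₀])
    refine ⟨M, S, x, ?_, fun φ hφ => hx φ (Finset.mem_union_left _ hφ)⟩
    by_contra hM
    obtain ⟨φ, hφ, hn⟩ := hne M S x (not_isEmpty_iff.1 hM)
    exact hn (hx φ (Finset.mem_union_right _ hφ))

/-- Amalgamation over a common set of parameters: if `α` and `β` have the same `L`-type, then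
`N` embeds `L`-elementarily into a `K`-elementary extension of `M`, identifying `β` with `α`. -/
theorem exists_elementary_amalgam {L : FirstOrder.Language.{u', v'}} {K : FirstOrder.Language.{u, v}} (ι : L →ᴸ K)
    {A : Type*} {M N : Type (max u v)} [L.Structure M] [K.Structure M] [ι.IsExpansionOn M]
    [L.Structure N] (α : A → M) (β : A → N)
    (hαβ : ∀ φ : L.Formula A, φ.Realize α ↔ φ.Realize β) :
    ∃ (M' : Type (max u v)) (_ : K.Structure M') (h : M ↪ₑ[K] M'),
      let := ι.reduct M'
      ∃ g : N ↪ₑ[L] M', ∀ a, g (β a) = h (α a) := by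
  classical
  -- finitely many facts about `N` can be reflected in `M`
  have reflect : ∀ ψ : L.Formula N, ψ.Realize id →
      ∃ a : N → M, (∀ c, a (β c) = α c) ∧ ψ.Realize a := by
    intro ψ hψ
    have hinj : ∀ c d, β c = β d → α c = α d := by
      intro c d hcd
      simpa using (hαβ (Term.equal (Term.var c) (Term.var d))).2 (by simpa using hcd)
    have hM : N → Nonempty M := by
      intro n
      have := (hαβ (∃' ⊤ : L.BoundedFormula A 0)).2
        (by simpa [Formula.Realize] using ⟨n⟩)
      simpa [Formula.Realize] using this
    let r : ψ.freeVarFinset → A ⊕ ψ.freeVarFinset := fun n =>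
      if hn : ∃ c, β c = n.1 then Sum.inl hn.choose else Sum.inr n
    let χ : L.Formula (A ⊕ ψ.freeVarFinset) := ψ.restrictFreeVar r
    have hχ : (χ.iExs ψ.freeVarFinset).Realize β := by
      refine Formula.realize_iExs.2 ⟨Subtype.val, ?_⟩
      refine (BoundedFormula.realize_restrictFreeVar id fun n => ?_).2 hψ
      by_cases hn : ∃ c, β c = n.1
      · simp [r, hn, hn.choose_spec]
      · simp [r, hn]
    obtain ⟨i, hi⟩ := Formula.realize_iExs.1 ((hαβ _).2 hχ)
    refine ⟨fun n => if hn : ∃ c, β c = n then α hn.choose else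
      if hn' : n ∈ ψ.freeVarFinset then i ⟨n, hn'⟩ else (hM n).some, fun c => ?_, ?_⟩
    · have hc : ∃ d, β d = β c := ⟨c, rfl⟩
      simp only [hc, dite_true]
      exact hinj _ _ hc.choose_spec
    · refine (BoundedFormula.realize_restrictFreeVar _ fun n => ?_).1 hi
      by_cases hn : ∃ c, β c = n.1
      · simp [r, hn]
      · simp [r, hn]
  let Γ : Set (K.Formula (M ⊕ N)) :=
    {γ | ∃ ψ : L.Formula N, ψ.Realize id ∧
      ∀ a : N → M, (∀ c, a (β c) = α c) → ψ.Realize a → γ.Realize (Sum.elim id a)}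
  obtain ⟨M', S', x, hx⟩ := exists_realize_of_forall_finset Γ fun Δ hΔ => by
    choose ψ hψ hψΔ using fun γ : Δ => hΔ γ.2
    obtain ⟨a, ha, hψa⟩ := reflect (Formula.iInf ψ) (by simpa using hψ)
    exact ⟨M, _, Sum.elim id a, fun γ hγ =>
      hψΔ ⟨γ, hγ⟩ a ha (Formula.realize_iInf.1 hψa ⟨γ, hγ⟩)⟩
  have hM : ∀ φ : K.Formula M, φ.Realize id → φ.Realize (x ∘ Sum.inl) := by
    intro φ hφ
    exact Formula.realize_relabel.1 (hx (φ.relabel Sum.inl) ⟨⊤, by simp, fun a _ _ => by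
      simpa [Formula.realize_relabel] using hφ⟩)
  let := ι.reduct M'
  have hN : ∀ φ : L.Formula N, φ.Realize id → φ.Realize (x ∘ Sum.inr) := by
    intro φ hφ
    refine (ι.realize_onFormula φ).1 (Formula.realize_relabel.1
      (hx ((ι.onFormula φ).relabel Sum.inr) ⟨φ, hφ, fun a _ ha => ?_⟩))
    simpa [Formula.realize_relabel] using ha
  refine ⟨M', S', ⟨x ∘ Sum.inl, fun n φ y => ?_⟩, ⟨x ∘ Sum.inr, fun n φ y => ?_⟩, fun a => ?_⟩
  · have h₁ := hM (φ.relabel y)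
    have h₂ := hM (φ.relabel y).not
    simp only [Formula.realize_not, Formula.realize_relabel, Function.id_comp,
      Function.comp_assoc] at h₁ h₂ ⊢
    tauto
  · have h₁ := hN (φ.relabel y)
    have h₂ := hN (φ.relabel y).not
    simp only [Formula.realize_not, Formula.realize_relabel, Function.id_comp,
      Function.comp_assoc] at h₁ h₂ ⊢
    tauto
  · have := hx (Term.equal (Term.var (Sum.inr (β a))) (Term.var (Sum.inl (α a))))
      ⟨⊤, by simp, fun b hb _ => by simpa using hb a⟩
    rwa [Formula.realize_equal, Term.realize_var, Term.realize_var] at this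

/-- Composites of the maps in an elementary chain. -/
theorem exists_elementaryEmbedding_of_chain {K : FirstOrder.Language.{u, v}} {G : ℕ → Type*}
    {X : Type*} [∀ n, K.Structure (G n)] (f : ∀ n, G n ↪ₑ[K] G (n + 1)) (g : ∀ n, G n → X)
    (hgf : ∀ n x, g (n + 1) (f n x) = g n x) {n m : ℕ} (hnm : n ≤ m) :
    ∃ e : G n ↪ₑ[K] G m, ∀ x, g m (e x) = g n x := by
  induction m, hnm using Nat.le_induction with
  | base => exact ⟨ElementaryEmbedding.refl K _, fun _ => rfl⟩
  | succ m _ ih =>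
    obtain ⟨e, he⟩ := ih
    exact ⟨(f m).comp e, fun x => (hgf _ _).trans (he x)⟩

/-- The Tarski–Vaught chain theorem: the maps into the union of an elementary chain are elementary,
as soon as they are embeddings. -/
theorem realize_comp_of_chain {K : FirstOrder.Language.{u, v}} {G : ℕ → Type*} {X : Type*}
    [∀ n, K.Structure (G n)] [K.Structure X] (f : ∀ n, G n ↪ₑ[K] G (n + 1)) (g : ∀ n, G n ↪[K] X)
    (hgf : ∀ n x, g (n + 1) (f n x) = g n x) (hg : ∀ y, ∃ n x, g n x = y)
    {α : Type*} {k : ℕ} (φ : K.BoundedFormula α k) (n : ℕ) (x : α → G n) (y : Fin k → G n) :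
    φ.Realize (g n ∘ x) (g n ∘ y) ↔ φ.Realize x y := by
  have hterm : ∀ (n k : ℕ) (x : α → G n) (y : Fin k → G n) (t : K.Term (α ⊕ Fin k)),
      t.realize (Sum.elim (g n ∘ x) (g n ∘ y)) = g n (t.realize (Sum.elim x y)) := by
    intro n k x y t
    rw [← Sum.comp_elim, HomClass.realize_term]
  induction φ generalizing n with
  | falsum => rfl
  | equal t₁ t₂ =>
    simp only [BoundedFormula.Realize, hterm, (g n).injective.eq_iff]
  | rel R ts =>
    simp only [BoundedFormula.Realize, hterm]
    exact (g n).map_rel R _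
  | imp φ ψ ih₁ ih₂ => simp only [BoundedFormula.realize_imp, ih₁, ih₂]
  | all φ ih =>
    constructor
    · intro h a
      refine (ih n _ _).1 ?_
      rw [Fin.comp_snoc]
      exact h _
    · intro h b
      obtain ⟨m, b, rfl⟩ := hg b
      obtain ⟨e, he⟩ := exists_elementaryEmbedding_of_chain f (fun n => g n) hgf (le_max_left n m)
      obtain ⟨e', he'⟩ := exists_elementaryEmbedding_of_chain f (fun n => g n) hgf
        (le_max_right n m)
      have key := (ih _ _ _).2 ((e.map_boundedFormula _ x y).2 h (e' b))
      rw [Fin.comp_snoc] at key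
      simpa only [Function.comp_def, he, he'] using key

/-- Let `X` be the union of a chain of `L`-structures, in which each structure carries relations
from `R` that are preserved elementarily two steps further. Then the relations along the terms
of fixed parity `j` induce an expansion of `X` of which these terms are elementary substructures. -/
theorem exists_expansion_of_alternating_chain {L : FirstOrder.Language.{u, v}}
    {R : FirstOrder.Language.{u', v'}} [R.IsRelational] {G : ℕ → Type*} {X : Type*}
    [∀ n, L.Structure (G n)] [∀ n, (L.sum R).Structure (G n)]
    [∀ n, (LHom.sumInl : L →ᴸ L.sum R).IsExpansionOn (G n)] [SX : L.Structure X]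
    (f : ∀ n, G n ↪ₑ[L] G (n + 1)) (f₂ : ∀ n, G n ↪ₑ[L.sum R] G (n + 2))
    (hf : ∀ n x, f (n + 1) (f n x) = f₂ n x) (g : ∀ n, G n ↪[L] X)
    (hgf : ∀ n x, g (n + 1) (f n x) = g n x) (hg : ∀ y, ∃ n x, g n x = y) (j : ℕ) :
    ∃ _ : (L.sum R).Structure X, (LHom.sumInl : L →ᴸ L.sum R).reduct X = SX ∧
      ∃ e : G j ↪ₑ[L.sum R] X, ∀ x, e x = g j x := by
  let f' : ∀ n, G (j + 2 * n) ↪ₑ[L.sum R] G (j + 2 * (n + 1)) := fun n => f₂ (j + 2 * n)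
  have hgf' : ∀ n x, g (j + 2 * (n + 1)) (f' n x) = g (j + 2 * n) x := fun n x =>
    (congrArg _ (hf _ x)).symm.trans ((hgf (j + 2 * n + 1) _).trans (hgf _ x))
  let SR : R.Structure X :=
    { funMap := fun F => isEmptyElim F
      RelMap := fun r x => ∃ n, ∃ y : _ → G (j + 2 * n), g (j + 2 * n) ∘ y = x ∧
        RelMap (LHom.sumInr.onRelation r : (L.sum R).Relations _) y }
  have hrel : ∀ n k (r : R.Relations k) (y : Fin k → G (j + 2 * n)),
      RelMap r (g (j + 2 * n) ∘ y) ↔ RelMap (LHom.sumInr.onRelation r : (L.sum R).Relations _) y := by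
    intro n k r y
    refine ⟨?_, fun h => ⟨n, y, rfl, h⟩⟩
    rintro ⟨n', y', hy, hr⟩
    obtain ⟨e, he⟩ := exists_elementaryEmbedding_of_chain f' (fun n => g (j + 2 * n)) hgf'
      (le_max_left n n')
    obtain ⟨e', he'⟩ := exists_elementaryEmbedding_of_chain f' (fun n => g (j + 2 * n)) hgf'
      (le_max_right n n')
    rw [← e.map_rel]
    rw [← e'.map_rel] at hr
    have : e ∘ y = e' ∘ y' := by
      funext i
      refine (g (j + 2 * max n n')).injective ?_
      exact (he _).trans ((congrFun hy i).symm.trans (he' _).symm)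
    rwa [this]
  have hg' : ∀ y, ∃ n, ∃ x : G (j + 2 * n), g (j + 2 * n) x = y := by
    intro y
    obtain ⟨n, x, rfl⟩ := hg y
    obtain ⟨e, he⟩ := exists_elementaryEmbedding_of_chain f (fun n => g n) hgf
      (show n ≤ j + 2 * n by omega)
    exact ⟨n, e x, he x⟩
  let g' : ∀ n, G (j + 2 * n) ↪[L.sum R] X := fun n =>
    { toEmbedding := (g (j + 2 * n)).toEmbedding
      map_fun' := by
        rintro k (F | F) x
        · exact (congrArg _ (LHom.map_onFunction (LHom.sumInl : L →ᴸ L.sum R) F x)).trans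
            (((g (j + 2 * n)).map_fun F x).trans
              (LHom.map_onFunction (LHom.sumInl : L →ᴸ L.sum R) F _).symm)
        · exact isEmptyElim F
      map_rel' := by
        rintro k (r | r) x
        · refine Iff.trans ((g (j + 2 * n)).map_rel r x) ?_
          exact iff_of_eq (LHom.map_onRelation (LHom.sumInl : L →ᴸ L.sum R) r x).symm
        · exact hrel n k r x }
  refine ⟨inferInstance, rfl, ⟨g j, fun n φ x => ?_⟩, fun _ => rfl⟩
  refine Iff.trans ?_ (realize_comp_of_chain f' g' hgf' hg' φ 0 x default)
  rw [Formula.Realize, Subsingleton.elim (g' 0 ∘ default) default]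
  rfl

/-- The union of an alternating chain, with its two expansions. -/
theorem exists_union_of_alternating_chain {L : FirstOrder.Language.{u, v}}
    {R : FirstOrder.Language.{u', v'}} [R.IsRelational] {G : ℕ → Type w}
    [∀ n, L.Structure (G n)] [∀ n, (L.sum R).Structure (G n)]
    [∀ n, (LHom.sumInl : L →ᴸ L.sum R).IsExpansionOn (G n)]
    (f : ∀ n, G n ↪ₑ[L] G (n + 1)) (f₂ : ∀ n, G n ↪ₑ[L.sum R] G (n + 2))
    (hf : ∀ n x, f (n + 1) (f n x) = f₂ n x) :
    ∃ (X : Type w) (S₀ S₁ : (L.sum R).Structure X),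
      @LHom.reduct L (L.sum R) LHom.sumInl X S₀ = @LHom.reduct L (L.sum R) LHom.sumInl X S₁ ∧
      ∃ (e₀ : @ElementaryEmbedding (L.sum R) (G 0) X _ S₀)
        (e₁ : @ElementaryEmbedding (L.sum R) (G 1) X _ S₁),
        ∀ x, @ElementaryEmbedding.toFun _ _ _ _ S₁ e₁ (f 0 x) =
          @ElementaryEmbedding.toFun _ _ _ _ S₀ e₀ x := by
  let F := DirectedSystem.natLERec (fun n => (f n).toEmbedding)
  let g : ∀ n, G n ↪[L] Language.DirectLimit G F :=
    Language.DirectLimit.of L ℕ G F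
  have hgf : ∀ n x, g (n + 1) (f n x) = g n x := by
    intro n x
    rw [← Language.DirectLimit.of_f (hij := n.le_succ)]
    simp [g, F, Nat.leRecOn_succ, Nat.leRecOn_self]
    rfl
  have hg : ∀ y, ∃ n x, g n x = y := Language.DirectLimit.exists_of
  obtain ⟨S₀, h₀, e₀, he₀⟩ := exists_expansion_of_alternating_chain f f₂ hf g hgf hg 0
  obtain ⟨S₁, h₁, e₁, he₁⟩ := exists_expansion_of_alternating_chain f f₂ hf g hgf hg 1
  exact ⟨_, S₀, S₁, h₀.trans h₁.symm, e₀, e₁, fun x =>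
    (he₁ _).trans ((hgf 0 x).trans (he₀ x).symm)⟩

/-- A pair of `K`-structures with an `L`-elementary map from the first to the second. -/
structure ReductElementaryPair {L : FirstOrder.Language.{u', v'}} {K : FirstOrder.Language.{u, v}}
    (ι : L →ᴸ K) where
  /-- The domain. -/
  dom : Type (max u v)
  /-- The codomain. -/
  cod : Type (max u v)
  [domStr : K.Structure dom]
  [codStr : K.Structure cod]
  /-- The `L`-elementary map. -/
  map : letI := ι.reduct dom; letI := ι.reduct cod; dom ↪ₑ[L] cod

namespace ReductElementaryPair

attribute [instance] domStr codStr

variable {L : FirstOrder.Language.{u', v'}} {K : FirstOrder.Language.{u, v}} {ι : L →ᴸ K}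

theorem exists_next (p : ReductElementaryPair ι) :
    ∃ (M : Type (max u v)) (_ : K.Structure M) (h : p.dom ↪ₑ[K] M),
      letI := ι.reduct p.dom
      letI := ι.reduct p.cod
      letI := ι.reduct M
      ∃ g : p.cod ↪ₑ[L] M, ∀ a, g (p.map.toFun a) = h a := by
  let := ι.reduct p.dom
  let := ι.reduct p.cod
  exact exists_elementary_amalgam ι id p.map.toFun fun φ => (p.map.map_formula φ id).symm

/-- Continue an `L`-elementary map `M → N` with an `L`-elementary map `N → M'` such that the
composite `M → M'` is `K`-elementary. -/
noncomputable def next (p : ReductElementaryPair ι) : ReductElementaryPair ι :=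
  letI := p.exists_next.choose_spec.choose
  ⟨p.cod, p.exists_next.choose, p.exists_next.choose_spec.choose_spec.choose_spec.choose⟩

/-- The chain obtained by iterating `next`. -/
noncomputable def chain (p : ReductElementaryPair ι) : ℕ → ReductElementaryPair ι
  | 0 => p
  | n + 1 => (chain p n).next

end ReductElementaryPair

/-- Robinson's joint consistency theorem, for two expansions by the same relational language. -/
theorem exists_common_expansion {L : FirstOrder.Language.{u, v}} {R : FirstOrder.Language.{0, 0}}
    [R.IsRelational] (p : ReductElementaryPair (LHom.sumInl : L →ᴸ L.sum R)) :
    letI := (LHom.sumInl : L →ᴸ L.sum R).reduct p.dom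
    letI := (LHom.sumInl : L →ᴸ L.sum R).reduct p.cod
    ∃ (X : Type (max u v)) (S₀ S₁ : (L.sum R).Structure X),
      @LHom.reduct L (L.sum R) LHom.sumInl X S₀ = @LHom.reduct L (L.sum R) LHom.sumInl X S₁ ∧
      ∃ (e₀ : @ElementaryEmbedding (L.sum R) p.dom X _ S₀)
        (e₁ : @ElementaryEmbedding (L.sum R) p.cod X _ S₁),
        ∀ x, @ElementaryEmbedding.toFun _ _ _ _ S₁ e₁ (p.map.toFun x) =
          @ElementaryEmbedding.toFun _ _ _ _ S₀ e₀ x := by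
  let SL : ∀ n, L.Structure (p.chain n).dom := fun n =>
    (LHom.sumInl : L →ᴸ L.sum R).reduct (p.chain n).dom
  have hSL : ∀ n, (LHom.sumInl : L →ᴸ L.sum R).IsExpansionOn (p.chain n).dom := fun n =>
    LHom.isExpansionOn_reduct _ _
  let f : ∀ n, (p.chain n).dom ↪ₑ[L] (p.chain (n + 1)).dom := fun n => (p.chain n).map
  let f₂ : ∀ n, (p.chain n).dom ↪ₑ[L.sum R] (p.chain (n + 2)).dom := fun n =>
    (p.chain n).exists_next.choose_spec.choose_spec.choose
  exact exists_union_of_alternating_chain f f₂ fun n =>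
    (p.chain n).exists_next.choose_spec.choose_spec.choose_spec.choose_spec

/-- Under implicit definability, the `L`-type of a tuple determines whether `P` holds of it. -/
theorem relMap_Psymb_of_same_type {L : FirstOrder.Language.{u, v}} {m : ℕ}
    (T : (L.sum (relLang m)).Theory)
    (himp : ∀ (M : Type (max u v)) (S₁ S₂ : (L.sum (relLang m)).Structure M),
      @FirstOrder.Language.Theory.Model _ M S₁ T →
      @FirstOrder.Language.Theory.Model _ M S₂ T →
      @FirstOrder.Language.LHom.reduct L (L.sum (relLang m)) LHom.sumInl M S₁ =
        @FirstOrder.Language.LHom.reduct L (L.sum (relLang m)) LHom.sumInl M S₂ →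
      ∀ v : Fin m → M, @RelMap _ M S₁ m Psymb v ↔ @RelMap _ M S₂ m Psymb v)
    {M N : Type (max u v)} [SM : (L.sum (relLang m)).Structure M]
    [SN : (L.sum (relLang m)).Structure N] [M ⊨ T] [N ⊨ T] (a : Fin m → M) (b : Fin m → N)
    (hab : ∀ φ : L.Formula (Fin m),
      ((LHom.sumInl : L →ᴸ L.sum (relLang m)).onFormula φ).Realize a ↔
      ((LHom.sumInl : L →ᴸ L.sum (relLang m)).onFormula φ).Realize b) :
    RelMap (Psymb (L := L)) a ↔ RelMap (Psymb (L := L)) b := by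
  have : (relLang m).IsRelational := fun _ => inferInstanceAs (IsEmpty Empty)
  let ι : L →ᴸ L.sum (relLang m) := LHom.sumInl
  let := ι.reduct M
  let := ι.reduct N
  obtain ⟨M', SM', h, g, hgh⟩ := exists_elementary_amalgam ι a b fun φ => by
    simpa only [ι, LHom.realize_onFormula] using hab φ
  let := ι.reduct M'
  obtain ⟨X, S₀, S₁, hS, e₀, e₁, he⟩ := exists_common_expansion (L := L) (R := relLang m) ⟨N, M', g⟩
  have hM' : M' ⊨ T := (h.theory_model_iff T).1 inferInstance
  have h₀ : @Theory.Model _ X S₀ T := (@ElementaryEmbedding.theory_model_iff _ _ _ _ S₀ e₀ T).1 ‹_›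
  have h₁ : @Theory.Model _ X S₁ T := (@ElementaryEmbedding.theory_model_iff _ _ _ _ S₁ e₁ T).1 hM'
  rw [← h.map_rel, ← @ElementaryEmbedding.map_rel _ _ _ _ S₁ e₁,
    ← @ElementaryEmbedding.map_rel _ N X _ S₀ e₀, himp X S₀ S₁ h₀ h₁ hS]
  refine iff_of_eq (congrArg _ (funext fun i => ?_))
  exact (congrArg _ (hgh i)).symm.trans (he (b i))

/-- If a set of formulas entails `ψ`, then so does a finite subset. -/
theorem exists_finset_entails {K : FirstOrder.Language.{u, v}} {X : Type w}
    (Γ : Set (K.Formula X)) (ψ : K.Formula X)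
    (h : ∀ (M : Type (max u v w)) [K.Structure M] (x : X → M),
      (∀ γ ∈ Γ, γ.Realize x) → ψ.Realize x) :
    ∃ Δ : Finset (K.Formula X), ↑Δ ⊆ Γ ∧ ∀ (M : Type (max u v w)) [K.Structure M] (x : X → M),
      (∀ γ ∈ Δ, γ.Realize x) → ψ.Realize x := by
  classical
  by_contra! hn
  obtain ⟨M, S, x, hx⟩ := exists_realize_of_forall_finset (insert ψ.not Γ) fun Δ hΔ => by
    obtain ⟨M, S, x, hx, hψ⟩ := hn (Δ.erase ψ.not) (by
      rw [Finset.coe_erase]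
      exact Set.sdiff_singleton_subset_iff.2 hΔ)
    refine ⟨M, S, x, fun φ hφ => ?_⟩
    by_cases hφψ : φ = ψ.not
    · exact hφψ ▸ hψ
    · exact hx φ (Finset.mem_erase.2 ⟨hφψ, hφ⟩)
  exact hx ψ.not (Set.mem_insert _ _) (h M x fun γ hγ => hx γ (Set.mem_insert_of_mem _ hγ))

/-- If the truth of a `K`-formula `P` modulo `T` depends only on `L`-types, then `P` is equivalent
modulo `T` to an `L`-formula. -/
theorem exists_onFormula_realize_iff {L : FirstOrder.Language.{u', v'}}
    {K : FirstOrder.Language.{u, v}} (ι : L →ᴸ K) (T : K.Theory) {X : Type w} (P : K.Formula X)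
    (hT : ∀ (M N : Type (max u v w)) [K.Structure M] [K.Structure N] [M ⊨ T] [N ⊨ T]
      (a : X → M) (b : X → N),
      (∀ φ : L.Formula X, (ι.onFormula φ).Realize a ↔ (ι.onFormula φ).Realize b) →
      P.Realize a → P.Realize b) :
    ∃ φ : L.Formula X, ∀ (M : Type (max u v w)) [K.Structure M] [M ⊨ T] (a : X → M),
      P.Realize a ↔ (ι.onFormula φ).Realize a := by
  have models : ∀ {M : Type (max u v w)} [K.Structure M] (a : X → M),
      (∀ σ ∈ T, (Formula.relabel Empty.elim σ : K.Formula X).Realize a) → M ⊨ T := by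
    intro M _ a h
    refine ⟨fun σ hσ => ?_⟩
    have := Formula.realize_relabel.1 (h σ hσ)
    rwa [Subsingleton.elim (a ∘ Empty.elim) default] at this
  have realize_ax : ∀ {M : Type (max u v w)} [K.Structure M] [M ⊨ T] (a : X → M), ∀ σ ∈ T,
      (Formula.relabel Empty.elim σ : K.Formula X).Realize a := by
    intro M _ _ a σ hσ
    rw [Formula.realize_relabel, Subsingleton.elim (a ∘ Empty.elim) default]
    exact Theory.realize_sentence_of_mem T hσ
  -- the `L`-formulas implying `P` modulo `T`
  let Φ : Set (L.Formula X) := {φ | ∀ (M : Type (max u v w)) [K.Structure M] [M ⊨ T] (a : X → M),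
    (ι.onFormula φ).Realize a → P.Realize a}
  have hΦ : ∀ (M : Type (max u v w)) [K.Structure M] [M ⊨ T] (a : X → M), P.Realize a →
      ∃ φ ∈ Φ, (ι.onFormula φ).Realize a := by
    intro M _ _ a hP
    obtain ⟨Δ, hΔ, hΔP⟩ := exists_finset_entails {γ | ∃ φ : L.Formula X,
        (ι.onFormula φ).Realize a ∧ ∀ (N : Type (max u v w)) [K.Structure N] [N ⊨ T] (b : X → N),
        (ι.onFormula φ).Realize b → γ.Realize b} P fun N _ b hb => by
      have : N ⊨ T := models b fun σ hσ =>
        hb _ ⟨⊤, Formula.realize_top.2 trivial, fun N _ _ b _ => realize_ax b σ hσ⟩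
      refine hT M N a b (fun φ => ⟨fun h => hb _ ⟨φ, h, fun N _ _ b h => h⟩, fun h => ?_⟩) hP
      by_contra hn
      exact hb (ι.onFormula φ.not) ⟨φ.not, hn, fun N _ _ b h => h⟩ h
    choose φ hφa hφ using fun γ : Δ => hΔ γ.2
    refine ⟨Formula.iInf φ, fun N _ _ b hb => hΔP N b fun γ hγ => hφ ⟨γ, hγ⟩ N b ?_, ?_⟩
    · let := ι.reduct N
      rw [LHom.realize_onFormula, Formula.realize_iInf] at hb
      exact (ι.realize_onFormula _).2 (hb ⟨γ, hγ⟩)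
    · let := ι.reduct M
      rw [LHom.realize_onFormula, Formula.realize_iInf]
      exact fun γ => (ι.realize_onFormula _).1 (hφa γ)
  obtain ⟨Δ, hΔ, hΔP⟩ := exists_finset_entails {γ | ∃ φ ∈ Φ,
      ∀ (N : Type (max u v w)) [K.Structure N] [N ⊨ T] (b : X → N),
      ¬ (ι.onFormula φ).Realize b → γ.Realize b} P.not fun N _ b hb => by
    have : N ⊨ T := models b fun σ hσ =>
      hb _ ⟨⊥, fun _ _ _ _ h => h.elim, fun N _ _ b _ => realize_ax b σ hσ⟩
    intro hPb
    obtain ⟨φ, hφ, hφb⟩ := hΦ N b hPb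
    exact hb (ι.onFormula φ).not ⟨φ, hφ, fun N _ _ b h => h⟩ hφb
  choose φ hφΦ hφ using fun γ : Δ => hΔ γ.2
  refine ⟨Formula.iSup φ, fun M _ _ a => ?_⟩
  let := ι.reduct M
  rw [LHom.realize_onFormula, Formula.realize_iSup]
  constructor
  · intro hP
    by_contra! hn
    exact hΔP M a (fun γ hγ => hφ ⟨γ, hγ⟩ M a fun h =>
      hn ⟨γ, hγ⟩ ((ι.realize_onFormula _).1 h)) hP
  · rintro ⟨γ, hγ⟩
    exact hφΦ γ M a ((ι.realize_onFormula _).2 hγ)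

/-- **Beth's implicit definability theorem.** Let `T` be a theory in the language `L ∪ {P}`,
where `P` is a new `m`-ary predicate symbol.  If `T` implicitly defines `P` — that is, any two
models of `T` on the same carrier with the same `L`-reduct have the same interpretation of
`P` — then `P` is explicitly definable in `T` by an `L`-formula: there is an `L`-formula
`φ(x̄)` such that in every model of `T`, `P(x̄) ↔ φ(x̄)`. -/
theorem beth_implicit_definability {L : FirstOrder.Language.{u, v}} {m : ℕ}
    (T : (L.sum (relLang m)).Theory)
    (himp : ∀ (M : Type (max u v)) (S₁ S₂ : (L.sum (relLang m)).Structure M),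
      @FirstOrder.Language.Theory.Model _ M S₁ T →
      @FirstOrder.Language.Theory.Model _ M S₂ T →
      @FirstOrder.Language.LHom.reduct L (L.sum (relLang m)) LHom.sumInl M S₁ =
        @FirstOrder.Language.LHom.reduct L (L.sum (relLang m)) LHom.sumInl M S₂ →
      ∀ v : Fin m → M, @RelMap _ M S₁ m Psymb v ↔ @RelMap _ M S₂ m Psymb v) :
    ∃ φ : L.Formula (Fin m),
      ∀ (M : Type (max u v)) (S : (L.sum (relLang m)).Structure M),
        @FirstOrder.Language.Theory.Model _ M S T →
        ∀ v : Fin m → M,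
          @RelMap _ M S m Psymb v ↔
            @FirstOrder.Language.Formula.Realize L M
              (@FirstOrder.Language.LHom.reduct L (L.sum (relLang m)) LHom.sumInl M S)
              (Fin m) φ v := by
  obtain ⟨φ, hφ⟩ := exists_onFormula_realize_iff (LHom.sumInl : L →ᴸ L.sum (relLang m)) T
    (Relations.formula Psymb Term.var) fun M N _ _ _ _ a b hab hP => by
      rw [Formula.realize_rel] at hP ⊢
      exact (relMap_Psymb_of_same_type T himp a b hab).1 hP
  refine ⟨φ, fun M S hM x => ?_⟩
  have := hφ M x
  rw [Formula.realize_rel] at this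
  refine this.trans ?_
  let := (LHom.sumInl : L →ᴸ L.sum (relLang m)).reduct M
  exact LHom.realize_onFormula _ φ
end

section
/- Any two countable recursively saturated models of PA with the same standard system and the same complete theory are isomorphic. -/
open FirstOrder FirstOrder.Language FirstOrder.Language.Structure

instance : Encodable (Σ n, ArithFunc n) :=
  Encodable.ofLeftInjection
    (fun f => match f with
      | ⟨_, .zero⟩ => 0
      | ⟨_, .one⟩ => 1
      | ⟨_, .add⟩ => 2
      | ⟨_, .mul⟩ => 3)
    (fun n => match n with
      | 0 => some ⟨0, .zero⟩
      | 1 => some ⟨0, .one⟩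
      | 2 => some ⟨2, .add⟩
      | 3 => some ⟨2, .mul⟩
      | _ => none)
    (by rintro ⟨n, f⟩; cases f <;> rfl)

instance : Encodable (Σ n, ArithRel n) :=
  Encodable.ofLeftInjection
    (fun f => match f with | ⟨_, .lt⟩ => 0)
    (fun n => match n with
      | 0 => some ⟨2, .lt⟩
      | _ => none)
    (by rintro ⟨n, f⟩; cases f; rfl)

instance : Encodable (Σ n, Larith.Functions n) := inferInstanceAs (Encodable (Σ n, ArithFunc n))
instance : Encodable (Σ n, Larith.Relations n) := inferInstanceAs (Encodable (Σ n, ArithRel n))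

/-- The Gödel code of a formula of arithmetic: the canonical (computable) encoding of its
flattening as a list of symbols. -/
def godelCode {α : Type} [Encodable α] {n : ℕ} (φ : Larith.BoundedFormula α n) : ℕ :=
  Encodable.encode φ.listEncode

/-- `N` is recursively (computably) saturated: every computable type `p(x)` in one free
variable, with finitely many parameters from `N`, that is finitely realized in `N` is
realized in `N`. -/
def RecursivelySaturated (N : Type*) [Larith.Structure N] : Prop :=
  ∀ (k : ℕ) (p : Set (Larith.BoundedFormula (Fin k) 1)) (v : Fin k → N),
    (∃ d : ℕ → Bool, Computable d ∧ ∀ φ, φ ∈ p ↔ d (godelCode φ) = true) →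
    (∀ s : Finset (Larith.BoundedFormula (Fin k) 1), ↑s ⊆ p →
      ∃ x : N, ∀ φ ∈ s, φ.Realize v ![x]) →
    ∃ x : N, ∀ φ ∈ p, φ.Realize v ![x]

open Larith

/-- The standard system of a model `N` of PA: the collection of subsets of `ℕ` of the form
`{n ∈ ℕ | N ⊨ pₙ ∣ a}` for `a ∈ N`, where `pₙ` is the `n`-th prime (the traces on the
standard cut of the sets coded in `N`). -/
def StandardSystem (N : Type*) [Larith.Structure N] : Set (Set ℕ) :=
  {A | ∃ a : N, A = {n : ℕ | ∃ b : N, mulF (natE (Nat.nth Nat.Prime n)) b = a}}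

namespace Larith

/-! ### Computability preliminaries -/

theorem primrecPred_prime : PrimrecPred Nat.Prime := by
  have hrel : PrimrecRel fun m q : ℕ => m < 2 ∨ q % m ≠ 0 :=
    (Primrec.nat_lt.comp Primrec.fst (Primrec.const 2)).or
      (Primrec.eq.comp (Primrec.nat_mod.comp Primrec.snd Primrec.fst) (Primrec.const 0)).not
  refine ((Primrec.nat_le.comp (Primrec.const 2) Primrec.id).and
    (hrel.forall_lt.comp Primrec.id Primrec.id)).of_eq fun q => ?_
  simp only [id, Nat.prime_def_lt', Nat.dvd_iff_mod_eq_zero, ne_eq]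
  refine and_congr_right fun _ => forall_congr' fun m => ?_
  have : m < 2 ↔ ¬2 ≤ m := not_le.symm
  tauto

theorem computable_nth_prime : Computable (Nat.nth Nat.Prime) := by
  have hcount : Primrec (Nat.count Nat.Prime) := by
    have : Primrec fun n => ((List.range n).filter (fun q => decide q.Prime)).length :=
      Primrec.list_length.comp ((Primrec.listFilter primrecPred_prime).comp Primrec.list_range)
    refine this.of_eq fun n => ?_
    rw [Nat.count, List.countP_eq_length_filter]
  have hpred : PrimrecPred fun a : ℕ × ℕ => a.2.Prime ∧ Nat.count Nat.Prime a.2 = a.1 :=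
    (primrecPred_prime.comp Primrec.snd).and
      (Primrec.eq.comp (hcount.comp Primrec.snd) Primrec.fst)
  have hfind : Partrec fun n : ℕ => Nat.rfind fun q =>
      (Part.some (decide (q.Prime ∧ Nat.count Nat.Prime q = n)) : Part Bool) :=
    Partrec.rfind (hpred.decide.to_comp)
  refine Partrec.of_eq hfind fun n => ?_
  have hn : Nat.Prime (Nat.nth Nat.Prime n) ∧
      Nat.count Nat.Prime (Nat.nth Nat.Prime n) = n :=
    ⟨Nat.prime_nth_prime n, Nat.primeCounting'_nth_eq n⟩
  refine Part.eq_some_iff.2 (Nat.mem_rfind.2 ⟨by simpa using hn, fun {m} hm => ?_⟩)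
  simp only [Part.mem_some_iff, Bool.false_eq, decide_eq_false_iff_not, not_and]
  rintro hmp rfl
  rw [Nat.nth_count hmp] at hm
  exact hm.false

theorem computable_exists_lt_eq {f : ℕ → ℕ} (hf : Computable f) {P : ℕ → Prop}
    (hP : PrimrecPred P) [DecidablePred P] :
    Computable fun m => decide (∃ n < m, P n ∧ m = f n) := by
  have htest : Primrec fun a : (ℕ × ℕ × Bool) × ℕ =>
      (a.1.2.2 || decide (P a.1.2.1 ∧ a.1.1 = a.2)) :=
    Primrec.or.comp (Primrec.snd.comp (Primrec.snd.comp Primrec.fst))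
      ((hP.comp (Primrec.fst.comp (Primrec.snd.comp Primrec.fst))).and
        (Primrec.eq.comp (Primrec.fst.comp Primrec.fst) Primrec.snd)).decide
  have hstep : Computable₂ fun (m : ℕ) (s : ℕ × Bool) => s.2 || decide (P s.1 ∧ m = f s.1) :=
    Computable.comp (f := fun a : (ℕ × ℕ × Bool) × ℕ =>
        (a.1.2.2 || decide (P a.1.2.1 ∧ a.1.1 = a.2)))
      (g := fun a : ℕ × ℕ × Bool => (a, f a.2.1)) htest.to_comp
      (Computable.id.pair (hf.comp (Computable.fst.comp Computable.snd)))
  refine (Computable.nat_rec Computable.id (Computable.const false) hstep).of_eq fun m => ?_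
  suffices ∀ j : ℕ, Nat.rec (motive := fun _ => Bool) false
      (fun y b => b || decide (P y ∧ m = f y)) j = decide (∃ n < j, P n ∧ m = f n) from this m
  intro j
  induction j with
  | zero => simp
  | succ j ih =>
    simp only [ih, ← Bool.decide_or, decide_eq_decide]
    constructor
    · rintro (⟨n, hn, h⟩ | h)
      exacts [⟨n, by omega, h⟩, ⟨j, by omega, h⟩]
    · rintro ⟨n, hn, h⟩
      rcases Nat.lt_succ_iff_lt_or_eq.1 hn with hn | rfl
      exacts [.inl ⟨n, hn, h⟩, .inr h]

theorem encode_map_encode {α : Type*} [Encodable α] (l : List α) :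
    Encodable.encode (l.map Encodable.encode) = Encodable.encode l := by
  induction l with
  | nil => rfl
  | cons a l ih => simp [ih]

theorem encode_le_encode_append (l₁ l₂ : List ℕ) :
    Encodable.encode l₂ ≤ Encodable.encode (l₁ ++ l₂) := by
  induction l₁ with
  | nil => rfl
  | cons a l ih =>
    rw [List.cons_append, Encodable.encode_list_cons]
    exact (ih.trans (Nat.right_le_pair _ _)).trans (Nat.le_succ _)

/-! ### Unique readability of the encoding of formulas -/

theorem listEncode_append_injective {α : Type} {n : ℕ} (φ ψ : Larith.BoundedFormula α n)
    (l l' : List ((Σ k, Larith.Term (α ⊕ Fin k)) ⊕ ((Σ n, Larith.Relations n) ⊕ ℕ)))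
    (h : φ.listEncode ++ l = ψ.listEncode ++ l') : φ = ψ ∧ l = l' := by
  induction φ generalizing l l' with
  | falsum => cases ψ <;> simp_all [BoundedFormula.listEncode]
  | equal t₁ t₂ => cases ψ <;> simp_all [BoundedFormula.listEncode]
  | @rel n k R ts =>
    cases ψ with
    | @rel _ k' R' ts' =>
      simp only [BoundedFormula.listEncode, List.cons_append, List.nil_append, List.cons.injEq,
        Sum.inr.injEq, Sum.inl.injEq, Sigma.mk.injEq] at h
      obtain ⟨⟨rfl, hR⟩, -, h⟩ := h
      obtain ⟨hts, hl⟩ := List.append_inj h (by simp)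
      refine ⟨?_, hl⟩
      obtain rfl := eq_of_heq hR
      congr
      funext i
      simpa using List.map_inj_left.1 hts i (List.mem_finRange i)
    | _ => simp [BoundedFormula.listEncode] at h
  | imp φ₁ φ₂ ih₁ ih₂ =>
    cases ψ with
    | imp ψ₁ ψ₂ =>
      simp only [BoundedFormula.listEncode, List.cons_append, List.append_assoc, List.cons.injEq,
        true_and] at h
      obtain ⟨rfl, h₂⟩ := ih₁ _ _ _ h
      obtain ⟨rfl, hl⟩ := ih₂ _ _ _ h₂
      exact ⟨rfl, hl⟩
    | _ => simp [BoundedFormula.listEncode] at h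
  | all φ ih =>
    cases ψ with
    | all ψ =>
      simp only [BoundedFormula.listEncode, List.cons_append, List.cons.injEq, true_and] at h
      obtain ⟨rfl, hl⟩ := ih _ _ _ h
      exact ⟨rfl, hl⟩
    | _ => simp [BoundedFormula.listEncode] at h

theorem exists_eq_imp_of_listEncode {α : Type} {n : ℕ} {ψ φ : Larith.BoundedFormula α n}
    {l : List ((Σ k, Larith.Term (α ⊕ Fin k)) ⊕ ((Σ n, Larith.Relations n) ⊕ ℕ))}
    (h : ψ.listEncode = Sum.inr (Sum.inr 0) :: (φ.listEncode ++ l)) :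
    ∃ χ, ψ = φ.imp χ ∧ χ.listEncode = l := by
  cases ψ with
  | imp ψ₁ ψ₂ =>
    simp only [BoundedFormula.listEncode, List.cons_append, List.cons.injEq, true_and] at h
    obtain ⟨rfl, hl⟩ := listEncode_append_injective _ _ _ _ h
    exact ⟨ψ₂, rfl, hl⟩
  | _ => simp [BoundedFormula.listEncode] at h

theorem exists_eq_all_of_listEncode {α : Type} {n : ℕ} {ψ : Larith.BoundedFormula α n}
    {l : List ((Σ k, Larith.Term (α ⊕ Fin k)) ⊕ ((Σ n, Larith.Relations n) ⊕ ℕ))}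
    (h : ψ.listEncode = Sum.inr (Sum.inr 1) :: l) :
    ∃ χ : Larith.BoundedFormula α (n + 1), ψ = χ.all ∧ χ.listEncode = l := by
  cases ψ with
  | all ψ =>
    simp only [BoundedFormula.listEncode, List.cons.injEq, true_and] at h
    exact ⟨ψ, rfl, h⟩
  | _ => simp [BoundedFormula.listEncode] at h

theorem godelCode_injective {α : Type} [Encodable α] {n : ℕ} :
    Function.Injective (godelCode : Larith.BoundedFormula α n → ℕ) := fun φ ψ h =>
  (listEncode_append_injective φ ψ [] [] (by simpa using Encodable.encode_injective h)).1

/-! ### Formulas omitting two variables -/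

/-- The term mentions neither the parameter `0` nor the bound variable `0`. -/
def TermOmits {k n : ℕ} (t : Larith.Term (Fin (k + 1) ⊕ Fin n)) : Prop :=
  ∀ s ∈ t.listEncode, Encodable.encode s ≠ 0 ∧ Encodable.encode s ≠ 2

/-- The formula mentions neither the parameter `0` nor the bound variable `0`. -/
def Omits {k n : ℕ} (φ : Larith.BoundedFormula (Fin (k + 1)) n) : Prop :=
  ∀ (m : ℕ) (t : Larith.Term (Fin (k + 1) ⊕ Fin m)), Sum.inl ⟨m, t⟩ ∈ φ.listEncode → TermOmits t

/-- The counterpart of `Omits` for codes of lists of symbols. -/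
def CodeOmits (c : ℕ) : Prop :=
  ∀ s ∈ Denumerable.ofNat (List ℕ) c, s % 2 = 0 →
    ∀ r ∈ Denumerable.ofNat (List ℕ) (s / 2).unpair.2, r ≠ 0 ∧ r ≠ 2

theorem primrecPred_codeOmits : PrimrecPred CodeOmits := by
  have hr : PrimrecPred fun r : ℕ => r ≠ 0 ∧ r ≠ 2 :=
    (Primrec.eq.comp Primrec.id (Primrec.const 0)).not.and
      (Primrec.eq.comp Primrec.id (Primrec.const 2)).not
  have hs : PrimrecPred fun s : ℕ => s % 2 = 0 →
      ∀ r ∈ Denumerable.ofNat (List ℕ) (s / 2).unpair.2, r ≠ 0 ∧ r ≠ 2 := by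
    refine PrimrecPred.of_eq (PrimrecPred.or
      (Primrec.eq.comp (Primrec.nat_mod.comp Primrec.id (Primrec.const 2)) (Primrec.const 0)).not
      (hr.forall_mem_list.comp ((Primrec.ofNat (List ℕ)).comp (Primrec.snd.comp
        (Primrec.unpair.comp (Primrec.nat_div.comp Primrec.id (Primrec.const 2)))))))
      fun s => imp_iff_not_or.symm
  exact hs.forall_mem_list.comp (Primrec.ofNat (List ℕ))

theorem ofNat_encode_eq_map {α : Type*} [Encodable α] (l : List α) :
    Denumerable.ofNat (List ℕ) (Encodable.encode l) = l.map Encodable.encode := by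
  rw [← encode_map_encode, Denumerable.ofNat_encode]

theorem codeOmits_iff_omits {k n : ℕ} (φ : Larith.BoundedFormula (Fin (k + 1)) n) :
    CodeOmits (godelCode φ) ↔ Omits φ := by
  have hsigma (m : ℕ) (t : Larith.Term (Fin (k + 1) ⊕ Fin m)) :
      Denumerable.ofNat (List ℕ) (Encodable.encode (Sum.inl ⟨m, t⟩ :
        (Σ m, Larith.Term (Fin (k + 1) ⊕ Fin m)) ⊕ ((Σ n, Larith.Relations n) ⊕ ℕ)) / 2).unpair.2 =
      t.listEncode.map Encodable.encode := by
    rw [← ofNat_encode_eq_map, Encodable.encode_inl, Encodable.encode_sigma_val,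
      Nat.mul_div_cancel_left _ two_pos, Nat.unpair_pair]
    rfl
  simp only [CodeOmits, godelCode, ofNat_encode_eq_map, List.forall_mem_map, Omits, TermOmits]
  constructor
  · intro h m t ht
    have := h _ ht
    rw [hsigma] at this
    exact List.forall_mem_map.1 (this (by simp))
  · rintro h (⟨m, t⟩ | s) hs
    · rw [hsigma]
      exact fun _ => List.forall_mem_map.2 (h m t hs)
    · simp [Nat.add_mod]

theorem TermOmits.realize_eq {M : Type} [Larith.Structure M] {k n : ℕ}
    {t : Larith.Term (Fin (k + 1) ⊕ Fin n)} (ht : TermOmits t) {v v' : Fin (k + 1) → M}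
    {xs xs' : Fin n → M} (hv : ∀ i, i ≠ 0 → v i = v' i)
    (hxs : ∀ i : Fin n, i.val ≠ 0 → xs i = xs' i) :
    t.realize (Sum.elim v xs) = t.realize (Sum.elim v' xs') := by
  induction t with
  | var x =>
    have hx := ht (Sum.inl x) (by simp [Term.listEncode])
    rcases x with i | i
    · refine hv i ?_
      rintro rfl
      exact hx.1 rfl
    · refine hxs i fun hi => hx.2 ?_
      have : Encodable.encode i = 0 := hi
      simp [this]
  | func f ts ih =>
    simp only [Term.realize_func]
    congr 1
    funext i
    refine ih i fun s hs => ht s ?_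
    simp only [Term.listEncode, List.mem_cons, List.mem_flatMap]
    exact .inr ⟨i, List.mem_finRange i, hs⟩

theorem Omits.realize_iff {M : Type} [Larith.Structure M] {k n : ℕ}
    {φ : Larith.BoundedFormula (Fin (k + 1)) n} (hφ : Omits φ) {v v' : Fin (k + 1) → M}
    {xs xs' : Fin n → M} (hv : ∀ i, i ≠ 0 → v i = v' i)
    (hxs : ∀ i : Fin n, i.val ≠ 0 → xs i = xs' i) :
    φ.Realize v xs ↔ φ.Realize v' xs' := by
  induction φ with
  | falsum => rfl
  | @equal n t₁ t₂ =>
    have h₁ : TermOmits t₁ := hφ n t₁ (by simp [BoundedFormula.listEncode])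
    have h₂ : TermOmits t₂ := hφ n t₂ (by simp [BoundedFormula.listEncode])
    simp only [BoundedFormula.Realize, h₁.realize_eq hv hxs, h₂.realize_eq hv hxs]
  | @rel n _ R ts =>
    have h : ∀ i, TermOmits (ts i) := fun i => hφ n _ (by simp [BoundedFormula.listEncode])
    simp only [BoundedFormula.Realize, (h _).realize_eq hv hxs]
  | imp φ₁ φ₂ ih₁ ih₂ =>
    have h₁ : Omits φ₁ := fun m t ht => hφ m t (by simp [BoundedFormula.listEncode, ht])
    have h₂ : Omits φ₂ := fun m t ht => hφ m t (by simp [BoundedFormula.listEncode, ht])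
    simp only [BoundedFormula.Realize, ih₁ h₁ hxs, ih₂ h₂ hxs]
  | @all n φ ih =>
    have h : Omits φ := fun m t ht => hφ m t (by simp [BoundedFormula.listEncode, ht])
    refine forall_congr' fun a => ih h fun i hi => ?_
    induction i using Fin.lastCases with
    | last => simp
    | cast j => simpa using hxs j hi

theorem Omits.not {k n : ℕ} {φ : Larith.BoundedFormula (Fin (k + 1)) n} (hφ : Omits φ) :
    Omits φ.not := by
  intro m t ht
  refine hφ m t ?_
  simpa [BoundedFormula.not, BoundedFormula.listEncode] using ht

/-- The renaming moving the parameter `0` to the bound variable `1`. -/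
def moveParam (k : ℕ) : Fin (k + 1) → Fin (k + 1) ⊕ Fin 2 :=
  Fin.cases (Sum.inr 1) fun i => Sum.inl i.succ

theorem termOmits_relabel {k j : ℕ} (t : Larith.Term (Fin (k + 1) ⊕ Fin j)) :
    TermOmits (t.relabel (BoundedFormula.relabelAux (moveParam k) j)) := by
  induction t with
  | var x =>
    intro s hs
    simp only [Term.relabel, Term.listEncode, List.mem_singleton] at hs
    subst hs
    rcases x with i | i
    · refine Fin.cases ?_ (fun i => ?_) i
      · have : Encodable.encode (Fin.castAdd j (1 : Fin 2)) = 1 := rfl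
        simp [BoundedFormula.relabelAux, moveParam, this]
      · have : Encodable.encode i.succ = i.val + 1 := rfl
        simp [BoundedFormula.relabelAux, moveParam, this]
    · have : Encodable.encode (Fin.natAdd 2 i) = 2 + i.val := rfl
      simp [BoundedFormula.relabelAux, this]
  | func f ts ih =>
    intro s hs
    simp only [Term.relabel, Term.listEncode, List.mem_cons, List.mem_flatMap] at hs
    rcases hs with rfl | ⟨i, -, hs⟩
    · simp
    · exact ih i s hs

theorem omits_relabel {k j : ℕ} (φ : Larith.BoundedFormula (Fin (k + 1)) j) :
    Omits (φ.relabel (moveParam k)) := by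
  induction φ with
  | falsum => simp [Omits, BoundedFormula.relabel_falsum, BoundedFormula.listEncode]
  | equal t₁ t₂ =>
    intro m t ht
    simp only [BoundedFormula.relabel, BoundedFormula.mapTermRel, BoundedFormula.listEncode,
      List.mem_cons, Sum.inl.injEq, Sigma.mk.injEq, List.not_mem_nil, or_false] at ht
    rcases ht with ⟨rfl, ht⟩ | ⟨rfl, ht⟩ <;> obtain rfl := eq_of_heq ht <;>
      exact termOmits_relabel _
  | rel R ts =>
    intro m t ht
    simp only [BoundedFormula.relabel, BoundedFormula.mapTermRel, BoundedFormula.listEncode] at ht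
    simp only [List.cons_append, List.nil_append, List.mem_cons, reduceCtorEq, false_or,
      List.mem_map, List.mem_finRange, true_and, Sum.inl.injEq, Sigma.mk.injEq] at ht
    obtain ⟨i, rfl, ht⟩ := ht
    obtain rfl := eq_of_heq ht
    exact termOmits_relabel _
  | imp φ₁ φ₂ ih₁ ih₂ =>
    intro m t ht
    simp only [BoundedFormula.relabel_imp, BoundedFormula.listEncode, List.mem_append,
      List.mem_cons, reduceCtorEq, false_or] at ht
    exact ht.elim (ih₁ m t) (ih₂ m t)
  | all φ ih =>
    intro m t ht
    simp only [BoundedFormula.relabel_all, BoundedFormula.listEncode,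
      List.mem_cons, reduceCtorEq, false_or] at ht
    exact ih m t ht

/-! ### Numerals and divisibility -/

/-- The symbol `0`. -/
def zeroSym : Larith.Functions 0 := ArithFunc.zero

/-- The symbol `1`. -/
def oneSym : Larith.Functions 0 := ArithFunc.one

/-- The symbol `+`. -/
def addSym : Larith.Functions 2 := ArithFunc.add

/-- The symbol `·`. -/
def mulSym : Larith.Functions 2 := ArithFunc.mul

/-- The closed term `1 + 1 + ⋯ + 1`. -/
def numeral {α : Type} : ℕ → Larith.Term α
  | 0 => Constants.term zeroSym
  | n + 1 => addSym.apply₂ (numeral n) (Constants.term oneSym)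

theorem realize_numeral {M : Type} [Larith.Structure M] {α : Type} (v : α → M) (n : ℕ) :
    (numeral n).realize v = (natE n : M) := by
  have hconst (c : Larith.Functions 0) :
      (Constants.term c : Larith.Term α).realize v = funMap c ![] := by
    rw [Term.realize_constants, constantMap]
    congr
  induction n with
  | zero => exact hconst _
  | succ n ih => rw [numeral, Term.realize_functions_apply₂, ih, hconst]; rfl

theorem listEncode_apply₂ {α : Type} (f : Larith.Functions 2) (t₁ t₂ : Larith.Term α) :
    (f.apply₂ t₁ t₂).listEncode = Sum.inr ⟨2, f⟩ :: (t₁.listEncode ++ t₂.listEncode) := by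
  simp [Functions.apply₂, Term.listEncode, List.finRange_succ]

theorem primrec_listEncode_numeral {α : Type} [Encodable α] :
    Primrec fun n => ((numeral n : Larith.Term α).listEncode.map Encodable.encode : List ℕ) := by
  let a : ℕ := Encodable.encode (Sum.inr ⟨2, addSym⟩ : α ⊕ (Σ i, Larith.Functions i))
  let z : ℕ := Encodable.encode (Sum.inr ⟨0, zeroSym⟩ : α ⊕ (Σ i, Larith.Functions i))
  let o : ℕ := Encodable.encode (Sum.inr ⟨0, oneSym⟩ : α ⊕ (Σ i, Larith.Functions i))
  have hrec : Primrec fun n : ℕ => (Nat.rec [z] (fun _ l => a :: (l ++ [o])) n : List ℕ) :=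
    Primrec.nat_rec₁ _ (Primrec.list_cons.comp (Primrec.const a)
      (Primrec.list_append.comp Primrec.snd (Primrec.const [o])))
  refine hrec.of_eq fun n => ?_
  induction n with
  | zero => simp [numeral, Constants.term, Term.listEncode, z]
  | succ n ih =>
    simp only [ih, numeral, listEncode_apply₂]
    simp [Constants.term, Term.listEncode, a, o]

/-- The parameter `0` or the bound variable `0`. -/
def specialVar (k n : ℕ) : Bool → Fin (k + 1) ⊕ Fin (n + 1)
  | true => Sum.inl 0
  | false => Sum.inr 0

/-- The formula saying that the standard number `q` does not divide `specialVar w`. -/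
def notDvd (k m : ℕ) (w : Bool) (q : ℕ) : Larith.BoundedFormula (Fin (k + 1)) (m + 1) :=
  .all (.imp (.equal (mulSym.apply₂ (numeral q) (.var (.inr (Fin.last (m + 1)))))
    (.var (specialVar k (m + 1) w))) .falsum)

theorem realize_notDvd {M : Type} [Larith.Structure M] {k m : ℕ} {w : Bool} {q : ℕ}
    {v : Fin (k + 1) → M} {xs : Fin (m + 1) → M} :
    (notDvd k m w q).Realize v xs ↔
      ¬∃ b : M, mulF (natE q) b = Sum.elim v xs (specialVar k m w) := by
  rw [not_exists]
  refine forall_congr' fun b => not_congr ?_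
  have : Sum.elim v (Fin.snoc xs b : Fin (m + 2) → M) (specialVar k (m + 1) w) =
      Sum.elim v xs (specialVar k m w) := by
    cases w
    · exact Fin.snoc_castSucc (α := fun _ => M) b xs 0
    · rfl
  simp only [BoundedFormula.Realize, Term.realize_functions_apply₂, realize_numeral,
    Term.realize_var, this, Sum.elim_inr, Fin.snoc_last]
  rfl

theorem primrec_listEncode_notDvd (k m : ℕ) (w : Bool) :
    Primrec fun q => ((notDvd k m w q).listEncode.map Encodable.encode : List ℕ) := by
  let T := (Σ j, Larith.Term (Fin (k + 1) ⊕ Fin j)) ⊕ ((Σ n, Larith.Relations n) ⊕ ℕ)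
  let U := (Fin (k + 1) ⊕ Fin (m + 2)) ⊕ (Σ i, Larith.Functions i)
  let x : T := Sum.inl ⟨m + 2, .var (specialVar k (m + 1) w)⟩
  let mul : U := Sum.inr ⟨2, mulSym⟩
  let b : U := Sum.inl (Sum.inr (Fin.last (m + 1)))
  have hterm : Primrec fun q : ℕ => 2 * Nat.pair (m + 2) (Encodable.encode
      (Encodable.encode mul :: (((numeral q : Larith.Term (Fin (k + 1) ⊕ Fin (m + 2))).listEncode.map
        Encodable.encode) ++ [Encodable.encode b]))) :=
    Primrec.nat_mul.comp (Primrec.const 2) (Primrec₂.natPair.comp (Primrec.const _)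
      (Primrec.encode.comp (Primrec.list_cons.comp (Primrec.const _)
        (Primrec.list_append.comp primrec_listEncode_numeral (Primrec.const _)))))
  refine (Primrec.list_cons.comp (Primrec.const (Encodable.encode (Sum.inr (Sum.inr 1) : T)))
    (Primrec.list_cons.comp (Primrec.const (Encodable.encode (Sum.inr (Sum.inr 0) : T)))
    (Primrec.list_cons.comp hterm (Primrec.const
      [Encodable.encode x, Encodable.encode (Sum.inr (Sum.inr (m + 1 + 1 + 2)) : T)])))).of_eq
    fun q => ?_
  have henc (t : Larith.Term (Fin (k + 1) ⊕ Fin (m + 2))) :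
      Encodable.encode (Sum.inl ⟨m + 2, t⟩ : T) =
        2 * Nat.pair (m + 2) (Encodable.encode (t.listEncode.map Encodable.encode)) := by
    rw [Encodable.encode_inl, Encodable.encode_sigma_val, encode_map_encode]
    rfl
  simp only [notDvd, BoundedFormula.listEncode, List.map_cons, List.cons_append, List.nil_append,
    List.map_nil, henc, listEncode_apply₂, List.map_append, x]
  rfl

/-! ### The type of a code for a type -/

/-- The formula saying that if the `n`-th prime does not divide `specialVar w`, then `φ` holds
with its bound variable `1` interpreted by the other special variable. -/
noncomputable def guarded {k : ℕ} (w : Bool) (n : ℕ) (φ : Larith.BoundedFormula (Fin (k + 1)) 2) :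
    Larith.BoundedFormula (Fin (k + 1)) 1 :=
  .all (.imp (.equal (.var (.inr 1)) (.var (specialVar k 1 !w)))
    (.imp (notDvd k 1 w (Nat.nth Nat.Prime n)) φ))

/-- The code of the negation of the formula with code `n`. -/
def negCode (n : ℕ) : ℕ :=
  Encodable.encode (Encodable.encode (Sum.inr (Sum.inr 0) : ℕ ⊕ (ℕ ⊕ ℕ)) ::
    (Denumerable.ofNat (List ℕ) n ++ [Encodable.encode (Sum.inr (Sum.inr 4) : ℕ ⊕ (ℕ ⊕ ℕ))]))

theorem negCode_godelCode {k : ℕ} (φ : Larith.BoundedFormula (Fin (k + 1)) 2) :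
    negCode (godelCode φ) = godelCode φ.not := by
  rw [godelCode, godelCode, ← encode_map_encode φ.not.listEncode, negCode, ofNat_encode_eq_map]
  simp [BoundedFormula.listEncode]

/-- The formula saying that if the `n`-th prime divides `specialVar w`, then the prime indexed by
`negCode n` does not. -/
noncomputable def exclusive (k : ℕ) (w : Bool) (n : ℕ) : Larith.BoundedFormula (Fin (k + 1)) 1 :=
  .imp (.imp (notDvd k 0 w (Nat.nth Nat.Prime n)) .falsum)
    (notDvd k 0 w (Nat.nth Nat.Prime (negCode n)))

/-- The type saying that the set of `n` such that the `n`-th prime does not divide `specialVar w`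
codes the complete type of the other special variable over the nonzero parameters. -/
def codeType (k : ℕ) (w : Bool) : Set (Larith.BoundedFormula (Fin (k + 1)) 1) :=
  {ψ | (∃ φ, Omits φ ∧ ψ = guarded w (godelCode φ) φ) ∨ ∃ n, ψ = exclusive k w n}

theorem listEncode_guarded {k : ℕ} (w : Bool) (n : ℕ)
    (φ : Larith.BoundedFormula (Fin (k + 1)) 2) :
    (guarded w n φ).listEncode = Sum.inr (Sum.inr 1) :: Sum.inr (Sum.inr 0) ::
      ((BoundedFormula.equal (.var (.inr 1)) (.var (specialVar k 1 !w)) :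
        Larith.BoundedFormula (Fin (k + 1)) 2).listEncode ++ Sum.inr (Sum.inr 0) ::
      ((notDvd k 1 w (Nat.nth Nat.Prime n)).listEncode ++ φ.listEncode)) := rfl

theorem exists_computable_guarded (k : ℕ) (w : Bool) :
    ∃ f : ℕ → ℕ, Computable f ∧ (∀ n, n < f n) ∧
      ∀ ψ : Larith.BoundedFormula (Fin (k + 1)) 1, ∀ n,
        godelCode ψ = f n ↔ ∃ φ, n = godelCode φ ∧ ψ = guarded w n φ := by
  let T := (Σ j, Larith.Term (Fin (k + 1) ⊕ Fin j)) ⊕ ((Σ n, Larith.Relations n) ⊕ ℕ)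
  let E : T → ℕ := Encodable.encode
  let eqn : Larith.BoundedFormula (Fin (k + 1)) 2 :=
    .equal (.var (.inr 1)) (.var (specialVar k 1 !w))
  let F : ℕ × ℕ → List ℕ := fun a => E (.inr (.inr 1)) :: E (.inr (.inr 0)) ::
    (eqn.listEncode.map E ++ E (.inr (.inr 0)) :: ((notDvd k 1 w a.1).listEncode.map E ++
      Denumerable.ofNat (List ℕ) a.2))
  have hF : Primrec F :=
    Primrec.list_cons.comp (Primrec.const _) (Primrec.list_cons.comp (Primrec.const _)
      (Primrec.list_append.comp (Primrec.const _) (Primrec.list_cons.comp (Primrec.const _)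
        (Primrec.list_append.comp ((primrec_listEncode_notDvd k 1 w).comp Primrec.fst)
          ((Primrec.ofNat _).comp Primrec.snd)))))
  refine ⟨fun n => Encodable.encode (F (Nat.nth Nat.Prime n, n)),
    (Primrec.encode.comp hF).to_comp.comp (computable_nth_prime.pair Computable.id), ?_, ?_⟩
  · intro n
    have h := encode_le_encode_append (E (.inr (.inr 0)) :: (eqn.listEncode.map E ++
      E (.inr (.inr 0)) :: (notDvd k 1 w (Nat.nth Nat.Prime n)).listEncode.map E))
      (Denumerable.ofNat (List ℕ) n)
    simp only [Denumerable.encode_ofNat, List.cons_append, List.append_assoc] at h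
    refine Nat.lt_of_le_of_lt h ?_
    simp only [F, Encodable.encode_list_cons (E (.inr (.inr 1)))]
    exact Nat.lt_succ_of_le (Nat.right_le_pair _ _)
  · intro ψ n
    constructor
    · intro h
      rw [godelCode, ← encode_map_encode, Encodable.encode_inj] at h
      have hpre : F (Nat.nth Nat.Prime n, n) = (.inr (.inr 1) :: .inr (.inr 0) ::
          (eqn.listEncode ++ .inr (.inr 0) :: (notDvd k 1 w (Nat.nth Nat.Prime n)).listEncode) :
            List T).map E ++ Denumerable.ofNat (List ℕ) n := by
        simp [F]
      rw [hpre, List.map_eq_append_iff] at h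
      obtain ⟨l₁, l₂, hψ, h₁, h₂⟩ := h
      obtain rfl := (List.map_injective_iff.2 Encodable.encode_injective) h₁
      simp only [List.cons_append, List.append_assoc] at hψ
      obtain ⟨χ₁, rfl, hχ₁⟩ := exists_eq_all_of_listEncode hψ
      obtain ⟨χ₂, rfl, hχ₂⟩ := exists_eq_imp_of_listEncode (φ := eqn) hχ₁
      obtain ⟨φ, rfl, hφ⟩ := exists_eq_imp_of_listEncode
        (φ := notDvd k 1 w (Nat.nth Nat.Prime n)) hχ₂
      exact ⟨φ, by rw [godelCode, ← encode_map_encode, hφ, h₂, Denumerable.encode_ofNat], rfl⟩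
    · rintro ⟨φ, rfl, rfl⟩
      rw [godelCode, ← encode_map_encode, listEncode_guarded]
      simp only [F, godelCode, ofNat_encode_eq_map, List.map_cons, List.map_append]
      rfl

theorem encode_le_encode_append_right (l₁ l₂ : List ℕ) :
    Encodable.encode l₁ ≤ Encodable.encode (l₁ ++ l₂) := by
  induction l₁ with
  | nil => exact Nat.zero_le _
  | cons a l ih =>
    rw [List.cons_append, Encodable.encode_list_cons, Encodable.encode_list_cons]
    exact Nat.succ_le_succ (StrictMono.monotone (fun _ _ => Nat.pair_lt_pair_right _) ih)

theorem lt_encode_of_mem {a : ℕ} {l : List ℕ} (h : a ∈ l) : a < Encodable.encode l := by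
  induction l with
  | nil => simp at h
  | cons b l ih =>
    rw [Encodable.encode_list_cons]
    rcases List.mem_cons.1 h with rfl | h
    · exact Nat.lt_succ_of_le (Nat.left_le_pair _ _)
    · exact Nat.lt_succ_of_lt ((ih h).trans_le (Nat.right_le_pair _ _))

theorem le_encode_listEncode_numeral {α : Type} [Encodable α] (q : ℕ) :
    q ≤ Encodable.encode (numeral q : Larith.Term α).listEncode := by
  induction q with
  | zero => exact Nat.zero_le _
  | succ q ih =>
    rw [numeral, listEncode_apply₂, Encodable.encode_list_cons, ← encode_map_encode,
      List.map_append]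
    rw [← encode_map_encode] at ih
    exact Nat.succ_le_succ ((ih.trans (encode_le_encode_append_right _ _)).trans
      (Nat.right_le_pair _ _))

theorem lt_encode_listEncode_notDvd (k m : ℕ) (w : Bool) (q : ℕ) :
    q < Encodable.encode (notDvd k m w q).listEncode := by
  rw [← encode_map_encode]
  refine lt_of_le_of_lt ?_ (lt_encode_of_mem (List.mem_map_of_mem (a := Sum.inl ⟨m + 2,
    mulSym.apply₂ (numeral q) (.var (.inr (Fin.last (m + 1))))⟩)
    (by simp [notDvd, BoundedFormula.listEncode])))
  rw [Encodable.encode_inl, Encodable.encode_sigma_val]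
  refine ((?_ : q ≤ _).trans (Nat.right_le_pair (Encodable.encode (m + 2)) _)).trans
    (Nat.le_mul_of_pos_left _ two_pos)
  change q ≤ Encodable.encode (mulSym.apply₂ (numeral q) (.var (.inr (Fin.last (m + 1)))) :
    Larith.Term (Fin (k + 1) ⊕ Fin (m + 2))).listEncode
  rw [listEncode_apply₂, Encodable.encode_list_cons, ← encode_map_encode, List.map_append]
  have h := le_encode_listEncode_numeral (α := Fin (k + 1) ⊕ Fin (m + 2)) q
  rw [← encode_map_encode] at h
  exact (h.trans (encode_le_encode_append_right _ _)).trans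
    ((Nat.right_le_pair _ _).trans (Nat.le_succ _))

theorem primrec_negCode : Primrec negCode :=
  Primrec.encode.comp (Primrec.list_cons.comp (Primrec.const _)
    (Primrec.list_append.comp (Primrec.ofNat _) (Primrec.const _)))

theorem exists_computable_exclusive (k : ℕ) (w : Bool) :
    ∃ f : ℕ → ℕ, Computable f ∧ (∀ n, n < f n) ∧ ∀ n, godelCode (exclusive k w n) = f n := by
  let T := (Σ j, Larith.Term (Fin (k + 1) ⊕ Fin j)) ⊕ ((Σ n, Larith.Relations n) ⊕ ℕ)
  let E : T → ℕ := Encodable.encode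
  let G : ℕ → List ℕ := fun q => (notDvd k 0 w q).listEncode.map Encodable.encode
  let F : ℕ × ℕ → List ℕ := fun a => (E (.inr (.inr 0)) :: E (.inr (.inr 0)) ::
    (G a.1 ++ [E (.inr (.inr 3))])) ++ G a.2
  have hG : Primrec G := primrec_listEncode_notDvd k 0 w
  have hF : Primrec F :=
    Primrec.list_append.comp
      (Primrec.list_cons.comp (Primrec.const _) (Primrec.list_cons.comp (Primrec.const _)
        (Primrec.list_append.comp (hG.comp Primrec.fst) (Primrec.const _)))) (hG.comp Primrec.snd)
  have hcode (n : ℕ) : godelCode (exclusive k w n) =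
      Encodable.encode (F (Nat.nth Nat.Prime n, Nat.nth Nat.Prime (negCode n))) := by
    rw [godelCode, ← encode_map_encode]
    simp only [F, G, exclusive, BoundedFormula.listEncode, List.map_cons, List.map_append,
      List.cons_append, List.map_nil]
    rfl
  refine ⟨_, ((Primrec.encode.comp hF).to_comp.comp (computable_nth_prime.pair
    (computable_nth_prime.comp primrec_negCode.to_comp))), fun n => ?_, hcode⟩
  refine lt_of_lt_of_le (lt_of_le_of_lt ?_ (lt_encode_listEncode_notDvd k 0 w
    (Nat.nth Nat.Prime n))) ?_
  · exact (Nat.le_add_right _ _).trans (Nat.add_two_le_nth_prime n)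
  · rw [← encode_map_encode]
    refine le_trans ?_ (encode_le_encode_append_right _ _)
    exact (encode_le_encode_append_right _ _).trans (encode_le_encode_append [_, _] _)

theorem exists_computable_codeType (k : ℕ) (w : Bool) :
    ∃ d : ℕ → Bool, Computable d ∧ ∀ ψ, ψ ∈ codeType k w ↔ d (godelCode ψ) = true := by
  classical
  obtain ⟨f, hf, hlt, hfeq⟩ := exists_computable_guarded k w
  obtain ⟨g, hg, hgt, hgeq⟩ := exists_computable_exclusive k w
  refine ⟨_, Primrec.or.to_comp.comp (computable_exists_lt_eq hf primrecPred_codeOmits)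
    (computable_exists_lt_eq hg (P := fun _ => True) (PrimrecPred.of_eq
      (Primrec.eq.comp (Primrec.id (α := ℕ)) Primrec.id) (by simp))), fun ψ => ?_⟩
  simp only [Bool.or_eq_true, decide_eq_true_eq, codeType, Set.mem_ofPred_eq]
  refine or_congr ⟨?_, ?_⟩ ⟨?_, ?_⟩
  · rintro ⟨φ, hφ, rfl⟩
    have h := (hfeq (guarded w (godelCode φ) φ) _).2 ⟨φ, rfl, rfl⟩
    exact ⟨godelCode φ, h ▸ hlt _, (codeOmits_iff_omits φ).2 hφ, h⟩
  · rintro ⟨n, -, hn, h⟩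
    obtain ⟨φ, rfl, rfl⟩ := (hfeq _ _).1 h
    exact ⟨φ, (codeOmits_iff_omits φ).1 hn, rfl⟩
  · rintro ⟨n, rfl⟩
    exact ⟨n, hgeq n ▸ hgt n, trivial, hgeq n⟩
  · rintro ⟨n, -, -, h⟩
    exact ⟨n, godelCode_injective (h.trans (hgeq n).symm)⟩

/-! ### Divisibility of standard numerals -/

/-- The `n`-th prime divides `e`. -/
def Dvd {N : Type} [Larith.Structure N] (n : ℕ) (e : N) : Prop :=
  ∃ b, mulF (natE (Nat.nth Nat.Prime n)) b = e

theorem IsPAModel.exists_mul_natE_iff {N : Type} [Larith.Structure N] (h : IsPAModel N) {p m : ℕ}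
    (hp : 0 < p) : (∃ b : N, mulF (natE p) b = natE m) ↔ p ∣ m := by
  obtain ⟨add_assoc, add_comm, add_zero, -, mul_comm, mul_one, mul_zero, mul_add,
    lt_irrefl, lt_trans, lt_tri, add_lt, mul_lt, lt_iff, zero_lt_one, one_le, -, -⟩ := h
  have natE_add (a b : ℕ) : (natE (a + b) : N) = addF (natE a) (natE b) := by
    induction b with
    | zero => exact (add_zero _).symm
    | succ b ih => rw [← Nat.add_assoc, natE, ih, add_assoc]; rfl
  have natE_mul (a b : ℕ) : (natE (a * b) : N) = mulF (natE a) (natE b) := by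
    induction b with
    | zero => exact (mul_zero _).symm
    | succ b ih =>
      rw [Nat.mul_succ, natE_add, ih, natE, mul_add, mul_one]
  have lt_add_one (x : N) : ltF x (addF x oneF) := by
    simpa only [add_comm, add_zero] using add_lt zeroF oneF x zero_lt_one
  have natE_lt {a b : ℕ} (hab : a < b) : ltF (natE a : N) (natE b) := by
    induction b with
    | zero => exact absurd hab (Nat.not_lt_zero a)
    | succ b ih =>
      rcases Nat.lt_succ_iff_lt_or_eq.1 hab with hab | rfl
      · exact lt_trans _ _ _ (ih hab) (lt_add_one _)
      · exact lt_add_one _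
  have mul_natE_lt {x y : N} (hxy : ltF x y) : ltF (mulF (natE p) x) (mulF (natE p) y) := by
    simpa only [mul_comm] using mul_lt x y (natE p) hxy (natE_lt hp)
  constructor
  · rintro ⟨b, hb⟩
    by_contra hpm
    have hmod : 0 < m % p := Nat.pos_of_ne_zero fun h => hpm (Nat.dvd_of_mod_eq_zero h)
    have hlow : ltF (natE (p * (m / p)) : N) (natE m) := natE_lt (by
      have := Nat.div_add_mod m p
      omega)
    have hupp : ltF (natE m : N) (natE (p * (m / p + 1))) := natE_lt (by
      have := Nat.div_add_mod m p
      have := Nat.mod_lt m hp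
      rw [Nat.mul_succ]
      omega)
    rw [natE_mul, ← hb] at hlow hupp
    rcases lt_tri b (natE (m / p)) with hlt | rfl | hlt
    · exact lt_irrefl _ (lt_trans _ _ _ hlow (mul_natE_lt hlt))
    · exact lt_irrefl _ hlow
    · obtain ⟨z, hz, rfl⟩ := (lt_iff _ _).1 hlt
      rcases one_le z hz with hz | rfl
      · have hlt' := add_lt _ _ (natE (m / p)) hz
        rw [add_comm, add_comm z] at hlt'
        exact lt_irrefl _ (lt_trans _ _ _ hupp (mul_natE_lt hlt'))
      · exact lt_irrefl _ hupp
  · rintro ⟨q, rfl⟩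
    exact ⟨natE q, (natE_mul p q).symm⟩

theorem IsPAModel.dvd_natE_iff {N : Type} [Larith.Structure N] (h : IsPAModel N) {n m : ℕ} :
    Dvd n (natE m : N) ↔ Nat.nth Nat.Prime n ∣ m :=
  h.exists_mul_natE_iff (Nat.prime_nth_prime n).pos

theorem nth_prime_dvd_prod_iff (S : Set ℕ) [DecidablePred (· ∈ S)] (j n : ℕ) :
    (Nat.nth Nat.Prime j ∣ ∏ i ∈ Finset.range n, if i ∈ S then Nat.nth Nat.Prime i else 1) ↔
      j < n ∧ j ∈ S := by
  rw [(Nat.prime_nth_prime j).prime.dvd_finsetProd_iff]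
  constructor
  · rintro ⟨i, hi, hdvd⟩
    split_ifs at hdvd with hS
    · rw [Nat.prime_dvd_prime_iff_eq (Nat.prime_nth_prime j) (Nat.prime_nth_prime i)] at hdvd
      obtain rfl := Nat.nth_injective Nat.infinite_setOfPred_prime hdvd
      exact ⟨Finset.mem_range.1 hi, hS⟩
    · exact absurd (Nat.dvd_one.1 hdvd) (Nat.prime_nth_prime j).ne_one
  · rintro ⟨hj, hS⟩
    exact ⟨j, Finset.mem_range.2 hj, by rw [if_pos hS]⟩

/-! ### Realizing types -/

theorem realize_guarded {M : Type} [Larith.Structure M] {k n : ℕ} {w : Bool}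
    {φ : Larith.BoundedFormula (Fin (k + 1)) 2} {a b : M} {v : Fin k → M} :
    (guarded w n φ).Realize (Fin.cons a v) ![b] ↔
      (¬Dvd n (cond w a b) → φ.Realize (Fin.cons a v) ![b, cond w b a]) := by
  have hsnoc (c : M) : (Fin.snoc ![b] c : Fin 2 → M) = ![b, c] := by
    ext i
    fin_cases i <;> rfl
  have hspec (w : Bool) (c : M) :
      Sum.elim (Fin.cons a v : Fin (k + 1) → M) ![b, c] (specialVar k 1 w) = cond w a b := by
    cases w <;> rfl
  simp only [guarded, BoundedFormula.realize_all, BoundedFormula.realize_imp, hsnoc]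
  simp only [BoundedFormula.Realize, Term.realize_var, hspec]
  simp only [realize_notDvd, hspec]
  have hnot : cond (!w) a b = cond w b a := by cases w <;> rfl
  rw [hnot]
  exact ⟨fun h => h _ rfl, fun h c hc => by obtain rfl : c = _ := hc; exact h⟩

theorem realize_exclusive {M : Type} [Larith.Structure M] {k n : ℕ} {w : Bool} {a b : M}
    {v : Fin k → M} :
    (exclusive k w n).Realize (Fin.cons a v) ![b] ↔
      (Dvd n (cond w a b) → ¬Dvd (negCode n) (cond w a b)) := by
  have hspec : Sum.elim (Fin.cons a v : Fin (k + 1) → M) ![b] (specialVar k 0 w) = cond w a b := by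
    cases w <;> rfl
  simp only [exclusive, BoundedFormula.realize_imp, realize_notDvd, hspec, Dvd]
  exact imp_congr not_not Iff.rfl

/-- The set of `n` such that the `n`-th prime does not divide `e` codes the complete type of `c`
over `v`. -/
def CodesType {M : Type} [Larith.Structure M] {k : ℕ} (e c : M) (v : Fin k → M) : Prop :=
  (∀ φ : Larith.BoundedFormula (Fin (k + 1)) 2, Omits φ → ¬Dvd (godelCode φ) e →
    φ.Realize (Fin.cons c v) ![c, c]) ∧ ∀ n, Dvd n e → ¬Dvd (negCode n) e

theorem forall_codeType_realize_iff {M : Type} [Larith.Structure M] {k : ℕ} {w : Bool} {a b : M}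
    {v : Fin k → M} :
    (∀ ψ ∈ codeType k w, ψ.Realize (Fin.cons a v) ![b]) ↔
      CodesType (cond w a b) (cond w b a) v := by
  have hrel {φ : Larith.BoundedFormula (Fin (k + 1)) 2} (hφ : Omits φ) :
      φ.Realize (Fin.cons a v) ![b, cond w b a] ↔
        φ.Realize (Fin.cons (cond w b a) v) ![cond w b a, cond w b a] := by
    refine hφ.realize_iff (fun i hi => ?_) fun i hi => ?_
    · obtain ⟨i, rfl⟩ := Fin.exists_succ_eq.2 hi
      rfl
    · fin_cases i
      · exact absurd rfl hi
      · rfl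
  constructor
  · intro h
    exact ⟨fun φ hφ hd => (hrel hφ).1 (realize_guarded.1 (h _ (.inl ⟨φ, hφ, rfl⟩)) hd),
      fun n => realize_exclusive.1 (h _ (.inr ⟨n, rfl⟩))⟩
  · rintro ⟨h, h'⟩ ψ (⟨φ, hφ, rfl⟩ | ⟨n, rfl⟩)
    · exact realize_guarded.2 fun hd => (hrel hφ).2 (h φ hφ hd)
    · exact realize_exclusive.2 (h' n)

theorem CodesType.not_dvd_iff {M : Type} [Larith.Structure M] {k : ℕ} {e c : M} {v : Fin k → M}
    (h : CodesType e c v) {φ : Larith.BoundedFormula (Fin (k + 1)) 2} (hφ : Omits φ) :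
    ¬Dvd (godelCode φ) e ↔ φ.Realize (Fin.cons c v) ![c, c] := by
  refine ⟨h.1 φ hφ, fun hr hd => ?_⟩
  have hd' := h.2 _ hd
  rw [negCode_godelCode] at hd'
  exact h.1 _ hφ.not hd' hr

/-- In a recursively saturated model of arithmetic every complete type is coded. -/
theorem exists_codesType {M : Type} [Larith.Structure M] (hM : IsPAModel M)
    (hrs : RecursivelySaturated M) {k : ℕ} (c : M) (v : Fin k → M) :
    ∃ e, CodesType e c v := by
  classical
  let S : Set ℕ := {i | ∃ φ : Larith.BoundedFormula (Fin (k + 1)) 2,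
    Omits φ ∧ godelCode φ = i ∧ ¬φ.Realize (Fin.cons c v) ![c, c]}
  let x (n : ℕ) : M := natE (∏ i ∈ Finset.range n, if i ∈ S then Nat.nth Nat.Prime i else 1)
  have hx (j n : ℕ) : Dvd j (x n) ↔ j < n ∧ j ∈ S :=
    hM.dvd_natE_iff.trans (nth_prime_dvd_prod_iff S j n)
  have hev (ψ) (hψ : ψ ∈ codeType k false) :
      ∀ᶠ n in Filter.atTop, ψ.Realize (Fin.cons c v) ![x n] := by
    rcases hψ with ⟨φ, hφ, rfl⟩ | ⟨j, rfl⟩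
    · filter_upwards [Filter.eventually_gt_atTop (godelCode φ)] with n hn
      refine realize_guarded.2 fun hd => ?_
      rw [cond_false, hx] at hd
      by_contra hr
      refine hd ⟨hn, φ, hφ, rfl, ?_⟩
      refine (hφ.realize_iff (fun i _ => rfl) fun i hi => ?_).not.1 hr
      fin_cases i
      · exact absurd rfl hi
      · rfl
    · refine Filter.Eventually.of_forall fun n => realize_exclusive.2 fun hd hd' => ?_
      rw [cond_false, hx] at hd hd'
      obtain ⟨-, φ, -, rfl, hr⟩ := hd
      obtain ⟨-, φ', -, hcode, hr'⟩ := hd'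
      rw [negCode_godelCode] at hcode
      obtain rfl := godelCode_injective hcode
      exact hr' hr
  obtain ⟨e, he⟩ := hrs (k + 1) (codeType k false) (Fin.cons c v)
    (exists_computable_codeType k false) fun s hs => by
      obtain ⟨n, hn⟩ := ((Finset.eventually_all s).2 fun ψ hψ => hev ψ (hs hψ)).exists
      exact ⟨x n, hn⟩
  exact ⟨e, forall_codeType_realize_iff.1 he⟩

theorem CodesType.congr {M N : Type} [Larith.Structure M] [Larith.Structure N]
    (hrs : RecursivelySaturated N) {k : ℕ} {e c : M} {v : Fin k → M} (h : CodesType e c v)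
    {e' : N} (he : ∀ n, Dvd n e ↔ Dvd n e') {u : Fin k → N}
    (hvu : ∀ φ : Larith.Formula (Fin k), φ.Realize v ↔ φ.Realize u) :
    ∃ d, CodesType e' d u := by
  classical
  have hdiag {M : Type} [Larith.Structure M] (φ : Larith.BoundedFormula (Fin (k + 1)) 2) (c : M)
      (v : Fin k → M) :
      (φ.toFormula.relabel (Sum.elim id fun _ => 0)).Realize (Fin.cons c v : Fin (k + 1) → M) ↔
        φ.Realize (Fin.cons c v) ![c, c] := by
    rw [Formula.realize_relabel, BoundedFormula.realize_toFormula]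
    refine iff_of_eq (congrArg₂ _ (funext fun i => rfl) (funext fun i => ?_))
    fin_cases i <;> rfl
  have hex (ψ : codeType k true) : ∃ χ : Larith.Formula (Fin (k + 1)),
      χ.Realize (Fin.cons c v : Fin (k + 1) → M) ∧
        ∀ y : N, χ.Realize (Fin.cons y u : Fin (k + 1) → N) →
          (ψ : Larith.BoundedFormula (Fin (k + 1)) 1).Realize (Fin.cons e' u) ![y] := by
    obtain ⟨ψ, ⟨φ, hφ, rfl⟩ | ⟨n, rfl⟩⟩ := ψ
    · by_cases hd : Dvd (godelCode φ) e
      · exact ⟨⊤, Formula.realize_top.2 trivial,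
          fun y _ => realize_guarded.2 fun hd' => absurd ((he _).1 hd) hd'⟩
      · refine ⟨_, (hdiag φ c v).2 (h.1 φ hφ hd), fun y hy => realize_guarded.2 fun _ => ?_⟩
        refine (hφ.realize_iff (fun i hi => ?_) fun i hi => ?_).1 ((hdiag φ y u).1 hy)
        · obtain ⟨i, rfl⟩ := Fin.exists_succ_eq.2 hi
          rfl
        · fin_cases i
          · exact absurd rfl hi
          · rfl
    · refine ⟨⊤, Formula.realize_top.2 trivial, fun y _ => realize_exclusive.2 ?_⟩
      rw [cond_true, ← he, ← he]
      exact h.2 n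
  choose χ hχ hχ' using hex
  obtain ⟨d, hd⟩ := hrs (k + 1) (codeType k true) (Fin.cons e' u)
    (exists_computable_codeType k true) fun s hs => by
      let θ : Larith.Formula (Fin (k + 1)) := BoundedFormula.iInf fun ψ : s => χ ⟨ψ, hs ψ.2⟩
      let g : Fin (k + 1) → Fin k ⊕ Fin 1 := Fin.cases (.inr 0) .inl
      have hθ {M : Type} [Larith.Structure M] (v : Fin k → M) :
          Formula.Realize (BoundedFormula.relabel (n := 1) (k := 0) g θ).ex v ↔
            ∃ y, θ.Realize (Fin.cons y v : Fin (k + 1) → M) := by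
        rw [Formula.Realize, BoundedFormula.realize_ex]
        refine exists_congr fun y => ?_
        rw [BoundedFormula.realize_relabel]
        refine iff_of_eq (congrArg₂ _ (funext fun i => ?_) (Subsingleton.elim _ _))
        refine Fin.cases rfl (fun i => rfl) i
      obtain ⟨y, hy⟩ := (hθ u).1 ((hvu _).1 ((hθ v).2
        ⟨c, BoundedFormula.realize_iInf.2 fun ψ => hχ _⟩))
      exact ⟨y, fun ψ hψ => hχ' ⟨ψ, hs hψ⟩ y (BoundedFormula.realize_iInf.1 hy ⟨ψ, hψ⟩)⟩
  exact ⟨d, forall_codeType_realize_iff.1 hd⟩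

/-! ### Back and forth -/

theorem exists_forall_realize_cons_iff {M N : Type} [Larith.Structure M] [Larith.Structure N]
    (hM : IsPAModel M) (hrsM : RecursivelySaturated M) (hrsN : RecursivelySaturated N)
    (hssy : StandardSystem M ⊆ StandardSystem N) {k : ℕ} {v : Fin k → M} {u : Fin k → N}
    (hvu : ∀ φ : Larith.Formula (Fin k), φ.Realize v ↔ φ.Realize u) (c : M) :
    ∃ d, ∀ φ : Larith.Formula (Fin (k + 1)),
      φ.Realize (Fin.cons c v : Fin (k + 1) → M) ↔ φ.Realize (Fin.cons d u : Fin (k + 1) → N) := by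
  obtain ⟨e, he⟩ := exists_codesType hM hrsM c v
  obtain ⟨e', he'⟩ := hssy ⟨e, rfl⟩
  have hdvd (n : ℕ) : Dvd n e ↔ Dvd n e' := Set.ext_iff.1 he' n
  obtain ⟨d, hd⟩ := he.congr hrsN hdvd hvu
  refine ⟨d, fun φ => ?_⟩
  have hmove {M : Type} [Larith.Structure M] (c : M) (v : Fin k → M) :
      (BoundedFormula.relabel (n := 2) (k := 0) (moveParam k) φ).Realize
        (Fin.cons c v) ![c, c] ↔ φ.Realize (Fin.cons c v : Fin (k + 1) → M) := by
    rw [BoundedFormula.realize_relabel]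
    refine iff_of_eq (congrArg₂ _ (funext fun i => ?_) (Subsingleton.elim _ _))
    exact Fin.cases rfl (fun i => rfl) i
  rw [← hmove, ← hmove, ← he.not_dvd_iff (omits_relabel φ), hdvd,
    hd.not_dvd_iff (omits_relabel φ)]

/-- The relation preserves the truth of formulas in both directions. -/
def IsElementaryRel {M N : Type} [Larith.Structure M] [Larith.Structure N]
    (S : Set (M × N)) : Prop :=
  ∀ (n : ℕ) (p : Fin n → M × N), (∀ i, p i ∈ S) → ∀ φ : Larith.Formula (Fin n),
    φ.Realize (fun i => (p i).1) ↔ φ.Realize fun i => (p i).2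

section

variable {M N : Type} [Larith.Structure M] [Larith.Structure N]

theorem isElementaryRel_empty (h : M ≅[Larith] N) : IsElementaryRel (∅ : Set (M × N)) := by
  intro n p hp φ
  cases n with
  | succ n => exact absurd (hp 0) (Set.notMem_empty _)
  | zero =>
    have hsent {K : Type} [Larith.Structure K] (w : Fin 0 → K) :
        Sentence.Realize K (φ.relabel (Fin.elim0 : Fin 0 → Empty)) ↔ φ.Realize w := by
      rw [Sentence.Realize, Formula.realize_relabel]
      exact iff_of_eq (congrArg _ (Subsingleton.elim _ _))
    rw [← hsent, ← hsent]
    exact h.realize_sentence _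

theorem IsElementaryRel.exists_insert {S : Finset (M × N)} (hS : IsElementaryRel (S : Set (M × N)))
    (hM : IsPAModel M) (hrsM : RecursivelySaturated M) (hrsN : RecursivelySaturated N)
    (hssy : StandardSystem M ⊆ StandardSystem N) (c : M) :
    ∃ d, IsElementaryRel (insert (c, d) (S : Set (M × N))) := by
  let p (i : Fin S.card) : M × N := S.equivFin.symm i
  obtain ⟨d, hd⟩ := exists_forall_realize_cons_iff hM hrsM hrsN hssy
    (hS _ p fun i => (S.equivFin.symm i).2) c
  refine ⟨d, fun n q hq φ => ?_⟩
  have hex (i : Fin n) : ∃ j : Fin (S.card + 1), q i = (Fin.cons (c, d) p : _ → M × N) j := by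
    rcases hq i with h | h
    · exact ⟨0, h⟩
    · exact ⟨(S.equivFin ⟨q i, h⟩).succ, by simp [p]⟩
  choose g hg using hex
  have := hd (φ.relabel g)
  rw [Formula.realize_relabel, Formula.realize_relabel] at this
  refine (iff_of_eq (congrArg _ (funext fun i => ?_))).trans
    (this.trans (iff_of_eq (congrArg _ (funext fun i => ?_))))
  · rw [hg, Function.comp_apply]
    exact Fin.cases rfl (fun _ => rfl) (g i)
  · rw [hg, Function.comp_apply]
    exact Fin.cases rfl (fun _ => rfl) (g i)

theorem IsElementaryRel.swap {S : Set (M × N)} (hS : IsElementaryRel S) :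
    IsElementaryRel (Prod.swap ⁻¹' S) := fun n p hp φ =>
  (hS n (fun i => (p i).swap) hp φ).symm

theorem IsElementaryRel.exists_equiv {S : Set (M × N)} (hS : IsElementaryRel S)
    (hl : ∀ a, ∃ b, (a, b) ∈ S) (hr : ∀ b, ∃ a, (a, b) ∈ S) : Nonempty (M ≃[Larith] N) := by
  choose f hf using hl
  let F : M ↪ₑ[Larith] N :=
    ⟨f, fun n φ x => (hS n (fun i => (x i, f (x i))) (fun i => hf _) φ).symm⟩
  have hsurj : Function.Surjective f := fun b => by
    obtain ⟨a, ha⟩ := hr b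
    refine ⟨a, ?_⟩
    have h := hS 2 ![(a, f a), (a, b)] (fun i => by fin_cases i <;> simp [hf, ha])
      (Term.equal (.var 0) (.var 1))
    simpa [Formula.realize_equal] using h
  exact ⟨⟨Equiv.ofBijective f ⟨F.injective, hsurj⟩, F.map_fun, F.map_rel⟩⟩

end

/-- The finite partial elementary maps from `M` to `N`. -/
abbrev PartialElementaryMap (M N : Type) [Larith.Structure M] [Larith.Structure N] : Type :=
  {S : Finset (M × N) // IsElementaryRel (S : Set (M × N))}

end Larith

/-- **Uniqueness of countable recursively saturated models.** Any two countable recursively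
saturated models of PA with the same standard system and the same complete theory are
isomorphic. -/
theorem countable_recursively_saturated_models_isomorphic
    (M₁ M₂ : Type) [Larith.Structure M₁] [Larith.Structure M₂]
    (h₁ : IsPAModel M₁) (h₂ : IsPAModel M₂)
    (hc₁ : Countable M₁) (hc₂ : Countable M₂)
    (hrs₁ : RecursivelySaturated M₁) (hrs₂ : RecursivelySaturated M₂)
    (hssy : StandardSystem M₁ = StandardSystem M₂)
    (hth : M₁ ≅[Larith] M₂) :
    Nonempty (M₁ ≃[Larith] M₂) := by
  classical
  have hleft (a : M₁) : IsCofinal {f : PartialElementaryMap M₁ M₂ | ∃ b, (a, b) ∈ f.1} := by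
    intro f
    obtain ⟨b, hb⟩ := f.2.exists_insert h₁ hrs₁ hrs₂ hssy.subset a
    exact ⟨⟨insert (a, b) f.1, by rwa [Finset.coe_insert]⟩, ⟨b, Finset.mem_insert_self _ _⟩,
      Finset.subset_insert _ _⟩
  have hright (b : M₂) : IsCofinal {f : PartialElementaryMap M₁ M₂ | ∃ a, (a, b) ∈ f.1} := by
    intro f
    have hswap : IsElementaryRel (f.1.map (Equiv.prodComm _ _).toEmbedding : Set (M₂ × M₁)) := by
      convert f.2.swap
      ext ⟨x, y⟩
      simp
    obtain ⟨a, ha⟩ := hswap.exists_insert h₂ hrs₂ hrs₁ hssy.superset b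
    refine ⟨⟨insert (a, b) f.1, ?_⟩, ⟨a, Finset.mem_insert_self _ _⟩, Finset.subset_insert _ _⟩
    convert ha.swap
    ext ⟨x, y⟩
    simp [and_comm]
  obtain ⟨_⟩ := nonempty_encodable (M₁ ⊕ M₂)
  let 𝒟 : M₁ ⊕ M₂ → Order.Cofinal (PartialElementaryMap M₁ M₂) :=
    Sum.elim (fun a => ⟨_, hleft a⟩) fun b => ⟨_, hright b⟩
  let f₀ : PartialElementaryMap M₁ M₂ := ⟨∅, by
    rw [Finset.coe_empty]
    exact isElementaryRel_empty hth⟩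
  let I := Order.idealOfCofinals f₀ 𝒟
  refine IsElementaryRel.exists_equiv (S := {x | ∃ f ∈ I, x ∈ f.1}) (fun n p hp φ => ?_)
    (fun a => ?_) fun b => ?_
  · choose f hf hpf using hp
    have : Nonempty I := I.nonempty.to_subtype
    obtain ⟨g, hg⟩ := I.directed.directed_val.finite_le fun i => (⟨f i, hf i⟩ : I)
    exact g.1.2 n p (fun i => hg i (hpf i)) φ
  · obtain ⟨f, ⟨b, hb⟩, hf⟩ := Order.cofinal_meets_idealOfCofinals f₀ 𝒟 (.inl a)
    exact ⟨b, f, hf, hb⟩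
  · obtain ⟨f, ⟨a, ha⟩, hf⟩ := Order.cofinal_meets_idealOfCofinals f₀ 𝒟 (.inr b)
    exact ⟨a, f, hf, ha⟩
end

section
/- If X ⊆ ℕ is 1-generic, then the Turing jump of X satisfies X′ ≡_T 0′ ⊕ X. -/
open Classical

/-- Codes for oracle partial recursive functions: the usual codes for partial recursive
functions (as in `Nat.Partrec.Code`) together with a code `oracle` for the oracle function. -/
inductive OCode : Type
  | zero : OCode
  | succ : OCode
  | left : OCode
  | right : OCode
  | oracle : OCode
  | pair : OCode → OCode → OCode
  | comp : OCode → OCode → OCode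
  | prec : OCode → OCode → OCode
  | rfind' : OCode → OCode

/-- The evaluation of the oracle code `c` with oracle `O`, as a partial function `ℕ →. ℕ`;
this is the relativized version of `Nat.Partrec.Code.eval`. -/
def oeval (O : ℕ → ℕ) : OCode → ℕ →. ℕ
  | .zero => pure 0
  | .succ => fun n => Part.some (n + 1)
  | .left => fun n => Part.some n.unpair.1
  | .right => fun n => Part.some n.unpair.2
  | .oracle => fun n => Part.some (O n)
  | .pair cf cg => fun n => Nat.pair <$> oeval O cf n <*> oeval O cg n
  | .comp cf cg => fun n => oeval O cg n >>= oeval O cf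
  | .prec cf cg =>
    Nat.unpaired fun a n =>
      n.rec (oeval O cf a) fun y IH => do
        let i ← IH
        oeval O cg (Nat.pair a (Nat.pair y i))
  | .rfind' cf =>
    Nat.unpaired fun a m =>
      (Nat.rfind fun n => (fun x => x = 0) <$> oeval O cf (Nat.pair a (n + m))).map (· + m)

/-- The canonical Gödel numbering of oracle codes. -/
def encodeO : OCode → ℕ
  | .zero => 0
  | .succ => 1
  | .left => 2
  | .right => 3
  | .oracle => 4
  | .pair cf cg => 5 * Nat.pair (encodeO cf) (encodeO cg) + 5
  | .comp cf cg => 5 * Nat.pair (encodeO cf) (encodeO cg) + 6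
  | .prec cf cg => 5 * Nat.pair (encodeO cf) (encodeO cg) + 7
  | .rfind' cf => 5 * encodeO cf + 8

/-- The characteristic function of a set of natural numbers. -/
noncomputable def chi (A : Set ℕ) : ℕ → ℕ := fun n => if n ∈ A then 1 else 0

/-- Turing reducibility: `A ≤ᵀ B` iff the characteristic function of `A` is computable from
the oracle `B`. -/
def TuringLE (A B : Set ℕ) : Prop :=
  ∃ c : OCode, ∀ n : ℕ, oeval (chi B) c n = Part.some (chi A n)

/-- Turing equivalence. -/
def TuringEquiv (A B : Set ℕ) : Prop := TuringLE A B ∧ TuringLE B A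

/-- The Turing jump `A′` of `A`: the halting problem relative to `A`. -/
def jump (A : Set ℕ) : Set ℕ :=
  {n | ∃ c : OCode, encodeO c = n ∧ (oeval (chi A) c n).Dom}

/-- The `n`-th iterate `0⁽ⁿ⁾` of the Turing jump of the empty set. -/
def zeroJump (n : ℕ) : Set ℕ := jump^[n] ∅

/-- The recursive join `A ⊕ B` of two sets of natural numbers. -/
def join (A B : Set ℕ) : Set ℕ :=
  {n | (∃ k, n = 2 * k ∧ k ∈ A) ∨ ∃ k, n = 2 * k + 1 ∧ k ∈ B}

/-- `S` is computably enumerable (Σ⁰₁) relative to the oracle `Z`, as a set of finite binary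
strings. -/
def CEIn (Z : Set ℕ) (S : Set (List Bool)) : Prop :=
  ∃ c : OCode, ∀ s : List Bool, s ∈ S ↔ (oeval (chi Z) c (Encodable.encode s)).Dom

/-- The length-`k` initial segment of (the characteristic function of) `X`, as a finite
binary string. -/
noncomputable def seg (X : Set ℕ) (k : ℕ) : List Bool :=
  (List.range k).map fun n => if n ∈ X then true else false

/-- `X` meets or avoids the set `S` of finite binary strings: some initial segment of `X`
lies in `S`, or some initial segment of `X` has no extension in `S`. -/
def MeetsOrAvoids (X : Set ℕ) (S : Set (List Bool)) : Prop :=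
  ∃ k : ℕ, seg X k ∈ S ∨ ∀ s : List Bool, seg X k <+: s → s ∉ S

/-- `X` is `1`-generic relative to the oracle `Z`: `X` meets or avoids every set of strings
that is computably enumerable in `Z`. -/
def OneGenericIn (Z : Set ℕ) (X : Set ℕ) : Prop :=
  ∀ S : Set (List Bool), CEIn Z S → MeetsOrAvoids X S

/-- `X` is `n`-generic: `X` meets or avoids every Σ⁰ₙ set of finite binary strings,
i.e. (by Post's theorem) every set of strings computably enumerable in `0⁽ⁿ⁻¹⁾`. -/
def NGeneric (n : ℕ) (X : Set ℕ) : Prop :=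
  OneGenericIn (zeroJump (n - 1)) X

open Nat.Partrec (Code)
open Encodable

/-! ### Functions computable from an oracle -/

/-- The oracle code that computes what an ordinary code computes, never asking the oracle. -/
def OCode.ofCode : Code → OCode
  | .zero => .zero
  | .succ => .succ
  | .left => .left
  | .right => .right
  | .pair c d => .pair (ofCode c) (ofCode d)
  | .comp c d => .comp (ofCode c) (ofCode d)
  | .prec c d => .prec (ofCode c) (ofCode d)
  | .rfind' c => .rfind' (ofCode c)

theorem oeval_ofCode (O : ℕ → ℕ) (c : Code) : oeval O (OCode.ofCode c) = c.eval := by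
  induction c with
  | pair c d hc hd | comp c d hc hd | prec c d hc hd => simp only [OCode.ofCode, oeval, hc, hd]; rfl
  | rfind' c hc => simp only [OCode.ofCode, oeval, hc]; rfl
  | _ => rfl

/-- The total function `f` is computable from the oracle `O`. -/
def ComputableFrom (O f : ℕ → ℕ) : Prop :=
  ∃ c : OCode, ∀ n, oeval O c n = Part.some (f n)

namespace ComputableFrom

variable {O f g : ℕ → ℕ}

theorem of_primrec (hf : Primrec f) : ComputableFrom O f := by
  obtain ⟨c, hc⟩ := Code.exists_code.1 (Nat.Partrec.of_primrec (Primrec.nat_iff.1 hf))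
  exact ⟨OCode.ofCode c, fun n => by rw [oeval_ofCode, hc]; rfl⟩

theorem oracle : ComputableFrom O O := ⟨.oracle, fun _ => rfl⟩

theorem comp (hf : ComputableFrom O f) (hg : ComputableFrom O g) :
    ComputableFrom O fun n => f (g n) := by
  obtain ⟨c, hc⟩ := hf
  obtain ⟨d, hd⟩ := hg
  exact ⟨.comp c d, fun n => by simp only [oeval, hd, ← hc]; exact Part.bind_some _ _⟩

theorem pair (hf : ComputableFrom O f) (hg : ComputableFrom O g) :
    ComputableFrom O fun n => Nat.pair (f n) (g n) := by
  obtain ⟨c, hc⟩ := hf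
  obtain ⟨d, hd⟩ := hg
  exact ⟨.pair c d, fun n => by simp [oeval, hc, hd, Seq.seq]⟩

/-- Composition of a primitive recursive function of two arguments with computable ones. -/
theorem comp₂ {h : ℕ → ℕ → ℕ} (hh : Primrec₂ h) (hf : ComputableFrom O f)
    (hg : ComputableFrom O g) : ComputableFrom O fun n => h (f n) (g n) := by
  have h₁ : Primrec fun p : ℕ => h p.unpair.1 p.unpair.2 :=
    hh.comp (Primrec.fst.comp .unpair) (Primrec.snd.comp .unpair)
  simpa using (of_primrec h₁).comp (hf.pair hg)

/-- Primitive recursion with initial value `b` and step function `g`. -/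
theorem prec {h : ℕ → ℕ} (b : ℕ) (hg : ComputableFrom O g)
    (h_zero : h 0 = b) (h_succ : ∀ n, h (n + 1) = g (Nat.pair n (h n))) :
    ComputableFrom O h := by
  obtain ⟨c, hc⟩ := of_primrec (O := O) (Primrec.const (α := ℕ) b)
  obtain ⟨d, hd⟩ := hg.comp (of_primrec (Primrec.snd.comp Primrec.unpair))
  have hprec : ComputableFrom O fun p => h p.unpair.2 := by
    refine ⟨.prec c d, fun p => ?_⟩
    simp only [oeval, Nat.unpaired]
    generalize p.unpair.2 = n
    induction n with
    | zero => simp [hc, h_zero]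
    | succ n ih =>
      simp only [ih]
      simp [hd, h_succ]
  simpa using hprec.comp
    (of_primrec (Primrec₂.natPair.comp (Primrec.const 0) Primrec.id))

/-- Unbounded search for a zero. -/
theorem find (hf : ComputableFrom O f) (hex : ∀ n, ∃ k, f (Nat.pair n k) = 0) :
    ComputableFrom O fun n => Nat.find (hex n) := by
  obtain ⟨c, hc⟩ := hf
  obtain ⟨d, hd⟩ := of_primrec (O := O)
    (Primrec₂.natPair.comp Primrec.id (Primrec.const 0))
  refine ⟨.comp (.rfind' c) d, fun n => ?_⟩
  simp only [oeval, hd, Nat.unpaired, id, Part.bind_eq_bind, Part.bind_some, Nat.unpair_pair, hc]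
  rw [Part.eq_some_iff, Part.mem_map_iff]
  refine ⟨Nat.find (hex n), Nat.mem_rfind.2 ⟨?_, fun {m} hm => ?_⟩, rfl⟩
  · simpa using Nat.find_spec (hex n)
  · simpa using Nat.find_min (hex n) hm

end ComputableFrom

/-! ### Numbering of oracle codes -/

theorem encodeO_injective : Function.Injective encodeO := by
  intro c
  induction c with
  | pair c d hc hd | comp c d hc hd | prec c d hc hd =>
    intro e h
    cases e <;> simp only [encodeO] at h <;> try omega
    obtain ⟨h₁, h₂⟩ := Nat.pair_eq_pair.1
      (Nat.eq_of_mul_eq_mul_left (by decide) (Nat.add_right_cancel h))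
    rw [hc h₁, hd h₂]
  | rfind' c hc =>
    intro e h
    cases e <;> simp only [encodeO] at h <;> try omega
    rw [hc (Nat.eq_of_mul_eq_mul_left (by decide) (Nat.add_right_cancel h))]
  | _ => intro e h; cases e <;> simp only [encodeO] at h <;> first | rfl | omega

/-- The oracle code of the constant function with value `n`. -/
def OCode.const : ℕ → OCode
  | 0 => .zero
  | n + 1 => .comp .succ (const n)

theorem oeval_const (O : ℕ → ℕ) (n m : ℕ) : oeval O (OCode.const n) m = Part.some n := by
  induction n with
  | zero => rfl
  | succ n ih => simp [OCode.const, oeval, ih]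

theorem primrec_encodeO_const : Primrec fun n => encodeO (OCode.const n) := by
  have h : Primrec₂ fun (_ : ℕ) (p : ℕ × ℕ) => 5 * Nat.pair 1 p.2 + 6 :=
    (Primrec.nat_add.comp (Primrec.nat_mul.comp (Primrec.const 5)
      (Primrec₂.natPair.comp (Primrec.const 1) (Primrec.snd.comp Primrec.snd)))
      (Primrec.const 6)).to₂
  refine (Primrec.nat_rec' (f := fun n : ℕ => n) (g := fun _ => 0) Primrec.id (Primrec.const 0)
    h).of_eq fun n => ?_
  induction n with
  | zero => rfl
  | succ n ih => simp only [OCode.const, encodeO, ← ih]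

/-! ### Sets reducible to a jump -/

theorem mem_jump_encodeO {A : Set ℕ} {c : OCode} :
    encodeO c ∈ jump A ↔ (oeval (chi A) c (encodeO c)).Dom :=
  ⟨fun ⟨_, h, hd⟩ => encodeO_injective h ▸ hd, fun h => ⟨c, rfl, h⟩⟩

/-- The domain of an oracle code with oracle `A` is many-one reducible to the jump of `A`,
by a reduction that does not depend on `A`. -/
theorem exists_reduction_to_jump (c : OCode) :
    ∃ f : ℕ → ℕ, Primrec f ∧ ∀ (A : Set ℕ) (n : ℕ), f n ∈ jump A ↔ (oeval (chi A) c n).Dom := by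
  refine ⟨fun n => encodeO (.comp c (.const n)), ?_, fun A n => ?_⟩
  · exact Primrec.nat_add.comp (Primrec.nat_mul.comp (Primrec.const 5)
      (Primrec₂.natPair.comp (Primrec.const _) primrec_encodeO_const)) (Primrec.const 6)
  · rw [mem_jump_encodeO]
    change ((oeval (chi A) (.const n) _).bind (oeval (chi A) c)).Dom ↔ _
    rw [oeval_const]
    exact iff_of_eq (congrArg Part.Dom (Part.bind_some _ _))

/-- A c.e. set is many-one reducible to every jump, by a uniform reduction. -/
theorem REPred.exists_reduction_to_jump {α : Type*} [Primcodable α] {p : α → Prop}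
    (hp : REPred p) :
    ∃ f : ℕ → ℕ, Primrec f ∧ ∀ (A : Set ℕ) (a : α), f (encode a) ∈ jump A ↔ p a := by
  obtain ⟨c, hc⟩ := Code.exists_code.1 hp
  obtain ⟨f, hf, h⟩ := _root_.exists_reduction_to_jump (OCode.ofCode c)
  refine ⟨f, hf, fun A a => ?_⟩
  rw [h, oeval_ofCode, hc]
  simp [Part.assert, Part.map]

/-- Every set is many-one reducible to its jump, by a uniform reduction. -/
theorem exists_reduction_to_own_jump :
    ∃ f : ℕ → ℕ, Primrec f ∧ ∀ (A : Set ℕ) (n : ℕ), f n ∈ jump A ↔ n ∈ A := by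
  have hv : Partrec fun n : ℕ => ((if n = 0 then none else some 0 : Option ℕ) : Part ℕ) :=
    Computable.ofOption (Primrec.ite (Primrec.eq.comp Primrec.id (Primrec.const 0))
      (Primrec.const none) (Primrec.const (some 0))).to_comp
  obtain ⟨c, hc⟩ := Code.exists_code.1 (Partrec.nat_iff.1 hv)
  obtain ⟨f, hf, h⟩ := exists_reduction_to_jump (.comp (.ofCode c) .oracle)
  refine ⟨f, hf, fun A n => ?_⟩
  rw [h]
  by_cases hn : n ∈ A <;> simp [oeval, oeval_ofCode, hc, chi, hn]

theorem TuringLE.of_reduction {A B : Set ℕ} {f : ℕ → ℕ} (hf : Primrec f)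
    (h : ∀ n, f n ∈ B ↔ n ∈ A) : TuringLE A B := by
  obtain ⟨c, hc⟩ := ComputableFrom.oracle (O := chi B) |>.comp (.of_primrec hf)
  exact ⟨c, fun n => by simp [hc, chi, h]⟩

/-- The projection of a c.e. set is c.e. -/
theorem REPred.exists {α β : Type*} [Primcodable α] [Primcodable β] {p : α × β → Prop}
    (hp : REPred p) : REPred fun a => ∃ b, p (a, b) := by
  obtain ⟨c, hc⟩ := Code.exists_code.1 hp
  have hdom (x : α × β) : p x ↔ ∃ k, ∃ y, y ∈ Code.evaln k c (encode x) := by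
    have : p x ↔ (c.eval (encode x)).Dom := by
      rw [hc]; simp [Part.assert, Part.map]
    rw [this, Part.dom_iff_mem, exists_comm]
    simp only [Code.evaln_complete]
  have hs : Computable₂ fun (a : α) (m : ℕ) => (decode (α := β) m.unpair.2).bind fun b =>
      Code.evaln m.unpair.1 c (encode (a, b)) := by
    refine Primrec.to_comp (Primrec.option_bind
      (Primrec.decode.comp (Primrec.snd.comp (Primrec.unpair.comp Primrec.snd))) ?_)
    exact (Code.primrec_evaln.comp (Primrec.pair (Primrec.pair
      (Primrec.fst.comp (Primrec.unpair.comp (Primrec.snd.comp Primrec.fst))) (Primrec.const c))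
      (Primrec.encode.comp (Primrec.pair (Primrec.fst.comp Primrec.fst) Primrec.snd)))).to₂
  refine (Partrec.rfindOpt hs).dom_re.of_eq fun a => ?_
  rw [Nat.rfindOpt_dom]
  simp only [hdom]
  constructor
  · rintro ⟨m, y, hy⟩
    obtain ⟨b, -, hb⟩ := Option.mem_bind_iff.1 hy
    exact ⟨b, _, y, hb⟩
  · rintro ⟨b, k, y, hy⟩
    exact ⟨Nat.pair k (encode b), y, by simpa using hy⟩

/-! ### Replacing the oracle by an ordinary program -/

/-- The code `c` with its oracle replaced by the program `q`. -/
def OCode.subst (q : Code) : OCode → Code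
  | .zero => .zero
  | .succ => .succ
  | .left => .left
  | .right => .right
  | .oracle => q
  | .pair c d => .pair (subst q c) (subst q d)
  | .comp c d => .comp (subst q c) (subst q d)
  | .prec c d => .prec (subst q c) (subst q d)
  | .rfind' c => .rfind' (subst q c)

/-- If `q` never disagrees with `O`, computations with `q` in place of the oracle `O` are correct. -/
theorem mem_oeval_of_mem_eval_subst {O : ℕ → ℕ} {q : Code} (hq : ∀ x, ∀ y ∈ q.eval x, y = O x)
    (c : OCode) : ∀ x, ∀ y ∈ (c.subst q).eval x, y ∈ oeval O c x := by
  induction c with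
  | oracle => exact fun x y h => Part.mem_some_iff.2 (hq x y h)
  | pair c d hc hd =>
    intro x y h
    simp only [OCode.subst, Code.eval, oeval, Seq.seq, Part.map_eq_map, Part.mem_bind_iff,
      Part.mem_map_iff, exists_exists_and_eq_and] at h ⊢
    obtain ⟨a, ha, b, hb, rfl⟩ := h
    exact ⟨a, hc _ _ ha, b, hd _ _ hb, rfl⟩
  | comp c d hc hd =>
    intro x y h
    obtain ⟨a, ha, hy⟩ := Part.mem_bind_iff.1 h
    exact Part.mem_bind_iff.2 ⟨a, hd _ _ ha, hc _ _ hy⟩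
  | prec c d hc hd =>
    intro x
    simp only [OCode.subst, Code.eval, oeval, Nat.unpaired]
    generalize x.unpair.2 = n
    induction n with
    | zero => exact hc _
    | succ n ih =>
      intro y h
      obtain ⟨a, ha, hy⟩ := Part.mem_bind_iff.1 h
      exact Part.mem_bind_iff.2 ⟨a, ih _ ha, hd _ _ hy⟩
  | rfind' c hc =>
    intro x y h
    obtain ⟨n, hn, rfl⟩ := (Part.mem_map_iff _).1 h
    refine (Part.mem_map_iff _).2 ⟨n, ?_, rfl⟩
    replace hn := Nat.mem_rfind.1 hn
    refine Nat.mem_rfind.2 ⟨?_, fun {m} hm => ?_⟩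
    · obtain ⟨v, hv, h0⟩ := (Part.mem_map_iff _).1 hn.1
      exact (Part.mem_map_iff _).2 ⟨v, hc _ _ hv, h0⟩
    · obtain ⟨v, hv, h0⟩ := (Part.mem_map_iff _).1 (hn.2 hm)
      exact (Part.mem_map_iff _).2 ⟨v, hc _ _ hv, h0⟩
  | _ => exact fun x y h => h

/-- The use principle: a converging computation asks finitely many oracle questions. -/
theorem exists_use {O : ℕ → ℕ} (c : OCode) : ∀ x, ∀ y ∈ oeval O c x, ∃ K, ∀ q : Code,
    (∀ i < K, O i ∈ q.eval i) → y ∈ (c.subst q).eval x := by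
  induction c with
  | oracle =>
    intro x y h
    exact ⟨x + 1, fun q hq => Part.mem_some_iff.1 h ▸ hq x (Nat.lt_succ_self x)⟩
  | pair c d hc hd =>
    intro x y h
    simp only [OCode.subst, Code.eval, oeval, Seq.seq, Part.map_eq_map, Part.mem_bind_iff,
      Part.mem_map_iff, exists_exists_and_eq_and] at h ⊢
    obtain ⟨a, ha, b, hb, rfl⟩ := h
    obtain ⟨K, hK⟩ := hc _ _ ha
    obtain ⟨L, hL⟩ := hd _ _ hb
    exact ⟨max K L, fun q hq => ⟨a, hK q fun i hi => hq i (lt_max_of_lt_left hi), b,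
      hL q fun i hi => hq i (lt_max_of_lt_right hi), rfl⟩⟩
  | comp c d hc hd =>
    intro x y h
    obtain ⟨a, ha, hy⟩ := Part.mem_bind_iff.1 h
    obtain ⟨K, hK⟩ := hd _ _ ha
    obtain ⟨L, hL⟩ := hc _ _ hy
    exact ⟨max K L, fun q hq => Part.mem_bind_iff.2
      ⟨a, hK q fun i hi => hq i (lt_max_of_lt_left hi),
        hL q fun i hi => hq i (lt_max_of_lt_right hi)⟩⟩
  | prec c d hc hd =>
    intro x
    simp only [OCode.subst, Code.eval, oeval, Nat.unpaired]
    generalize x.unpair.2 = n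
    induction n with
    | zero => exact hc _
    | succ n ih =>
      intro y h
      obtain ⟨a, ha, hy⟩ := Part.mem_bind_iff.1 h
      obtain ⟨K, hK⟩ := ih _ ha
      obtain ⟨L, hL⟩ := hd _ _ hy
      exact ⟨max K L, fun q hq => Part.mem_bind_iff.2
        ⟨a, hK q fun i hi => hq i (lt_max_of_lt_left hi),
          hL q fun i hi => hq i (lt_max_of_lt_right hi)⟩⟩
  | rfind' c hc =>
    intro x y h
    obtain ⟨n, hn, rfl⟩ := (Part.mem_map_iff _).1 h
    replace hn := Nat.mem_rfind.1 hn
    have hex (m : ℕ) : ∃ K, ∀ b : Bool,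
        b ∈ (fun z => decide (z = 0)) <$> oeval O c (Nat.pair x.unpair.1 (m + x.unpair.2)) →
        ∀ q : Code, (∀ i < K, O i ∈ q.eval i) → b ∈ (fun z => decide (z = 0)) <$>
          (c.subst q).eval (Nat.pair x.unpair.1 (m + x.unpair.2)) := by
      by_cases hdom : (oeval O c (Nat.pair x.unpair.1 (m + x.unpair.2))).Dom
      · obtain ⟨v, hv⟩ := Part.dom_iff_mem.1 hdom
        obtain ⟨K, hK⟩ := hc _ _ hv
        refine ⟨K, fun b hb q hq => (Part.mem_map_iff _).2 ⟨v, hK q hq, ?_⟩⟩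
        obtain ⟨w, hw, rfl⟩ := (Part.mem_map_iff _).1 hb
        rw [Part.mem_unique hv hw]
      · refine ⟨0, fun b hb => ?_⟩
        obtain ⟨w, hw, -⟩ := (Part.mem_map_iff _).1 hb
        exact absurd (Part.dom_iff_mem.2 ⟨w, hw⟩) hdom
    choose K hK using hex
    refine ⟨(Finset.range (n + 1)).sup K, fun q hq => (Part.mem_map_iff _).2
      ⟨n, Nat.mem_rfind.2 ⟨hK n _ hn.1 q fun i hi => hq i ?_, fun {m} hm =>
        hK m _ (hn.2 hm) q fun i hi => hq i ?_⟩, rfl⟩⟩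
    · exact hi.trans_le (Finset.le_sup (f := K) (Finset.self_mem_range_succ n))
    · exact hi.trans_le (Finset.le_sup (f := K)
        (Finset.mem_range.2 (hm.trans (Nat.lt_succ_self n))))
  | _ => exact fun x y h => ⟨0, fun _ _ => h⟩

theorem eval_subst_of_total {O : ℕ → ℕ} {q : Code} (hq : ∀ x, q.eval x = Part.some (O x))
    (c : OCode) : (c.subst q).eval = oeval O c := by
  funext x
  refine Part.ext fun y => ⟨mem_oeval_of_mem_eval_subst (fun x y h => ?_) c x y, fun h => ?_⟩
  · rw [hq] at h
    exact Part.mem_some_iff.1 h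
  · obtain ⟨K, hK⟩ := exists_use c x y h
    exact hK q fun i _ => hq i ▸ Part.mem_some _

/-- One step of `substNum`: `a`, `b`, `d` are the results for the left, right and only
subcode. -/
def substNumStep (q : Code) (n : ℕ) (a b d : Option Code) : Option Code :=
  if n = 0 then some .zero
  else if n = 1 then some .succ
  else if n = 2 then some .left
  else if n = 3 then some .right
  else if n = 4 then some q
  else if n % 5 = 0 then a.bind fun x => b.map fun y => .pair x y
  else if n % 5 = 1 then a.bind fun x => b.map fun y => .comp x y
  else if n % 5 = 2 then a.bind fun x => b.map fun y => .prec x y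
  else if n % 5 = 3 then d.map .rfind'
  else none

/-- `OCode.subst` on the level of Gödel numbers; it is `none` on numbers that are not the
Gödel number of a code. -/
def substNum (q : Code) (n : ℕ) : Option Code :=
  if _h : n < 5 then substNumStep q n none none none
  else
    substNumStep q n (substNum q (n / 5 - 1).unpair.1) (substNum q (n / 5 - 1).unpair.2)
      (substNum q (n / 5 - 1))
termination_by n
decreasing_by
  · have := Nat.unpair_left_le (n / 5 - 1); omega
  · have := Nat.unpair_right_le (n / 5 - 1); omega
  · omega

theorem substNum_encodeO (q : Code) (c : OCode) :
    substNum q (encodeO c) = some (c.subst q) := by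
  induction c with
  | pair c d hc hd | comp c d hc hd | prec c d hc hd =>
    rw [encodeO, substNum, dif_neg (by omega)]
    have h (r : ℕ) (m : ℕ) (hr : 5 ≤ r) (hr' : r < 10) : (5 * m + r) / 5 - 1 = m := by omega
    have h' (m : ℕ) : (5 * m + 5) % 5 = 0 ∧ (5 * m + 6) % 5 = 1 ∧ (5 * m + 7) % 5 = 2 := by omega
    rw [h _ _ (by decide) (by decide)]
    simp [substNumStep, hc, hd, h', OCode.subst]
  | rfind' c hc =>
    rw [encodeO, substNum, dif_neg (by omega)]
    have h (m : ℕ) : (5 * m + 8) / 5 - 1 = m := by omega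
    have h' (m : ℕ) : (5 * m + 8) % 5 = 3 := by omega
    simp [substNumStep, hc, h, h', OCode.subst]
  | _ => simp [encodeO, substNum, substNumStep, OCode.subst]

theorem exists_encodeO_of_substNum (q : Code) (n : ℕ) :
    ∀ d ∈ substNum q n, ∃ c, encodeO c = n := by
  induction n using Nat.strong_induction_on with
  | _ n ih =>
    intro d hd
    rw [substNum] at hd
    split_ifs at hd with h
    · interval_cases n
      exacts [⟨.zero, rfl⟩, ⟨.succ, rfl⟩, ⟨.left, rfl⟩, ⟨.right, rfl⟩, ⟨.oracle, rfl⟩]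
    · have h₁ := ih (n / 5 - 1).unpair.1 (by have := Nat.unpair_left_le (n / 5 - 1); omega)
      have h₂ := ih (n / 5 - 1).unpair.2 (by have := Nat.unpair_right_le (n / 5 - 1); omega)
      have h₃ := ih (n / 5 - 1) (by omega)
      simp only [substNumStep, show n ≠ 0 by omega, show n ≠ 1 by omega, show n ≠ 2 by omega,
        show n ≠ 3 by omega, show n ≠ 4 by omega, if_false] at hd
      have key {a b : Option Code} {f : Code → Code → Code}
          (hd : d ∈ a.bind fun x => b.map fun y => f x y) : (∃ x, x ∈ a) ∧ ∃ y, y ∈ b := by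
        obtain ⟨x, hx, hd⟩ := Option.mem_bind_iff.1 hd
        obtain ⟨y, hy, -⟩ := Option.mem_map.1 hd
        exact ⟨⟨x, hx⟩, y, hy⟩
      split_ifs at hd with h0 h1 h2 h3
      · obtain ⟨⟨x, hx⟩, y, hy⟩ := key hd
        obtain ⟨c, hc⟩ := h₁ x hx
        obtain ⟨e, he⟩ := h₂ y hy
        exact ⟨.pair c e, by rw [encodeO, hc, he, Nat.pair_unpair]; omega⟩
      · obtain ⟨⟨x, hx⟩, y, hy⟩ := key hd
        obtain ⟨c, hc⟩ := h₁ x hx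
        obtain ⟨e, he⟩ := h₂ y hy
        exact ⟨.comp c e, by rw [encodeO, hc, he, Nat.pair_unpair]; omega⟩
      · obtain ⟨⟨x, hx⟩, y, hy⟩ := key hd
        obtain ⟨c, hc⟩ := h₁ x hx
        obtain ⟨e, he⟩ := h₂ y hy
        exact ⟨.prec c e, by rw [encodeO, hc, he, Nat.pair_unpair]; omega⟩
      · obtain ⟨x, hx, -⟩ := Option.mem_map.1 hd
        obtain ⟨c, hc⟩ := h₃ x hx
        exact ⟨.rfind' c, by rw [encodeO, hc]; omega⟩
      · cases hd

theorem primrec_substNum : Primrec₂ substNum := by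
  have lt₅ : PrimrecPred fun x : Code × List (Option Code) => x.2.length < 5 :=
    Primrec.nat_lt.comp (Primrec.list_length.comp .snd) (.const 5)
  have hlen : Primrec fun x : Code × List (Option Code) => x.2.length :=
    Primrec.list_length.comp .snd
  have hm : Primrec fun x : Code × List (Option Code) => x.2.length / 5 - 1 :=
    Primrec.nat_sub.comp (Primrec.nat_div.comp hlen (.const 5)) (.const 1)
  have look {g : Code × List (Option Code) → ℕ} (hg : Primrec g) :
      Primrec fun x : Code × List (Option Code) => (x.2[g x]?).getD none :=
    Primrec.option_getD.comp (Primrec.list_getElem?.comp .snd hg) (.const none)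
  have hbin {f : Code → Code → Code} (hf : Primrec₂ f) :
      Primrec fun x : (Code × ℕ) × Option Code × Option Code × Option Code =>
        x.2.1.bind fun u => x.2.2.1.map fun v => f u v :=
    Primrec.option_bind (Primrec.fst.comp .snd) (Primrec.option_map
      (Primrec.fst.comp (Primrec.snd.comp (Primrec.snd.comp .fst)))
      (hf.comp (Primrec.snd.comp .fst) .snd).to₂).to₂
  have hstep : Primrec fun x : (Code × ℕ) × Option Code × Option Code × Option Code =>
      substNumStep x.1.1 x.1.2 x.2.1 x.2.2.1 x.2.2.2 := by
    have hn : Primrec fun x : (Code × ℕ) × Option Code × Option Code × Option Code => x.1.2 :=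
      Primrec.snd.comp .fst
    have heq (k : ℕ) : PrimrecPred
        fun x : (Code × ℕ) × Option Code × Option Code × Option Code => x.1.2 = k :=
      Primrec.eq.comp hn (.const k)
    have hmod (k : ℕ) : PrimrecPred
        fun x : (Code × ℕ) × Option Code × Option Code × Option Code => x.1.2 % 5 = k :=
      Primrec.eq.comp (Primrec.nat_mod.comp hn (.const 5)) (.const k)
    refine .ite (heq 0) (.const _) <| .ite (heq 1) (.const _) <| .ite (heq 2) (.const _) <|
      .ite (heq 3) (.const _) <| .ite (heq 4) (Primrec.option_some.comp (Primrec.fst.comp .fst)) <|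
      .ite (hmod 0) (hbin Code.primrec₂_pair) <| .ite (hmod 1) (hbin Code.primrec₂_comp) <|
      .ite (hmod 2) (hbin Code.primrec₂_prec) <| .ite (hmod 3) ?_ (.const none)
    exact Primrec.option_map (Primrec.snd.comp (Primrec.snd.comp .snd))
      (Code.primrec_rfind'.comp .snd).to₂
  refine Primrec.nat_strong_rec substNum (g := fun q L =>
    some (if L.length < 5 then substNumStep q L.length none none none
      else substNumStep q L.length ((L[(L.length / 5 - 1).unpair.1]?).getD none)
        ((L[(L.length / 5 - 1).unpair.2]?).getD none) ((L[L.length / 5 - 1]?).getD none))) ?_ ?_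
  · refine Primrec.option_some.comp (.ite lt₅ ?_ ?_)
    · exact hstep.comp (.pair (.pair .fst hlen) (.const (none, none, none)))
    · exact hstep.comp (.pair (.pair .fst hlen) (.pair (look (Primrec.fst.comp
        (Primrec.unpair.comp hm))) (.pair (look (Primrec.snd.comp (Primrec.unpair.comp hm)))
        (look hm))))
  · intro q n
    conv_rhs => rw [substNum]
    simp only [List.length_map, List.length_range, Option.some_inj, dite_eq_ite]
    split_ifs with h
    · rfl
    · have look {i : ℕ} (hi : i < n) :
          (((List.range n).map (substNum q))[i]?).getD none = substNum q i := by
        simp [hi]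
      rw [look, look, look]
      · omega
      · have := Nat.unpair_right_le (n / 5 - 1); omega
      · have := Nat.unpair_left_le (n / 5 - 1); omega

/-- The program with Gödel number `n`, run on input `n` with the program `q` in place of the
oracle. -/
def selfEval (q : Code) (n : ℕ) : Part ℕ :=
  (substNum q n : Part Code).bind fun c => c.eval n

theorem partrec_selfEval : Partrec₂ selfEval :=
  Partrec.bind (Computable.ofOption primrec_substNum.to_comp)
    (Code.eval_part.comp Computable.snd (Computable.snd.comp Computable.fst)).to₂

theorem selfEval_dom_iff {q : Code} {n : ℕ} :
    (selfEval q n).Dom ↔ ∃ c, encodeO c = n ∧ ((c.subst q).eval n).Dom := by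
  constructor
  · intro h
    obtain ⟨y, hy⟩ := Part.dom_iff_mem.1 h
    obtain ⟨d, hd, hy⟩ := Part.mem_bind_iff.1 hy
    rw [Part.mem_coe] at hd
    obtain ⟨c, rfl⟩ := exists_encodeO_of_substNum q n d hd
    rw [substNum_encodeO, Option.mem_some_iff] at hd
    exact ⟨c, rfl, hd ▸ Part.dom_iff_mem.2 ⟨y, hy⟩⟩
  · rintro ⟨c, rfl, h⟩
    simpa [selfEval, substNum_encodeO] using h

theorem rePred_jump_empty : REPred fun n => n ∈ jump ∅ := by
  refine (partrec_selfEval.comp (Computable.const Code.zero) Computable.id).dom_re.of_eq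
    fun n => ?_
  have h : ∀ x, Code.zero.eval x = Part.some (chi ∅ x) := fun x => by simp [Code.eval, chi]; rfl
  simp only [selfEval_dom_iff, eval_subst_of_total h]
  rfl

/-! ### Finite strings as oracles -/

/-- The partial function given by a finite binary string. -/
def stringLookup (σ : List Bool) (i : ℕ) : Option ℕ :=
  σ[i]?.map fun b => cond b 1 0

theorem exists_stringOracle : ∃ q : List Bool → Code, Primrec q ∧
    ∀ σ i, (q σ).eval i = (stringLookup σ i : Part ℕ) := by
  have h : Primrec fun p : List Bool × ℕ => stringLookup p.1 p.2 :=
    Primrec.option_map (Primrec.list_getElem?.comp .fst .snd)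
      (Primrec.cond .snd (.const 1) (.const 0)).to₂
  obtain ⟨c, hc⟩ := Code.exists_code.1 (Computable.ofOption h.to_comp)
  refine ⟨fun σ => c.curry (encode σ), Code.primrec₂_curry.comp (.const c) .encode,
    fun σ i => ?_⟩
  have hdecode : decode (α := List Bool × ℕ) (Nat.pair (encode σ) i) = some (σ, i) :=
    encodek (σ, i)
  rw [Code.eval_curry, hc]
  beta_reduce
  rw [hdecode]
  simp [Part.map_id']

theorem seg_succ (X : Set ℕ) (k : ℕ) : seg X (k + 1) = seg X k ++ [decide (chi X k = 1)] := by
  by_cases h : k ∈ X <;> simp [seg, List.range_succ, chi, h]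

theorem seg_prefix_seg (X : Set ℕ) {k l : ℕ} (h : k ≤ l) : seg X k <+: seg X l := by
  induction h with
  | refl => exact List.prefix_rfl
  | step _ ih => exact ih.trans (seg_succ X _ ▸ List.prefix_append _ _)

theorem stringLookup_seg (X : Set ℕ) (k i : ℕ) :
    stringLookup (seg X k) i = if i < k then some (chi X i) else none := by
  by_cases h : i < k <;> by_cases hi : i ∈ X <;> simp [stringLookup, seg, chi, h, hi]

/-- The initial segments of `X` are uniformly computable from `X`. -/
theorem ComputableFrom.encode_seg {X : Set ℕ} {O : ℕ → ℕ} (hX : ComputableFrom O (chi X)) :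
    ComputableFrom O fun k => encode (seg X k) := by
  have happ : Primrec₂ fun (s b : ℕ) =>
      encode (((decode (α := List Bool) s).getD []) ++ [decide (b = 1)]) :=
    Primrec.encode.comp (Primrec.list_append.comp
      (Primrec.option_getD.comp (Primrec.decode.comp .fst) (.const []))
      (Primrec.list_cons.comp (Primrec.eq.comp .snd (.const 1)).decide (.const [])))
  refine .prec (encode ([] : List Bool))
    (.comp₂ happ (.of_primrec (Primrec.snd.comp .unpair))
      (hX.comp (.of_primrec (Primrec.fst.comp .unpair)))) rfl fun n => ?_
  simp [seg_succ]

/-! ### The jump of a 1-generic -/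

theorem join_jump_empty_turingLE_jump (X : Set ℕ) : TuringLE (join (jump ∅) X) (jump X) := by
  obtain ⟨f, hf, hf'⟩ := rePred_jump_empty.exists_reduction_to_jump
  obtain ⟨g, hg, hg'⟩ := exists_reduction_to_own_jump
  refine .of_reduction (f := fun n => if n % 2 = 0 then f (n / 2) else g (n / 2)) ?_ fun n => ?_
  · have hdiv : Primrec fun n : ℕ => n / 2 := Primrec.nat_div.comp .id (.const 2)
    exact .ite (Primrec.eq.comp (Primrec.nat_mod.comp .id (.const 2)) (.const 0))
      (hf.comp hdiv) (hg.comp hdiv)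
  · rcases Nat.even_or_odd' n with ⟨k, rfl | rfl⟩
    · have h := hf' X k
      simp only [encode_nat] at h
      have hodd (m : ℕ) : 2 * k ≠ 2 * m + 1 := by omega
      simp [join, h, hodd]
    · have heven (m : ℕ) : 2 * k + 1 ≠ 2 * m := by omega
      simp [join, heven, hg', Nat.add_mod, Nat.mul_add_div]

theorem ComputableFrom.chi_join_left (A B : Set ℕ) :
    ComputableFrom (chi (join A B)) (chi A) := by
  have h := ComputableFrom.oracle (O := chi (join A B)) |>.comp
    (.of_primrec Primrec.nat_double)
  have heq (n : ℕ) : chi (join A B) (2 * n) = chi A n := by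
    have hodd (m : ℕ) : 2 * n ≠ 2 * m + 1 := by omega
    simp [chi, join, hodd]
  simpa only [heq] using h

theorem ComputableFrom.chi_join_right (A B : Set ℕ) :
    ComputableFrom (chi (join A B)) (chi B) := by
  have h := ComputableFrom.oracle (O := chi (join A B)) |>.comp
    (.of_primrec Primrec.nat_double_succ)
  have heq (n : ℕ) : chi (join A B) (2 * n + 1) = chi B n := by
    have heven (m : ℕ) : 2 * n + 1 ≠ 2 * m := by omega
    simp [chi, join, heven]
  simpa only [heq] using h

/-- A c.e. set of pairs of a number and a string can be decided, along initial segments of `X`,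
from `0′ ⊕ X`. -/
theorem REPred.computableFrom_seg {p : ℕ × List Bool → Prop} (hp : REPred p) (X : Set ℕ) :
    ComputableFrom (chi (join (jump ∅) X))
      (chi {m | p (m.unpair.1, seg X m.unpair.2)}) := by
  obtain ⟨f, hf, hf'⟩ := hp.exists_reduction_to_jump
  have h := (ComputableFrom.chi_join_left (jump ∅) X).comp <| (ComputableFrom.of_primrec hf).comp <|
    (ComputableFrom.of_primrec (Primrec.fst.comp .unpair)).pair <|
    (ComputableFrom.chi_join_right (jump ∅) X).encode_seg.comp
      (.of_primrec (Primrec.snd.comp .unpair))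
  have heq (m : ℕ) : chi (jump ∅) (f (Nat.pair m.unpair.1 (encode (seg X m.unpair.2)))) =
      chi {m | p (m.unpair.1, seg X m.unpair.2)} m := by
    have := hf' ∅ (m.unpair.1, seg X m.unpair.2)
    simp only [encode_prod_val, encode_nat] at this
    simp [chi, this]
  simpa only [heq] using h

/-- If `X` meets or avoids every set in a uniformly c.e. sequence `p`, and `A` consists of the
indices of the sets met by `X`, then `A` is computable from `0′ ⊕ X`, provided that sets that
are met at all are met by every long enough initial segment of `X`. -/
theorem REPred.turingLE_of_meetsOrAvoids {p : ℕ × List Bool → Prop} (hp : REPred p) {X A : Set ℕ}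
    (hX : ∀ n, MeetsOrAvoids X {σ | p (n, σ)})
    (hsound : ∀ n k, p (n, seg X k) → n ∈ A)
    (hcomplete : ∀ n ∈ A, ∃ l, ∀ k, l ≤ k → p (n, seg X k)) :
    TuringLE A (join (jump ∅) X) := by
  have hext : REPred fun x : ℕ × List Bool => ∃ τ, p (x.1, x.2 ++ τ) := by
    have hcomp : Computable fun y : (ℕ × List Bool) × List Bool => (y.1.1, y.1.2 ++ y.2) :=
      (Primrec.pair (Primrec.fst.comp .fst)
        (Primrec.list_append.comp (Primrec.snd.comp .fst) .snd)).to_comp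
    exact REPred.exists (p := fun y : (ℕ × List Bool) × List Bool => p (y.1.1, y.1.2 ++ y.2))
      (Partrec.comp hp hcomp)
  have h₁ := hp.computableFrom_seg X
  have h₂ := hext.computableFrom_seg X
  have hsearch : Primrec₂ fun a b : ℕ => b * (1 - a) :=
    Primrec.nat_mul.comp .snd (Primrec.nat_sub.comp (.const 1) .fst)
  have hex (n : ℕ) : ∃ k, chi {m | ∃ τ, p (m.unpair.1, seg X m.unpair.2 ++ τ)} (Nat.pair n k) *
      (1 - chi {m | p (m.unpair.1, seg X m.unpair.2)} (Nat.pair n k)) = 0 := by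
    obtain ⟨k, hk | hk⟩ := hX n
    · have hk' : p (n, seg X k) := hk
      exact ⟨k, by simp [chi, hk']⟩
    · have hk' (τ : List Bool) : ¬ p (n, seg X k ++ τ) := hk _ (List.prefix_append _ _)
      exact ⟨k, by simp [chi, hk']⟩
  obtain ⟨c, hc⟩ := h₁.comp <|
    (ComputableFrom.of_primrec Primrec.id).pair ((h₁.comp₂ hsearch h₂).find hex)
  refine ⟨c, fun n => ?_⟩
  rw [hc]
  have hfind := Nat.find_spec (hex n)
  set k := Nat.find (hex n)
  have hiff : n ∈ A ↔ p (n, seg X k) := by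
    refine ⟨fun hn => ?_, hsound n k⟩
    by_contra hk
    obtain ⟨l, hl⟩ := hcomplete n hn
    have hno : ¬ ∃ τ, p (n, seg X k ++ τ) := fun h => by simp [chi, hk, h] at hfind
    obtain ⟨τ, hτ⟩ := seg_prefix_seg X (le_max_left k l)
    exact hno ⟨τ, hτ ▸ hl _ (le_max_right k l)⟩
  simp [chi, hiff, k]

theorem jump_turingLE_join_jump_empty {X : Set ℕ} (hX : OneGenericIn ∅ X) :
    TuringLE (jump X) (join (jump ∅) X) := by
  obtain ⟨q, hq, hq'⟩ := exists_stringOracle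
  have hpart : Partrec fun x : ℕ × List Bool => selfEval (q x.2) x.1 :=
    partrec_selfEval.comp (hq.to_comp.comp Computable.snd) Computable.fst
  have hmem (k i : ℕ) (y : ℕ) : y ∈ (q (seg X k)).eval i ↔ i < k ∧ y = chi X i := by
    rw [hq', stringLookup_seg, Part.mem_coe]
    by_cases h : i < k <;> simp [h, eq_comm]
  refine hpart.dom_re.turingLE_of_meetsOrAvoids (fun n => hX _ ?_) (fun n k h => ?_) ?_
  · obtain ⟨c, hc⟩ := Code.exists_code.1 <| hpart.comp <|
      Computable.pair (Computable.const n) (Computable.id (α := List Bool))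
    refine ⟨.ofCode c, fun σ => ?_⟩
    rw [oeval_ofCode, hc]
    simp [Part.map]
  · obtain ⟨c, hc, h⟩ := selfEval_dom_iff.1 h
    obtain ⟨y, hy⟩ := Part.dom_iff_mem.1 h
    exact ⟨c, hc, Part.dom_iff_mem.2 ⟨y, mem_oeval_of_mem_eval_subst
      (fun i z hz => ((hmem k i z).1 hz).2) c _ _ hy⟩⟩
  · rintro n ⟨c, hc, h⟩
    obtain ⟨y, hy⟩ := Part.dom_iff_mem.1 h
    obtain ⟨K, hK⟩ := exists_use c _ _ hy
    exact ⟨K, fun k hk => selfEval_dom_iff.2 ⟨c, hc, Part.dom_iff_mem.2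
      ⟨y, hK _ fun i hi => (hmem k i _).2 ⟨hi.trans_le hk, rfl⟩⟩⟩⟩

/-- **The jump of a 1-generic.** If `X ⊆ ℕ` is `1`-generic, then `X′ ≡ᵀ 0′ ⊕ X`. -/
theorem jump_of_one_generic (X : Set ℕ) (hX : NGeneric 1 X) :
    TuringEquiv (jump X) (join (jump ∅) X) := by
  exact ⟨jump_turingLE_join_jump_empty hX, join_jump_empty_turingLE_jump X⟩
end

section
/- If X is n-generic and Y is 1-generic relative to X ⊕ 0^(n−1), then X ⊕ Y is n-generic. -/
open Classical

/-- The computation of the code `c` from the finite part `L` of an oracle. Queries beyond `L` and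
unbounded searches longer than `L` are cut off. -/
def ostage : OCode → List ℕ → ℕ → Option ℕ
  | .zero, _, _ => some 0
  | .succ, _, n => some (n + 1)
  | .left, _, n => some n.unpair.1
  | .right, _, n => some n.unpair.2
  | .oracle, L, n => L[n]?
  | .pair cf cg, L, n => (ostage cf L n).bind fun a => (ostage cg L n).map fun b => Nat.pair a b
  | .comp cf cg, L, n => (ostage cg L n).bind fun a => ostage cf L a
  | .prec cf cg, L, n =>
    n.unpair.2.rec (ostage cf L n.unpair.1) fun y IH =>
      IH.bind fun i => ostage cg L (Nat.pair n.unpair.1 (Nat.pair y i))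
  | .rfind' cf, L, n =>
    let i := (List.range L.length).findIdx fun j =>
      (ostage cf L (Nat.pair n.unpair.1 (j + n.unpair.2))).getD 0 == 0
    if ostage cf L (Nat.pair n.unpair.1 (i + n.unpair.2)) = some 0 then some (i + n.unpair.2)
    else none

theorem primrec_ostage (c : OCode) : Primrec₂ (ostage c) := by
  induction c with
  | zero => exact Primrec₂.const (some 0)
  | succ => exact Primrec.option_some.comp (Primrec.succ.comp Primrec.snd)
  | left => exact Primrec.option_some.comp (Primrec.fst.comp (Primrec.unpair.comp Primrec.snd))
  | right => exact Primrec.option_some.comp (Primrec.snd.comp (Primrec.unpair.comp Primrec.snd))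
  | oracle => exact Primrec.list_getElem?
  | pair cf cg hf hg =>
    refine Primrec.option_bind hf ?_
    refine Primrec.option_map (hg.comp (Primrec.fst.comp Primrec.fst)
      (Primrec.snd.comp Primrec.fst)) ?_
    exact Primrec₂.natPair.comp (Primrec.snd.comp Primrec.fst) Primrec.snd
  | comp cf cg hf hg =>
    exact Primrec.option_bind hg (hf.comp (Primrec.fst.comp Primrec.fst) Primrec.snd)
  | prec cf cg hf hg =>
    have hu : Primrec fun p : List ℕ × ℕ => p.2.unpair := Primrec.unpair.comp Primrec.snd
    have hstep : Primrec₂ fun (p : List ℕ × ℕ) (q : ℕ × Option ℕ) =>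
        q.2.bind fun i => ostage cg p.1 (Nat.pair p.2.unpair.1 (Nat.pair q.1 i)) :=
      Primrec.option_bind (Primrec.snd.comp Primrec.snd)
        (hg.comp (Primrec.fst.comp (Primrec.fst.comp Primrec.fst))
          (Primrec₂.natPair.comp (Primrec.fst.comp (hu.comp (Primrec.fst.comp Primrec.fst)))
            (Primrec₂.natPair.comp (Primrec.fst.comp (Primrec.snd.comp Primrec.fst))
              Primrec.snd)))
    exact Primrec.nat_rec' (Primrec.snd.comp hu) (hf.comp Primrec.fst (Primrec.fst.comp hu)) hstep
  | rfind' cf hf =>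
    have hu : Primrec fun p : List ℕ × ℕ => p.2.unpair := Primrec.unpair.comp Primrec.snd
    have hv : Primrec₂ fun (p : List ℕ × ℕ) (j : ℕ) =>
        ostage cf p.1 (Nat.pair p.2.unpair.1 (j + p.2.unpair.2)) :=
      hf.comp (Primrec.fst.comp Primrec.fst)
        (Primrec₂.natPair.comp (Primrec.fst.comp (hu.comp Primrec.fst))
          (Primrec.nat_add.comp Primrec.snd (Primrec.snd.comp (hu.comp Primrec.fst))))
    have hi : Primrec fun p : List ℕ × ℕ => (List.range p.1.length).findIdx fun j =>
        (ostage cf p.1 (Nat.pair p.2.unpair.1 (j + p.2.unpair.2))).getD 0 == 0 :=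
      Primrec.list_findIdx (Primrec.list_range.comp (Primrec.list_length.comp Primrec.fst))
        (Primrec.beq.comp (Primrec.option_getD.comp hv (Primrec.const 0)) (Primrec.const 0))
    exact Primrec.ite (Primrec.eq.comp (hv.comp Primrec.id hi) (Primrec.const (some 0)))
      (Primrec.option_some.comp (Primrec.nat_add.comp hi (Primrec.snd.comp hu)))
      (Primrec.const none)

theorem oeval_comp_of_eq {O : ℕ → ℕ} {cf cg : OCode} {n m : ℕ} (h : oeval O cg n = Part.some m) :
    oeval O (.comp cf cg) n = oeval O cf m := by
  change (oeval O cg n).bind (oeval O cf) = _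
  rw [h]
  exact Part.bind_some _ _

theorem oeval_pair_of_eq {O : ℕ → ℕ} {cf cg : OCode} {n a b : ℕ} (ha : oeval O cf n = Part.some a)
    (hb : oeval O cg n = Part.some b) : oeval O (.pair cf cg) n = Part.some (Nat.pair a b) := by
  simp [oeval, ha, hb, Seq.seq]

theorem oeval_prec_zero (O : ℕ → ℕ) (cf cg : OCode) (a : ℕ) :
    oeval O (.prec cf cg) (Nat.pair a 0) = oeval O cf a := by
  simp [oeval, Nat.unpaired]

theorem oeval_prec_succ_of_eq {O : ℕ → ℕ} {cf cg : OCode} {a y i : ℕ}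
    (h : oeval O (.prec cf cg) (Nat.pair a y) = Part.some i) :
    oeval O (.prec cf cg) (Nat.pair a (y + 1)) = oeval O cg (Nat.pair a (Nat.pair y i)) := by
  simp only [oeval, Nat.unpaired, Nat.unpair_pair] at h ⊢
  rw [h]
  exact Part.bind_some _ _

theorem mem_oeval_rfind' {O : ℕ → ℕ} {cf : OCode} {n m : ℕ} :
    m ∈ oeval O (.rfind' cf) n ↔ ∃ i, 0 ∈ oeval O cf (Nat.pair n.unpair.1 (i + n.unpair.2)) ∧
      (∀ j < i, ∃ v ≠ 0, v ∈ oeval O cf (Nat.pair n.unpair.1 (j + n.unpair.2))) ∧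
      i + n.unpair.2 = m := by
  have hrf (i : ℕ) : i ∈ (Nat.rfind fun j => (fun x => decide (x = 0)) <$>
        oeval O cf (Nat.pair n.unpair.1 (j + n.unpair.2))) ↔
      0 ∈ oeval O cf (Nat.pair n.unpair.1 (i + n.unpair.2)) ∧
        ∀ j < i, ∃ v ≠ 0, v ∈ oeval O cf (Nat.pair n.unpair.1 (j + n.unpair.2)) := by
    refine Nat.mem_rfind.trans ?_
    simp [Part.mem_map_iff, and_comm]
  simp only [oeval, Nat.unpaired, Part.mem_map_iff]
  exact exists_congr fun i => by rw [hrf, and_assoc]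

theorem mem_oeval_of_ostage {O : ℕ → ℕ} {k : ℕ} (c : OCode) {n m : ℕ}
    (h : ostage c ((List.range k).map O) n = some m) : m ∈ oeval O c n := by
  induction c generalizing n m with
  | zero | succ | left | right =>
    simp only [ostage, Option.some.injEq] at h
    subst h
    exact Part.mem_some _
  | oracle =>
    simp only [ostage, List.getElem?_map, Option.map_eq_some_iff, List.getElem?_eq_some_iff] at h
    obtain ⟨a, ⟨_, rfl⟩, rfl⟩ := h
    simp [oeval]
  | pair cf cg hf hg =>
    simp only [ostage, Option.bind_eq_some_iff, Option.map_eq_some_iff] at h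
    obtain ⟨a, ha, b, hb, rfl⟩ := h
    simp only [oeval, Part.map_eq_map, Seq.seq, Part.mem_bind_iff, Part.mem_map_iff]
    exact ⟨_, ⟨a, hf ha, rfl⟩, b, hg hb, rfl⟩
  | comp cf cg hf hg =>
    simp only [ostage, Option.bind_eq_some_iff] at h
    obtain ⟨a, ha, hb⟩ := h
    exact Part.mem_bind_iff.2 ⟨a, hg ha, hf hb⟩
  | prec cf cg hf hg =>
    simp only [ostage] at h
    simp only [oeval, Nat.unpaired]
    generalize n.unpair.1 = a at *
    generalize n.unpair.2 = j at *
    induction j generalizing m with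
    | zero => exact hf h
    | succ j ih =>
      obtain ⟨i, hi, h⟩ := Option.bind_eq_some_iff.1 h
      exact Part.mem_bind_iff.2 ⟨i, ih hi, hg h⟩
  | rfind' cf hf =>
    simp only [ostage] at h
    split_ifs at h with h0
    refine mem_oeval_rfind'.2 ⟨_, hf h0, fun j hj => ?_, Option.some.inj h⟩
    have := List.not_of_lt_findIdx hj
    rw [List.getElem_range] at this
    obtain ⟨v, hv⟩ : ∃ v, ostage cf ((List.range k).map O)
        (Nat.pair n.unpair.1 (j + n.unpair.2)) = some v := by
      rw [← Option.isSome_iff_exists]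
      by_contra hn
      simp [Option.not_isSome_iff_eq_none.1 hn] at this
    exact ⟨v, by simpa [hv] using this, hf hv⟩

theorem eventually_ostage_of_mem_oeval {O : ℕ → ℕ} (c : OCode) {n m : ℕ} (h : m ∈ oeval O c n) :
    ∀ᶠ k in Filter.atTop, ostage c ((List.range k).map O) n = some m := by
  induction c generalizing n m with
  | zero | succ | left | right =>
    obtain rfl := Part.mem_some_iff.1 h
    exact Filter.Eventually.of_forall fun _ => rfl
  | oracle =>
    obtain rfl := Part.mem_some_iff.1 h
    filter_upwards [Filter.eventually_gt_atTop n] with k hk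
    simp [ostage, List.getElem?_range hk]
  | pair cf cg hf hg =>
    simp only [oeval, Part.map_eq_map, Seq.seq, Part.mem_bind_iff, Part.mem_map_iff] at h
    obtain ⟨_, ⟨a, ha, rfl⟩, b, hb, rfl⟩ := h
    filter_upwards [hf ha, hg hb] with k h1 h2
    simp [ostage, h1, h2]
  | comp cf cg hf hg =>
    obtain ⟨a, ha, hb⟩ := Part.mem_bind_iff.1 h
    filter_upwards [hf hb, hg ha] with k h1 h2
    simp [ostage, h1, h2]
  | prec cf cg hf hg =>
    simp only [oeval, Nat.unpaired] at h
    simp only [ostage]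
    generalize n.unpair.1 = a at *
    generalize n.unpair.2 = j at *
    induction j generalizing m with
    | zero => exact hf h
    | succ j ih =>
      obtain ⟨i, hi, h⟩ := Part.mem_bind_iff.1 h
      filter_upwards [ih hi, hg h] with k h1 h2
      exact Option.bind_eq_some_iff.2 ⟨i, h1, h2⟩
  | rfind' cf hf =>
    obtain ⟨i, hz, hlt, rfl⟩ := mem_oeval_rfind'.1 h
    have hlt' : ∀ᶠ k in Filter.atTop, ∀ j ∈ Finset.range i, ∃ v, v ≠ 0 ∧
        ostage cf ((List.range k).map O) (Nat.pair n.unpair.1 (j + n.unpair.2)) = some v := by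
      refine (Filter.eventually_all_finset _).2 fun j hj => ?_
      obtain ⟨v, hv0, hv⟩ := hlt j (Finset.mem_range.1 hj)
      filter_upwards [hf hv] with k hk
      exact ⟨v, hv0, hk⟩
    filter_upwards [hf hz, hlt', Filter.eventually_gt_atTop i] with k h1 h2 h3
    have hidx : ((List.range ((List.range k).map O).length).findIdx fun j =>
        (ostage cf ((List.range k).map O) (Nat.pair n.unpair.1 (j + n.unpair.2))).getD 0 == 0)
          = i := by
      rw [List.findIdx_eq (by simpa using h3)]
      refine ⟨by simp [h1], fun j hj => ?_⟩
      obtain ⟨v, hv0, hv⟩ := h2 j (Finset.mem_range.2 hj)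
      simp [hv, hv0]
    simp only [ostage, hidx, h1, if_true]

theorem exists_code_of_primrec {f : ℕ → ℕ} (hf : Nat.Primrec f) :
    ∃ c : OCode, ∀ O n, oeval O c n = Part.some (f n) := by
  induction hf with
  | zero => exact ⟨.zero, fun _ _ => rfl⟩
  | succ => exact ⟨.succ, fun _ _ => rfl⟩
  | left => exact ⟨.left, fun _ _ => rfl⟩
  | right => exact ⟨.right, fun _ _ => rfl⟩
  | pair _ _ hf hg =>
    obtain ⟨c, hc⟩ := hf
    obtain ⟨d, hd⟩ := hg
    exact ⟨.pair c d, fun O n => oeval_pair_of_eq (hc O n) (hd O n)⟩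
  | comp _ _ hf hg =>
    obtain ⟨c, hc⟩ := hf
    obtain ⟨d, hd⟩ := hg
    exact ⟨.comp c d, fun O n => (oeval_comp_of_eq (hd O n)).trans (hc O _)⟩
  | prec _ _ hf hg =>
    obtain ⟨c, hc⟩ := hf
    obtain ⟨d, hd⟩ := hg
    refine ⟨.prec c d, fun O n => ?_⟩
    rw [← Nat.pair_unpair n]
    simp only [Nat.unpaired, Nat.unpair_pair]
    induction n.unpair.2 with
    | zero => exact (oeval_prec_zero _ _ _ _).trans (hc _ _)
    | succ y ih => rw [oeval_prec_succ_of_eq ih, hd]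

open Encodable in
/-- There is a code which computes the initial segments of its oracle. -/
theorem exists_code_initial_segment :
    ∃ c : OCode, ∀ O a k, oeval O c (Nat.pair a k) = Part.some (encode ((List.range k).map O)) := by
  have happ : Primrec fun n : ℕ => encode
      (((decode n.unpair.1 : Option (List ℕ)).getD []) ++ [n.unpair.2]) :=
    Primrec.encode.comp (Primrec.list_concat.comp
      (Primrec.option_getD.comp (Primrec.decode.comp (Primrec.fst.comp Primrec.unpair))
        (Primrec.const [])) (Primrec.snd.comp Primrec.unpair))
  obtain ⟨e, he⟩ := exists_code_of_primrec (Primrec.nat_iff.1 happ)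
  obtain ⟨z, hz⟩ := exists_code_of_primrec
    (Primrec.nat_iff.1 (Primrec.const (encode ([] : List ℕ))))
  refine ⟨.prec z (.comp e (.pair (.comp .right .right)
    (.comp .oracle (.comp .left .right)))), fun O a k => ?_⟩
  induction k with
  | zero => rw [oeval_prec_zero, hz]; rfl
  | succ k ih =>
    have hr (m : ℕ) : oeval O .right m = Part.some m.unpair.2 := rfl
    have hl (m : ℕ) : oeval O .left m = Part.some m.unpair.1 := rfl
    have ho (m : ℕ) : oeval O .oracle m = Part.some (O m) := rfl
    rw [oeval_prec_succ_of_eq ih, oeval_comp_of_eq (oeval_pair_of_eq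
      ((oeval_comp_of_eq (hr _)).trans (hr _))
      ((oeval_comp_of_eq ((oeval_comp_of_eq (hr _)).trans (hl _))).trans (ho _))), he]
    simp [List.range_succ]

open Encodable in
theorem CEIn.of_exists_stage {Z : Set ℕ} {Q : List Bool × List ℕ → Prop} (hQ : PrimrecPred Q) :
    CEIn Z {s | ∃ k, Q (s, (List.range k).map (chi Z))} := by
  obtain ⟨_, hQ⟩ := hQ
  have hq : Primrec fun n : ℕ => if Q ((decode n.unpair.1 : Option (List Bool)).getD [],
      (decode n.unpair.2 : Option (List ℕ)).getD []) then 0 else 1 :=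
    Primrec.ite (PrimrecPred.comp ⟨_, hQ⟩ (Primrec.pair
      (Primrec.option_getD.comp (Primrec.decode.comp (Primrec.fst.comp Primrec.unpair))
        (Primrec.const []))
      (Primrec.option_getD.comp (Primrec.decode.comp (Primrec.snd.comp Primrec.unpair))
        (Primrec.const [])))) (Primrec.const 0) (Primrec.const 1)
  obtain ⟨q, hq⟩ := exists_code_of_primrec (Primrec.nat_iff.1 hq)
  obtain ⟨i, hi⟩ := exists_code_of_primrec
    (Primrec.nat_iff.1 (Primrec₂.natPair.comp Primrec.id (Primrec.const 0)))
  obtain ⟨l, hl⟩ := exists_code_initial_segment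
  refine ⟨.comp (.rfind' (.comp q (.pair .left l))) i, fun s => ?_⟩
  have heval (k : ℕ) : oeval (chi Z) (.comp q (.pair .left l)) (Nat.pair (encode s) k) =
      Part.some (if Q (s, (List.range k).map (chi Z)) then 0 else 1) := by
    rw [oeval_comp_of_eq (oeval_pair_of_eq (a := encode s) (by simp [oeval]) (hl _ _ _)), hq]
    simp
  rw [oeval_comp_of_eq (hi _ _)]
  constructor
  · intro h
    refine Part.dom_iff_mem.2 ⟨_, mem_oeval_rfind'.2 ⟨Nat.find h, ?_, fun j hj => ?_, rfl⟩⟩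
    · simp [heval, Nat.find_spec h]
    · refine ⟨1, one_ne_zero, ?_⟩
      simp [heval, Nat.find_min h hj]
  · intro h
    obtain ⟨_, h⟩ := Part.dom_iff_mem.1 h
    obtain ⟨i, h, -⟩ := mem_oeval_rfind'.1 h
    refine ⟨i, ?_⟩
    by_contra hQ
    simp [heval, hQ] at h

/-- The relation `R` is the increasing limit of a primitive recursive relation evaluated on the
initial segments of `Z`. -/
def StageApprox {α : Type*} [Primcodable α] (Z : Set ℕ) (R : α → Prop) : Prop :=
  ∃ Q : α × List ℕ → Prop, PrimrecPred Q ∧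
    (∀ a, R a → ∀ᶠ k in Filter.atTop, Q (a, (List.range k).map (chi Z))) ∧
    ∀ a k, Q (a, (List.range k).map (chi Z)) → R a

open Encodable in
theorem CEIn.stageApprox {Z : Set ℕ} {S : Set (List Bool)} (hS : CEIn Z S) :
    StageApprox Z fun s => s ∈ S := by
  obtain ⟨c, hc⟩ := hS
  refine ⟨fun p => (ostage c p.2 (encode p.1)).isSome = true, ?_, fun s hs => ?_, fun s k h => ?_⟩
  · exact Primrec.eq.comp (Primrec.option_isSome.comp ((primrec_ostage c).comp Primrec.snd
      (Primrec.encode.comp Primrec.fst))) (Primrec.const true)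
  · filter_upwards [eventually_ostage_of_mem_oeval c (Part.get_mem ((hc s).1 hs))] with k hk
    simp [hk]
  · obtain ⟨m, hm⟩ := Option.isSome_iff_exists.1 h
    exact (hc s).2 (Part.dom_iff_mem.2 ⟨m, mem_oeval_of_ostage c hm⟩)

namespace StageApprox

variable {α β : Type*} [Primcodable α] [Primcodable β] {Z : Set ℕ}

theorem of_primrecPred {R : α → Prop} (hR : PrimrecPred R) : StageApprox Z R :=
  ⟨fun p => R p.1, hR.comp Primrec.fst, fun _ h => Filter.Eventually.of_forall fun _ => h,
    fun _ _ h => h⟩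

theorem comp {R : β → Prop} (hR : StageApprox Z R) {f : α → β} (hf : Primrec f) :
    StageApprox Z fun a => R (f a) := by
  obtain ⟨Q, hQ, h₁, h₂⟩ := hR
  exact ⟨fun p => Q (f p.1, p.2), hQ.comp (Primrec.pair (hf.comp Primrec.fst) Primrec.snd),
    fun a => h₁ (f a), fun a => h₂ (f a)⟩

theorem and {R R' : α → Prop} (hR : StageApprox Z R) (hR' : StageApprox Z R') :
    StageApprox Z fun a => R a ∧ R' a := by
  obtain ⟨Q, hQ, h₁, h₂⟩ := hR
  obtain ⟨Q', hQ', h₁', h₂'⟩ := hR'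
  exact ⟨fun p => Q p ∧ Q' p, hQ.and hQ', fun a h => (h₁ a h.1).and (h₁' a h.2),
    fun a k h => ⟨h₂ a k h.1, h₂' a k h.2⟩⟩

open Encodable in
theorem ceIn_exists {R : List Bool × List Bool → Prop} (hR : StageApprox Z R) :
    CEIn Z {t | ∃ s, R (t, s)} := by
  obtain ⟨Q, hQ, h₁, h₂⟩ := hR
  have hd : Primrec fun p : List Bool × List ℕ =>
      (decode p.2.length.unpair.1 : Option (List Bool)).getD [] :=
    Primrec.option_getD.comp (Primrec.decode.comp (Primrec.fst.comp (Primrec.unpair.comp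
      (Primrec.list_length.comp Primrec.snd)))) (Primrec.const [])
  convert CEIn.of_exists_stage (Z := Z)
    (hQ.comp (Primrec.pair (Primrec.pair Primrec.fst hd) Primrec.snd)) using 1
  ext t
  constructor
  · rintro ⟨s, hs⟩
    have hlim : Filter.Tendsto (Nat.pair (encode s)) Filter.atTop Filter.atTop :=
      Filter.tendsto_atTop_mono (fun k => Nat.right_le_pair _ k) Filter.tendsto_id
    obtain ⟨k, hk⟩ := (hlim.eventually (h₁ _ hs)).exists
    exact ⟨Nat.pair (encode s) k, by simpa using hk⟩
  · rintro ⟨k, hk⟩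
    exact ⟨_, h₂ _ k hk⟩

end StageApprox

/-- The list of entries at even positions and the list of entries at odd positions. -/
def splitParity {α : Type*} : List α → List α × List α :=
  List.foldr (fun a p => (a :: p.2, p.1)) ([], [])

theorem primrec_splitParity {α : Type*} [Primcodable α] :
    Primrec (splitParity : List α → List α × List α) := by
  refine Primrec.list_foldr (h := fun _ q => (q.1 :: q.2.2, q.2.1)) Primrec.id
    (Primrec.const ([], [])) ?_
  exact Primrec.pair (Primrec.list_cons.comp (Primrec.fst.comp Primrec.snd)
    (Primrec.snd.comp (Primrec.snd.comp Primrec.snd)))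
    (Primrec.fst.comp (Primrec.snd.comp Primrec.snd))

theorem getElem?_splitParity {α : Type*} (l : List α) (i : ℕ) :
    (splitParity l).1[i]? = l[2 * i]? ∧ (splitParity l).2[i]? = l[2 * i + 1]? := by
  induction l generalizing i with
  | nil => simp [splitParity]
  | cons a l ih =>
    have h : splitParity (a :: l) = (a :: (splitParity l).2, (splitParity l).1) := rfl
    rw [h]
    refine ⟨?_, by simpa using (ih i).1⟩
    cases i with
    | zero => simp
    | succ i => simpa [mul_add] using (ih i).2

theorem splitParity_map_range {α : Type*} (f : ℕ → α) (k : ℕ) :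
    splitParity ((List.range k).map f) =
      ((List.range ((k + 1) / 2)).map fun i => f (2 * i),
        (List.range (k / 2)).map fun i => f (2 * i + 1)) := by
  have key (g : ℕ → α) (j i : ℕ) :
      ((List.range j).map g)[i]? = if i < j then some (g i) else none := by
    split_ifs with h
    · simp [List.getElem?_range h]
    · simp only [List.getElem?_eq_none_iff, List.length_map, List.length_range]; omega
  refine Prod.ext (List.ext_getElem? fun i => ?_) (List.ext_getElem? fun i => ?_)
  · rw [(getElem?_splitParity _ i).1, key, key]
    congr 1
    exact propext (by omega)
  · rw [(getElem?_splitParity _ i).2, key, key]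
    congr 1
    exact propext (by omega)

theorem primrecRel_prefix {α : Type*} [Primcodable α] :
    PrimrecRel fun l₁ l₂ : List α => l₁ <+: l₂ := by
  refine PrimrecPred.of_eq (Primrec.eq.comp Primrec.fst (Primrec.list_take.comp
    (Primrec.list_length.comp Primrec.fst) Primrec.snd)) fun p => List.prefix_iff_eq_take.symm

theorem two_mul_mem_join {A B : Set ℕ} {k : ℕ} : 2 * k ∈ join A B ↔ k ∈ A := by
  constructor
  · rintro (⟨j, hj, h⟩ | ⟨j, hj, h⟩)
    · obtain rfl : k = j := by omega
      exact h
    · omega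
  · exact fun h => Or.inl ⟨k, rfl, h⟩

theorem two_mul_add_one_mem_join {A B : Set ℕ} {k : ℕ} : 2 * k + 1 ∈ join A B ↔ k ∈ B := by
  constructor
  · rintro (⟨j, hj, h⟩ | ⟨j, hj, h⟩)
    · omega
    · obtain rfl : k = j := by omega
      exact h
  · exact fun h => Or.inr ⟨k, rfl, h⟩

theorem length_seg (X : Set ℕ) (k : ℕ) : (seg X k).length = k := by simp [seg]

theorem getElem?_seg_of_lt {X : Set ℕ} {k i : ℕ} (h : i < k) :
    (seg X k)[i]? = some (decide (i ∈ X)) := by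
  simp [seg, List.getElem?_range h]

theorem seg_prefix_iff {X : Set ℕ} {k : ℕ} {s : List Bool} :
    seg X k <+: s ↔ ∀ i < k, s[i]? = some (decide (i ∈ X)) := by
  simp [List.prefix_iff_getElem?, seg]

theorem splitParity_map_range_chi_join (A B : Set ℕ) (k : ℕ) :
    splitParity ((List.range k).map (chi (join A B))) =
      ((List.range ((k + 1) / 2)).map (chi A), (List.range (k / 2)).map (chi B)) := by
  rw [splitParity_map_range]
  simp only [chi, two_mul_mem_join, two_mul_add_one_mem_join]
  rfl

theorem map_chi_beq_one (A : Set ℕ) (k : ℕ) :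
    ((List.range k).map (chi A)).map (· == 1) = seg A k := by
  simp only [List.map_map, seg]
  refine List.map_congr_left fun n _ => ?_
  by_cases h : n ∈ A <;> simp [chi, h]

theorem seg_mono (X : Set ℕ) {j k : ℕ} (h : j ≤ k) : seg X j <+: seg X k :=
  seg_prefix_iff.2 fun _ hi => getElem?_seg_of_lt (hi.trans_le h)

theorem eq_decide_of_getElem?_seg {X : Set ℕ} {k i : ℕ} {b : Bool}
    (h : (seg X k)[i]? = some b) : b = decide (i ∈ X) := by
  obtain ⟨hi, -⟩ := List.getElem?_eq_some_iff.1 h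
  rw [getElem?_seg_of_lt (length_seg X k ▸ hi)] at h
  exact (Option.some.inj h).symm

theorem seg_join_eq_of_splitParity {A B : Set ℕ} {s : List Bool} {j k : ℕ}
    (hA : (splitParity s).1 <+: seg A j) (hB : (splitParity s).2 = seg B k) :
    seg (join A B) s.length = s := by
  refine List.IsPrefix.eq_of_length (seg_prefix_iff.2 fun i hi => ?_) (length_seg _ _)
  rw [List.getElem?_eq_getElem hi]
  obtain ⟨m, rfl | rfl⟩ := Nat.even_or_odd' i
  · have h := (getElem?_splitParity s m).1
    rw [List.getElem?_eq_getElem hi] at h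
    obtain ⟨hm, h⟩ := List.getElem?_eq_some_iff.1 h
    have h' := List.prefix_iff_getElem?.1 hA m hm
    rw [← h, eq_decide_of_getElem?_seg h']
    simp only [two_mul_mem_join]
  · have h := (getElem?_splitParity s m).2
    rw [List.getElem?_eq_getElem hi, hB] at h
    rw [eq_decide_of_getElem?_seg h]
    simp only [two_mul_add_one_mem_join]

theorem seg_prefix_splitParity {A B : Set ℕ} {s : List Bool} {k : ℕ}
    (h : seg (join A B) (2 * k) <+: s) :
    seg A k <+: (splitParity s).1 ∧ seg B k <+: (splitParity s).2 := by
  rw [seg_prefix_iff] at h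
  constructor <;> refine seg_prefix_iff.2 fun i hi => ?_
  · rw [(getElem?_splitParity s i).1, h _ (by omega)]
    simp only [two_mul_mem_join]
  · rw [(getElem?_splitParity s i).2, h _ (by omega)]
    simp only [two_mul_add_one_mem_join]

theorem StageApprox.join_right {α : Type*} [Primcodable α] {Z : Set ℕ} {R : α → Prop}
    (hR : StageApprox Z R) (X : Set ℕ) : StageApprox (join X Z) R := by
  obtain ⟨Q, hQ, h₁, h₂⟩ := hR
  refine ⟨fun p => Q (p.1, (splitParity p.2).2), hQ.comp (Primrec.pair Primrec.fst
    (Primrec.snd.comp (primrec_splitParity.comp Primrec.snd))), fun a h => ?_, fun a k h => ?_⟩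
  · simp only [splitParity_map_range_chi_join]
    exact (Nat.tendsto_div_const_atTop two_ne_zero).eventually (h₁ a h)
  · simp only [splitParity_map_range_chi_join] at h
    exact h₂ a _ h

theorem stageApprox_prefix_seg (X Z : Set ℕ) :
    StageApprox (join X Z) fun s : List Bool => ∃ j, s <+: seg X j := by
  refine ⟨fun p => p.1 <+: (splitParity p.2).1.map (· == 1), ?_, fun s h => ?_, fun s k h => ?_⟩
  · exact primrecRel_prefix.comp Primrec.fst (Primrec.list_map
      (Primrec.fst.comp (primrec_splitParity.comp Primrec.snd))
      (Primrec.beq.comp Primrec.snd (Primrec.const 1)))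
  · obtain ⟨j, hj⟩ := h
    filter_upwards [Filter.eventually_ge_atTop (2 * j)] with k hk
    simp only [splitParity_map_range_chi_join, map_chi_beq_one]
    exact hj.trans (seg_mono X (by omega))
  · simp only [splitParity_map_range_chi_join, map_chi_beq_one] at h
    exact ⟨_, h⟩

theorem OneGenericIn.join_of_relative {X Y Z : Set ℕ} (hX : OneGenericIn Z X)
    (hY : OneGenericIn (join X Z) Y) : OneGenericIn Z (join X Y) := by
  intro S hS
  have hfst : Primrec fun p : List Bool × List Bool => (splitParity p.2).1 :=
    Primrec.fst.comp (primrec_splitParity.comp Primrec.snd)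
  have hsnd : Primrec fun p : List Bool × List Bool => (splitParity p.2).2 :=
    Primrec.snd.comp (primrec_splitParity.comp Primrec.snd)
  obtain ⟨k, ⟨s, hs, hsY, j, hsX⟩ | hk⟩ := hY _
    (((hS.stageApprox.join_right X).comp Primrec.snd).and
      ((StageApprox.of_primrecPred (Primrec.eq.comp hsnd Primrec.fst)).and
        ((stageApprox_prefix_seg X Z).comp hfst))).ceIn_exists
  · exact ⟨s.length, Or.inl (by rwa [seg_join_eq_of_splitParity hsX hsY])⟩
  obtain ⟨j, ⟨s, hs, hsX, hsY⟩ | hj⟩ := hX _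
    ((hS.stageApprox.comp Primrec.snd).and
      ((StageApprox.of_primrecPred (Primrec.eq.comp hfst Primrec.fst)).and
        (StageApprox.of_primrecPred
          (primrecRel_prefix.comp (Primrec.const (seg Y k)) hsnd)))).ceIn_exists
  · exact (hk _ hsY ⟨s, hs, rfl, j, hsX.symm ▸ List.prefix_rfl⟩).elim
  refine ⟨2 * max j k, Or.inr fun s h hs => ?_⟩
  obtain ⟨h₁, h₂⟩ := seg_prefix_splitParity h
  exact hj _ ((seg_mono X (le_max_left j k)).trans h₁)
    ⟨s, hs, rfl, (seg_mono Y (le_max_right j k)).trans h₂⟩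

/-- **Joins of relatively generic sets.** If `X` is `n`-generic (`n ≥ 1`) and `Y` is
`1`-generic relative to `X ⊕ 0⁽ⁿ⁻¹⁾`, then `X ⊕ Y` is `n`-generic. -/
theorem join_of_relatively_generic (n : ℕ) (hn : 1 ≤ n) (X Y : Set ℕ)
    (hX : NGeneric n X) (hY : OneGenericIn (join X (zeroJump (n - 1))) Y) :
    NGeneric n (join X Y) := by
  exact OneGenericIn.join_of_relative hX hY
end
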